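/- In the one-boundary setting (ξ₂(t) ≡ X constant and u(X,t) ≠ 0 for all t ∈ [0,T]), assume (H1) holds, (H2) holds at every NZ*-moment of w₁(t) := u(ξ₁(t),t) and (H3) holds at every Z-moment of w₁. Let A = (r,s) ∪ [s,r₁] ∪ (r₁,s₁) ⊂ (0,T) be an A-type interval of w₁. Then Z(t₁) ≥ Z(s) ≥ Z(t₂) > Z(t₃) for all t₁ ∈ (r,s), t₂ ∈ (s,r₁], t₃ ∈ (r₁,s₁). -/

import Mathlib

open Set

/-- spatial partial derivative `u_x` -/
noncomputable def pdx (u : ℝ → ℝ → ℝ) (x t : ℝ) : ℝ := deriv (fun y => u y t) x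

/-- second spatial partial derivative `u_xx` -/
noncomputable def pdxx (u : ℝ → ℝ → ℝ) (x t : ℝ) : ℝ := deriv (fun y => pdx u y t) x

/-- time partial derivative `u_t` -/
noncomputable def pdt (u : ℝ → ℝ → ℝ) (x t : ℝ) : ℝ := deriv (fun s => u x s) t

/-- the closure of the space-time domain `Ω` -/
def domCl (xi1 xi2 : ℝ → ℝ) (T : ℝ) : Set (ℝ × ℝ) :=
  {p : ℝ × ℝ | p.2 ∈ Icc (0:ℝ) T ∧ p.1 ∈ Icc (xi1 p.2) (xi2 p.2)}

/-- the domain together with its lateral boundaries -/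
def domLat (xi1 xi2 : ℝ → ℝ) (T : ℝ) : Set (ℝ × ℝ) :=
  {p : ℝ × ℝ | p.2 ∈ Ioc (0:ℝ) T ∧ p.1 ∈ Icc (xi1 p.2) (xi2 p.2)}

/-- `u` is a classical solution of `u_t = a u_xx + b u_x + c u` on
`Ω = {(x,t) : ξ₁(t) < x < ξ₂(t), 0 < t ≤ T}`: it is continuous on the closure, its
partial derivatives `u_t, u_x, u_xx` exist and are continuous up to the lateral
boundaries, and the equation holds. -/
structure IsClassicalSolution (a b c : ℝ → ℝ → ℝ) (xi1 xi2 : ℝ → ℝ) (T : ℝ)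
    (u : ℝ → ℝ → ℝ) : Prop where
  cont : ContinuousOn (fun p : ℝ × ℝ => u p.1 p.2) (domCl xi1 xi2 T)
  diff_x : ∀ p ∈ domLat xi1 xi2 T, DifferentiableAt ℝ (fun y => u y p.2) p.1
  diff_xx : ∀ p ∈ domLat xi1 xi2 T, DifferentiableAt ℝ (fun y => pdx u y p.2) p.1
  diff_t : ∀ p ∈ domLat xi1 xi2 T, DifferentiableAt ℝ (fun s => u p.1 s) p.2
  cont_x : ContinuousOn (fun p : ℝ × ℝ => pdx u p.1 p.2) (domLat xi1 xi2 T)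
  cont_xx : ContinuousOn (fun p : ℝ × ℝ => pdxx u p.1 p.2) (domLat xi1 xi2 T)
  cont_t : ContinuousOn (fun p : ℝ × ℝ => pdt u p.1 p.2) (domLat xi1 xi2 T)
  eqn : ∀ p ∈ domLat xi1 xi2 T,
    pdt u p.1 p.2 =
      a p.1 p.2 * pdxx u p.1 p.2 + b p.1 p.2 * pdx u p.1 p.2 + c p.1 p.2 * u p.1 p.2

/-- the regularity assumption (1.2): `a, a⁻¹, a_t, a_x, a_xx, b, b_t, b_x, c ∈ L^∞`,
with `a > 0` -/
def Reg12 (a b c : ℝ → ℝ → ℝ) (xi1 xi2 : ℝ → ℝ) (T : ℝ) : Prop :=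
  ∃ M : ℝ, ∀ p ∈ domLat xi1 xi2 T,
    0 < a p.1 p.2 ∧
    DifferentiableAt ℝ (fun y => a y p.2) p.1 ∧
    DifferentiableAt ℝ (fun y => pdx a y p.2) p.1 ∧
    DifferentiableAt ℝ (fun s => a p.1 s) p.2 ∧
    DifferentiableAt ℝ (fun y => b y p.2) p.1 ∧
    DifferentiableAt ℝ (fun s => b p.1 s) p.2 ∧
    |a p.1 p.2| ≤ M ∧ |(a p.1 p.2)⁻¹| ≤ M ∧ |pdt a p.1 p.2| ≤ M ∧ |pdx a p.1 p.2| ≤ M ∧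
    |pdxx a p.1 p.2| ≤ M ∧ |b p.1 p.2| ≤ M ∧ |pdt b p.1 p.2| ≤ M ∧ |pdx b p.1 p.2| ≤ M ∧
    |c p.1 p.2| ≤ M

/-- the set of zeroes of `u(·,t)` in `I(t) = [ξ₁(t), ξ₂(t)]` -/
def zeroSet (u : ℝ → ℝ → ℝ) (xi1 xi2 : ℝ → ℝ) (t : ℝ) : Set ℝ :=
  {x ∈ Icc (xi1 t) (xi2 t) | u x t = 0}

/-- `Z(t)`: the (extended-natural) number of zeroes of `u(·,t)` in `I(t)` -/
noncomputable def Znum (u : ℝ → ℝ → ℝ) (xi1 xi2 : ℝ → ℝ) (t : ℝ) : ℕ∞ :=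
  (zeroSet u xi1 xi2 t).encard

/-- `u(·,s)` has a multiple (degenerate) zero in `I(s)` -/
def HasMultipleZero (u : ℝ → ℝ → ℝ) (xi1 xi2 : ℝ → ℝ) (s : ℝ) : Prop :=
  ∃ x₀ ∈ Icc (xi1 s) (xi2 s), u x₀ s = 0 ∧ pdx u x₀ s = 0

/-- the boundary trace `wᵢ(t) := u(ξᵢ(t), t)` -/
def bdryTrace (u : ℝ → ℝ → ℝ) (xi : ℝ → ℝ) : ℝ → ℝ := fun t => u (xi t) t

/-- some left neighborhood of `s` consists entirely of N-moments -/
def leftN (w : ℝ → ℝ) (s : ℝ) : Prop := ∃ ε > 0, ∀ t ∈ Ioo (s - ε) s, w t ≠ 0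

/-- some left neighborhood of `s` consists entirely of Z-moments -/
def leftZ (w : ℝ → ℝ) (s : ℝ) : Prop := ∃ ε > 0, ∀ t ∈ Ioo (s - ε) s, w t = 0

/-- some right neighborhood of `s` consists entirely of N-moments -/
def rightN (w : ℝ → ℝ) (s : ℝ) : Prop := ∃ ε > 0, ∀ t ∈ Ioo s (s + ε), w t ≠ 0

/-- some right neighborhood of `s` consists entirely of Z-moments -/
def rightZ (w : ℝ → ℝ) (s : ℝ) : Prop := ∃ ε > 0, ∀ t ∈ Ioo s (s + ε), w t = 0

/-- `s` is an NZN-moment of `w` -/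
def IsNZN (w : ℝ → ℝ) (s : ℝ) : Prop := w s = 0 ∧ leftN w s ∧ rightN w s

/-- `s` is a ZZZ-moment of `w` -/
def IsZZZ (w : ℝ → ℝ) (s : ℝ) : Prop := w s = 0 ∧ leftZ w s ∧ rightZ w s

/-- `s` is an NZZ-moment of `w` -/
def IsNZZ (w : ℝ → ℝ) (s : ℝ) : Prop := w s = 0 ∧ leftN w s ∧ rightZ w s

/-- `s` is a ZZN-moment of `w` -/
def IsZZN (w : ℝ → ℝ) (s : ℝ) : Prop := w s = 0 ∧ leftZ w s ∧ rightN w s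

/-- `s` is an NZ*-moment of `w` -/
def IsNZstar (w : ℝ → ℝ) (s : ℝ) : Prop := w s = 0 ∧ leftN w s

/-- (H1): on every nondegenerate closed interval of Z-moments of the boundary trace `w`,
the boundary curve `ξ` is `C¹` -/
def H1cond (w xi : ℝ → ℝ) (T : ℝ) : Prop :=
  ∀ p q : ℝ, 0 ≤ p → p < q → q ≤ T → (∀ t ∈ Icc p q, w t = 0) → ContDiffOn ℝ 1 xi (Icc p q)

/-- (H2) at an NZ*-moment `s` of `u(ξ(·),·)`, with sign `σ = (-1)^i`:
`ξ'(s-0)` exists, and `σ · u_x(ξ(s),s) ≥ 0` (resp. `≤ 0`) if `u(ξ(t),t) > 0`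
(resp. `< 0`) shortly before `s`. -/
def H2at (u : ℝ → ℝ → ℝ) (xi : ℝ → ℝ) (σ s : ℝ) : Prop :=
  (∃ L : ℝ, HasDerivWithinAt xi L (Iio s) s) ∧
  ((∃ ε > 0, ∀ t ∈ Ioo (s - ε) s, 0 < u (xi t) t) → 0 ≤ σ * pdx u (xi s) s) ∧
  ((∃ ε > 0, ∀ t ∈ Ioo (s - ε) s, u (xi t) t < 0) → σ * pdx u (xi s) s ≤ 0)

/-- (H3) at a Z-moment `s` of `u(ξ(·),·)`, with sign `σ = (-1)^i`:
`σ · u(ξ(t),t) · u(x,s) ≤ 0` for `t` slightly after `s` and `x ∈ I(s)` near (but not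
equal to) `ξ(s)`. -/
def H3at (u : ℝ → ℝ → ℝ) (xi1 xi2 xi : ℝ → ℝ) (σ s : ℝ) : Prop :=
  ∃ ε > 0, ∃ δ > 0, ∀ t ∈ Ioo s (s + ε), ∀ x ∈ Icc (xi1 s) (xi2 s),
    x ≠ xi s → |x - xi s| < δ → σ * (u (xi t) t * u x s) ≤ 0

/-- (H3) at a Z-moment `s` for the left boundary (`i = 1`, one-boundary setting):
`-u(ξ₁(t),t) · u(x,s) ≤ 0` for `t` slightly after `s` and `x` slightly to the right
of `ξ₁(s)`. -/
def H3one (u : ℝ → ℝ → ℝ) (xi : ℝ → ℝ) (s : ℝ) : Prop :=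
  ∃ ε > 0, ∃ δ > 0, ∀ t ∈ Ioo s (s + ε), ∀ x : ℝ,
    xi s < x → x - xi s < δ → -(u (xi t) t) * u x s ≤ 0

open Filter Topology

structure Coef (a ax axx at' : ℝ → ℝ → ℝ) (M : ℝ) (D : Set (ℝ × ℝ)) : Prop where
  Mpos : 0 < M
  dx : ∀ x t, (x, t) ∈ D → HasDerivAt (fun y => a y t) (ax x t) x
  dxx : ∀ x t, (x, t) ∈ D → HasDerivAt (fun y => ax y t) (axx x t) x
  dt : ∀ x t, (x, t) ∈ D → HasDerivAt (fun r => a x r) (at' x t) t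
  lo : ∀ x t, (x, t) ∈ D → M⁻¹ ≤ a x t
  hi : ∀ x t, (x, t) ∈ D → a x t ≤ M
  bx : ∀ x t, (x, t) ∈ D → |ax x t| ≤ M
  bxx : ∀ x t, (x, t) ∈ D → |axx x t| ≤ M
  bt : ∀ x t, (x, t) ∈ D → |at' x t| ≤ M

structure Sol (a u ux uxx ut : ℝ → ℝ → ℝ) (M : ℝ) (D : Set (ℝ × ℝ)) : Prop where
  cu : ContinuousOn (fun q : ℝ × ℝ => u q.1 q.2) D
  cux : ContinuousOn (fun q : ℝ × ℝ => ux q.1 q.2) D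
  cuxx : ContinuousOn (fun q : ℝ × ℝ => uxx q.1 q.2) D
  cut : ContinuousOn (fun q : ℝ × ℝ => ut q.1 q.2) D
  dx : ∀ x t, (x, t) ∈ D → HasDerivAt (fun y => u y t) (ux x t) x
  dxx : ∀ x t, (x, t) ∈ D → HasDerivAt (fun y => ux y t) (uxx x t) x
  dt : ∀ x t, (x, t) ∈ D → HasDerivAt (fun r => u x r) (ut x t) t
  ineq : ∀ x t, (x, t) ∈ D → |ut x t - a x t * uxx x t| ≤ M * (|u x t| + |ux x t|)

lemma Coef.mono {a ax axx at' : ℝ → ℝ → ℝ} {M : ℝ} {D D' : Set (ℝ × ℝ)}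
    (h : Coef a ax axx at' M D) (hs : D' ⊆ D) : Coef a ax axx at' M D' :=
  ⟨h.Mpos, fun x t m => h.dx x t (hs m), fun x t m => h.dxx x t (hs m),
   fun x t m => h.dt x t (hs m), fun x t m => h.lo x t (hs m), fun x t m => h.hi x t (hs m),
   fun x t m => h.bx x t (hs m), fun x t m => h.bxx x t (hs m), fun x t m => h.bt x t (hs m)⟩

lemma Sol.mono {a u ux uxx ut : ℝ → ℝ → ℝ} {M : ℝ} {D D' : Set (ℝ × ℝ)}
    (h : Sol a u ux uxx ut M D) (hs : D' ⊆ D) : Sol a u ux uxx ut M D' :=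
  ⟨h.cu.mono hs, h.cux.mono hs, h.cuxx.mono hs, h.cut.mono hs,
   fun x t m => h.dx x t (hs m), fun x t m => h.dxx x t (hs m),
   fun x t m => h.dt x t (hs m), fun x t m => h.ineq x t (hs m)⟩

lemma Sol.neg {a u ux uxx ut : ℝ → ℝ → ℝ} {M : ℝ} {D : Set (ℝ × ℝ)}
    (h : Sol a u ux uxx ut M D) :
    Sol a (fun x t => -u x t) (fun x t => -ux x t) (fun x t => -uxx x t)
      (fun x t => -ut x t) M D :=
  ⟨h.cu.neg, h.cux.neg, h.cuxx.neg, h.cut.neg,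
   fun x t m => (h.dx x t m).neg, fun x t m => (h.dxx x t m).neg,
   fun x t m => (h.dt x t m).neg, fun x t m => by
    have := h.ineq x t m
    rw [abs_neg, abs_neg, ← abs_neg]
    convert this using 2; ring⟩

/-- rectangle -/
def Rec (α β σ p : ℝ) : Set (ℝ × ℝ) := {q | q.2 ∈ Icc σ p ∧ q.1 ∈ Icc α β}

lemma Coef.refl {a ax axx at' : ℝ → ℝ → ℝ} {M α β σ p : ℝ}
    (h : Coef a ax axx at' M (Rec α β σ p)) :
    Coef (fun x t => a (-x) t) (fun x t => -ax (-x) t) (fun x t => axx (-x) t)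
      (fun x t => at' (-x) t) M (Rec (-β) (-α) σ p) := by
  have hm : ∀ x t, (x, t) ∈ Rec (-β) (-α) σ p → (-x, t) ∈ Rec α β σ p := by
    rintro x t ⟨h1, h2, h3⟩
    exact ⟨h1, by simp at *; linarith, by simp at *; linarith⟩
  refine ⟨h.Mpos, fun x t m => ?_, fun x t m => ?_,
   fun x t m => h.dt _ t (hm x t m), fun x t m => h.lo _ t (hm x t m), fun x t m => h.hi _ t (hm x t m),
   fun x t m => by rw [abs_neg]; exact h.bx _ t (hm x t m), fun x t m => h.bxx _ t (hm x t m), fun x t m => h.bt _ t (hm x t m)⟩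
  · have := (h.dx _ t (hm x t m)).comp x (hasDerivAt_neg x)
    simpa [Function.comp_def] using this
  · have := ((h.dxx _ t (hm x t m)).comp x (hasDerivAt_neg x)).fun_neg
    simpa [Function.comp_def] using this

lemma Sol.refl {a u ux uxx ut : ℝ → ℝ → ℝ} {M α β σ p : ℝ}
    (h : Sol a u ux uxx ut M (Rec α β σ p)) :
    Sol (fun x t => a (-x) t) (fun x t => u (-x) t) (fun x t => -ux (-x) t)
      (fun x t => uxx (-x) t) (fun x t => ut (-x) t) M (Rec (-β) (-α) σ p) := by
  have hm : ∀ x t, (x, t) ∈ Rec (-β) (-α) σ p → (-x, t) ∈ Rec α β σ p := by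
    rintro x t ⟨h1, h2, h3⟩
    exact ⟨h1, by simp at *; linarith, by simp at *; linarith⟩
  have hc : Continuous (fun q : ℝ × ℝ => ((-q.1, q.2) : ℝ × ℝ)) := by fun_prop
  have hmt : MapsTo (fun q : ℝ × ℝ => ((-q.1, q.2) : ℝ × ℝ)) (Rec (-β) (-α) σ p) (Rec α β σ p) :=
    fun q hq => hm q.1 q.2 hq
  refine ⟨h.cu.comp hc.continuousOn hmt, (h.cux.comp hc.continuousOn hmt).neg,
    h.cuxx.comp hc.continuousOn hmt, h.cut.comp hc.continuousOn hmt,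
    fun x t m => ?_, fun x t m => ?_, fun x t m => h.dt _ t (hm x t m), fun x t m => ?_⟩
  · have := (h.dx _ t (hm x t m)).comp x (hasDerivAt_neg x)
    simpa [Function.comp_def] using this
  · have := ((h.dxx _ t (hm x t m)).comp x (hasDerivAt_neg x)).fun_neg
    simpa [Function.comp_def] using this
  · rw [abs_neg]; exact h.ineq _ t (hm x t m)

lemma deriv_nonpos_of_left_min {g : ℝ → ℝ} {g' t : ℝ} (hg : HasDerivAt g g' t)
    (hm : ∀ᶠ r in 𝓝[<] t, g t ≤ g r) : g' ≤ 0 := by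
  have h1 := hg.tendsto_slope
  have h2 : Tendsto (slope g t) (𝓝[<] t) (𝓝 g') :=
    h1.mono_left (nhdsWithin_mono _ (fun x hx => ne_of_lt hx))
  refine le_of_tendsto h2 ?_
  filter_upwards [hm, self_mem_nhdsWithin] with r hr hlt
  rw [slope_def_field]
  exact div_nonpos_of_nonneg_of_nonpos (by linarith) (by simp at hlt; linarith)

lemma second_deriv_nonneg_of_min {k k' : ℝ → ℝ} {k'' x : ℝ}
    (h1 : ∀ᶠ y in 𝓝 x, HasDerivAt k (k' y) y) (h2 : HasDerivAt k' k'' x)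
    (hm : IsLocalMin k x) : k' x = 0 ∧ 0 ≤ k'' := by
  have h0 : k' x = 0 := hm.hasDerivAt_eq_zero h1.self_of_nhds
  refine ⟨h0, ?_⟩
  by_contra hneg
  push Not at hneg
  have hs : Tendsto (slope k' x) (𝓝[>] x) (𝓝 k'') :=
    h2.tendsto_slope.mono_left (nhdsWithin_mono _ (fun x hx => ne_of_gt hx))
  have he : ∀ᶠ y in 𝓝[>] x, k' y < 0 := by
    filter_upwards [hs.eventually_lt_const hneg, self_mem_nhdsWithin] with y hy hgt
    rw [slope_def_field, h0, sub_zero] at hy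
    simp at hgt
    by_contra hc
    push Not at hc
    exact absurd hy (not_lt.mpr (div_nonneg hc (by linarith)))
  have hall : ∀ᶠ y in 𝓝[>] x, k' y < 0 ∧ HasDerivAt k (k' y) y ∧ k x ≤ k y := by
    filter_upwards [he, nhdsWithin_le_nhds h1, nhdsWithin_le_nhds hm] with y a b c
    exact ⟨a, b, c⟩
  obtain ⟨d, hd, hdd⟩ := mem_nhdsGT_iff_exists_Ioo_subset.mp hall
  simp at hd
  have hmid : (x + d) / 2 ∈ Ioo x d := ⟨by linarith, by linarith⟩
  have hcont : ContinuousOn k (Icc x ((x + d) / 2)) := by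
    intro y hy
    rcases eq_or_lt_of_le hy.1 with h | h
    · rw [← h]; exact (h1.self_of_nhds).continuousAt.continuousWithinAt
    · exact (hdd ⟨h, lt_of_le_of_lt hy.2 hmid.2⟩).2.1.continuousAt.continuousWithinAt
  obtain ⟨c, hc, hce⟩ := exists_hasDerivAt_eq_slope k k' hmid.1 hcont
    (fun y hy => (hdd ⟨hy.1, hy.2.trans hmid.2⟩).2.1)
  have h3 := (hdd ⟨hc.1, hc.2.trans hmid.2⟩).1
  have h4 := (hdd hmid).2.2
  rw [hce] at h3
  exact absurd h3 (not_lt.mpr (div_nonneg (by linarith) (by linarith [hmid.1])))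

/-- region between two curves -/
def Reg (A B : ℝ → ℝ) (σ p : ℝ) : Set (ℝ × ℝ) := {q | q.2 ∈ Icc σ p ∧ q.1 ∈ Icc (A q.2) (B q.2)}

lemma Reg_compact {A B : ℝ → ℝ} {σ p : ℝ} (hA : ContinuousOn A (Icc σ p))
    (hB : ContinuousOn B (Icc σ p)) : IsCompact (Reg A B σ p) := by
  have hK : IsCompact ((Icc σ p) ×ˢ (Icc (0:ℝ) 1)) := isCompact_Icc.prod isCompact_Icc
  have himg : IsCompact ((fun q : ℝ × ℝ => ((A q.1 + q.2 * (B q.1 - A q.1), q.1) : ℝ × ℝ)) ''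
      {q ∈ (Icc σ p) ×ˢ (Icc (0:ℝ) 1) | 0 ≤ B q.1 - A q.1}) := by
    have hf : ContinuousOn (fun q : ℝ × ℝ => B q.1 - A q.1) ((Icc σ p) ×ˢ (Icc (0:ℝ) 1)) :=
      (hB.comp continuousOn_fst (fun q hq => hq.1)).sub
        (hA.comp continuousOn_fst (fun q hq => hq.1))
    have hcl : IsCompact {q ∈ (Icc σ p) ×ˢ (Icc (0:ℝ) 1) | 0 ≤ B q.1 - A q.1} := by
      have h1 := hf.preimage_isClosed_of_isClosed hK.isClosed (isClosed_Ici (a := (0:ℝ)))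
      exact hK.of_isClosed_subset h1 (fun q hq => hq.1)
    refine hcl.image_of_continuousOn ?_
    have hA' : ContinuousOn (fun q : ℝ × ℝ => A q.1) ((Icc σ p) ×ˢ (Icc (0:ℝ) 1)) :=
      hA.comp continuousOn_fst (fun q hq => hq.1)
    exact ((hA'.add (continuousOn_snd.mul hf)).prodMk continuousOn_fst).mono (fun q hq => hq.1)
  convert himg using 1
  ext ⟨x, t⟩
  constructor
  · rintro ⟨h1, h2⟩
    simp only at h1 h2
    have hle : A t ≤ B t := h2.1.trans h2.2
    rcases eq_or_lt_of_le hle with h | h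
    · refine ⟨(t, 0), ⟨⟨h1, by simp⟩, by simp [h]⟩, ?_⟩
      have : x = A t := le_antisymm (h ▸ h2.2) h2.1
      simp [this]
    · have hp : 0 < B t - A t := by linarith
      refine ⟨(t, (x - A t) / (B t - A t)), ⟨⟨h1, ?_, ?_⟩, by simp; linarith⟩, ?_⟩
      · exact div_nonneg (by linarith [h2.1]) hp.le
      · rw [div_le_one hp]; linarith [h2.2]
      · simp; field_simp; ring
  · rintro ⟨⟨t', θ⟩, ⟨⟨h1, h2⟩, h3⟩, h4⟩
    simp only [Prod.mk.injEq] at h4 h1 h2 h3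
    obtain ⟨h4, rfl⟩ := h4
    refine ⟨h1, ?_, ?_⟩
    · simp only; rw [← h4]; nlinarith [h2.1]
    · simp only; rw [← h4]; nlinarith [h2.2]

lemma wmp {h hx hxx ht : ℝ → ℝ → ℝ} {A B : ℝ → ℝ} {σ p Λ : ℝ}
    (hA : ContinuousOn A (Icc σ p)) (hB : ContinuousOn B (Icc σ p))
    (hc : ContinuousOn (fun q : ℝ × ℝ => h q.1 q.2) (Reg A B σ p))
    (d : ∀ x t, t ∈ Ioc σ p → x ∈ Ioo (A t) (B t) →
      HasDerivAt (fun y => h y t) (hx x t) x ∧ HasDerivAt (fun y => hx y t) (hxx x t) x ∧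
      HasDerivAt (fun r => h x r) (ht x t) t)
    (key : ∀ x t, t ∈ Ioc σ p → x ∈ Ioo (A t) (B t) → h x t < 0 → hx x t = 0 → 0 ≤ hxx x t →
      Λ * h x t < ht x t)
    (bA : ∀ t ∈ Icc σ p, 0 ≤ h (A t) t) (bB : ∀ t ∈ Icc σ p, 0 ≤ h (B t) t)
    (b0 : ∀ x ∈ Icc (A σ) (B σ), 0 ≤ h x σ) :
    ∀ t ∈ Icc σ p, ∀ x ∈ Icc (A t) (B t), 0 ≤ h x t := by
  by_contra hcon
  push Not at hcon
  obtain ⟨t0, ht0, x0, hx0, hneg⟩ := hcon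
  have hK := Reg_compact hA hB
  have hfc : ContinuousOn (fun q : ℝ × ℝ => Real.exp (-Λ * q.2) * h q.1 q.2) (Reg A B σ p) :=
    ContinuousOn.mul (by fun_prop) hc
  obtain ⟨⟨x, t⟩, ⟨hmt, hmx⟩, hmin⟩ := hK.exists_isMinOn ⟨(x0, t0), ht0, hx0⟩ hfc
  simp only at hmt hmx
  have hmin' : ∀ y r, r ∈ Icc σ p → y ∈ Icc (A r) (B r) →
      Real.exp (-Λ * t) * h x t ≤ Real.exp (-Λ * r) * h y r := fun y r h1 h2 =>
    hmin (show (y, r) ∈ Reg A B σ p from ⟨h1, h2⟩)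
  have hxt : h x t < 0 := by
    have := hmin' x0 t0 ht0 hx0
    by_contra hc'
    push Not at hc'
    have h1 : 0 ≤ Real.exp (-Λ * t) * h x t := by positivity
    have h2 : Real.exp (-Λ * t0) * h x0 t0 < 0 := mul_neg_of_pos_of_neg (Real.exp_pos _) hneg
    linarith
  have htσ : σ < t := by
    rcases eq_or_lt_of_le hmt.1 with h' | h'
    · subst h'; exact absurd (b0 x hmx) (not_le.mpr hxt)
    · exact h'
  have hxA : A t < x := by
    rcases eq_or_lt_of_le hmx.1 with h' | h'
    · subst h'; exact absurd (bA t hmt) (not_le.mpr hxt)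
    · exact h'
  have hxB : x < B t := by
    rcases eq_or_lt_of_le hmx.2 with h' | h'
    · subst h'; exact absurd (bB t hmt) (not_le.mpr hxt)
    · exact h'
  have htI : t ∈ Ioc σ p := ⟨htσ, hmt.2⟩
  obtain ⟨d1, d2, d3⟩ := d x t htI ⟨hxA, hxB⟩
  have hlm : IsLocalMin (fun y => h y t) x := by
    filter_upwards [Ioo_mem_nhds hxA hxB] with y hy
    have := hmin' y t hmt ⟨hy.1.le, hy.2.le⟩
    exact le_of_mul_le_mul_left this (Real.exp_pos _)
  obtain ⟨e1, e2⟩ := second_deriv_nonneg_of_min (k := fun y => h y t) (k' := fun y => hx y t)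
    (by filter_upwards [Ioo_mem_nhds hxA hxB] with y hy; exact (d y t htI hy).1) d2 hlm
  have hkey := key x t htI ⟨hxA, hxB⟩ hxt e1 e2
  have hd : HasDerivAt (fun r => Real.exp (-Λ * r) * h x r)
      (Real.exp (-Λ * t) * (-Λ * 1) * h x t + Real.exp (-Λ * t) * ht x t) t :=
    (((hasDerivAt_id t).const_mul (-Λ)).exp).mul d3
  have hle : Iio t ∩ Icc σ p ∈ 𝓝[<] t := by
    have : Ioo σ t ∈ 𝓝[<] t := Ioo_mem_nhdsLT htσ
    filter_upwards [this] with r hr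
    exact ⟨hr.2, hr.1.le, (hr.2.le.trans hmt.2)⟩
  have hsub : 𝓝[<] t ≤ 𝓝[Icc σ p] t := by
    rw [nhdsWithin, nhdsWithin]
    refine le_inf inf_le_left ?_
    rw [le_principal_iff]
    exact mem_of_superset hle inter_subset_right
  have := deriv_nonpos_of_left_min hd (by
    have hAe : ∀ᶠ r in 𝓝[<] t, A r < x := ((hA t hmt).mono_left hsub).eventually_lt_const hxA
    have hBe : ∀ᶠ r in 𝓝[<] t, x < B r := ((hB t hmt).mono_left hsub).eventually_const_lt hxB
    filter_upwards [hAe, hBe, hle] with r h1 h2 h3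
    exact hmin' x r h3.2 ⟨h1.le, h2.le⟩)
  have hE := Real.exp_pos (-Λ * t)
  nlinarith

lemma pos_of_ne {s : Set ℝ} (hs : IsPreconnected s) {f : ℝ → ℝ} (hf : ContinuousOn f s)
    (hne : ∀ x ∈ s, f x ≠ 0) {x0 : ℝ} (h0 : x0 ∈ s) (hp : 0 < f x0) : ∀ x ∈ s, 0 < f x := by
  intro x hx
  by_contra hc
  push Not at hc
  obtain ⟨z, hz, hz0⟩ := hs.intermediate_value hx h0 hf ⟨hc, hp.le⟩
  exact hne z hz hz0

lemma mp_strict {a ax axx at' u ux uxx ut : ℝ → ℝ → ℝ} {M : ℝ} {D : Set (ℝ × ℝ)}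
    (C : Coef a ax axx at' M D) (S : Sol a u ux uxx ut M D) {A B : ℝ → ℝ} {σ p : ℝ} (hσ : σ ≤ p)
    (hA : ContinuousOn A (Icc σ p)) (hB : ContinuousOn B (Icc σ p))
    (hAB : ∀ t ∈ Icc σ p, A t ≤ B t) (hD : Reg A B σ p ⊆ D)
    (bA : ∀ t ∈ Icc σ p, 0 < u (A t) t) (bB : ∀ t ∈ Icc σ p, 0 < u (B t) t)
    (b0 : ∀ x ∈ Icc (A σ) (B σ), 0 < u x σ) :
    ∀ t ∈ Icc σ p, ∀ x ∈ Icc (A t) (B t), 0 < u x t := by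
  have hne : (Icc σ p).Nonempty := nonempty_Icc.mpr hσ
  have hσm : σ ∈ Icc σ p := left_mem_Icc.mpr hσ
  have hM := C.Mpos
  have cu := S.cu.mono hD
  have cA : ContinuousOn (fun t => u (A t) t) (Icc σ p) :=
    cu.comp (hA.prodMk continuousOn_id) (fun t ht => ⟨ht, left_mem_Icc.mpr (hAB t ht)⟩)
  have cB : ContinuousOn (fun t => u (B t) t) (Icc σ p) :=
    cu.comp (hB.prodMk continuousOn_id) (fun t ht => ⟨ht, right_mem_Icc.mpr (hAB t ht)⟩)
  have c0 : ContinuousOn (fun x => u x σ) (Icc (A σ) (B σ)) :=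
    cu.comp (continuousOn_id.prodMk continuousOn_const) (fun x hx => ⟨hσm, hx⟩)
  obtain ⟨tA, htA, hminA⟩ := isCompact_Icc.exists_isMinOn hne cA
  obtain ⟨tB, htB, hminB⟩ := isCompact_Icc.exists_isMinOn hne cB
  obtain ⟨x0, hx0, hmin0⟩ := isCompact_Icc.exists_isMinOn (nonempty_Icc.mpr (hAB σ hσm)) c0
  set κ := min (min (u (A tA) tA) (u (B tB) tB)) (u x0 σ) with hκ
  have hκp : 0 < κ := lt_min (lt_min (bA _ htA) (bB _ htB)) (b0 _ hx0)
  have k1 : ∀ t ∈ Icc σ p, κ ≤ u (A t) t := fun t ht =>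
    ((min_le_left _ _).trans (min_le_left _ _)).trans (hminA ht)
  have k2 : ∀ t ∈ Icc σ p, κ ≤ u (B t) t := fun t ht =>
    ((min_le_left _ _).trans (min_le_right _ _)).trans (hminB ht)
  have k3 : ∀ x ∈ Icc (A σ) (B σ), κ ≤ u x σ := fun t ht => (min_le_right _ _).trans (hmin0 ht)
  have hE : ∀ t, σ ≤ t → κ * Real.exp (-(M+1) * (t - σ)) ≤ κ := fun t ht => by
    have : Real.exp (-(M+1) * (t - σ)) ≤ 1 := by
      rw [Real.exp_le_one_iff]; nlinarith
    nlinarith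
  have hEd : ∀ t, HasDerivAt (fun r => κ * Real.exp (-(M+1) * (r - σ)))
      (κ * (Real.exp (-(M+1) * (t - σ)) * (-(M+1) * 1))) t := fun t =>
    ((((hasDerivAt_id t).sub_const σ).const_mul (-(M+1))).exp).const_mul κ
  have := wmp (h := fun x t => u x t - κ * Real.exp (-(M+1) * (t - σ))) (hx := ux) (hxx := uxx)
    (ht := fun x t => ut x t - (κ * (Real.exp (-(M+1) * (t - σ)) * (-(M+1) * 1)))) (Λ := M)
    hA hB (cu.sub (by fun_prop))
    (fun x t ht hx => by
      have hm : (x, t) ∈ D := hD ⟨⟨ht.1.le, ht.2⟩, hx.1.le, hx.2.le⟩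
      exact ⟨(S.dx x t hm).sub_const _, S.dxx x t hm, (S.dt x t hm).sub (hEd t)⟩)
    (fun x t ht hx h1 h2 h3 => by
      have hm : (x, t) ∈ D := hD ⟨⟨ht.1.le, ht.2⟩, hx.1.le, hx.2.le⟩
      have i := S.ineq x t hm
      have lo : 0 ≤ a x t := le_trans (inv_nonneg.mpr hM.le) (C.lo x t hm)
      rw [h2, abs_zero, add_zero] at i
      have i2 := (abs_le.mp i).1
      have i3 := mul_nonneg lo h3
      have hEp := Real.exp_pos (-(M+1) * (t - σ))
      have hP := mul_pos hκp hEp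
      set P := κ * Real.exp (-(M+1) * (t - σ)) with hPdef
      have h1' : u x t < P := by linarith
      rw [show κ * (Real.exp (-(M+1) * (t - σ)) * (-(M+1) * 1)) = -(M+1) * P by rw [hPdef]; ring]
      rcases le_or_gt 0 (u x t) with hu | hu
      · rw [abs_of_nonneg hu] at i2
        nlinarith
      · rw [abs_of_neg hu] at i2
        nlinarith)
    (fun t ht => by have := k1 t ht; have := hE t ht.1; linarith)
    (fun t ht => by have := k2 t ht; have := hE t ht.1; linarith)
    (fun x hx => by have := k3 x hx; have := hE σ le_rfl; linarith)
  intro t ht x hx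
  have h1 := this t ht x hx
  have hEp := mul_pos hκp (Real.exp_pos (-(M+1) * (t - σ)))
  linarith

/-- weak version -/
lemma mp_weak {a ax axx at' u ux uxx ut : ℝ → ℝ → ℝ} {M : ℝ} {D : Set (ℝ × ℝ)}
    (C : Coef a ax axx at' M D) (S : Sol a u ux uxx ut M D) {A B : ℝ → ℝ} {σ p : ℝ}
    (hA : ContinuousOn A (Icc σ p)) (hB : ContinuousOn B (Icc σ p))
    (hD : Reg A B σ p ⊆ D)
    (bA : ∀ t ∈ Icc σ p, 0 ≤ u (A t) t) (bB : ∀ t ∈ Icc σ p, 0 ≤ u (B t) t)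
    (b0 : ∀ x ∈ Icc (A σ) (B σ), 0 ≤ u x σ) :
    ∀ t ∈ Icc σ p, ∀ x ∈ Icc (A t) (B t), 0 ≤ u x t := by
  have hM := C.Mpos
  refine wmp (h := u) (hx := ux) (hxx := uxx) (ht := ut) (Λ := M + 1) hA hB (S.cu.mono hD)
    (fun x t ht hx => ?_) (fun x t ht hx h1 h2 h3 => ?_) bA bB b0
  · have hm : (x, t) ∈ D := hD ⟨⟨ht.1.le, ht.2⟩, hx.1.le, hx.2.le⟩
    exact ⟨S.dx x t hm, S.dxx x t hm, S.dt x t hm⟩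
  · have hm : (x, t) ∈ D := hD ⟨⟨ht.1.le, ht.2⟩, hx.1.le, hx.2.le⟩
    have i := S.ineq x t hm
    have lo : 0 ≤ a x t := le_trans (inv_nonneg.mpr hM.le) (C.lo x t hm)
    rw [h2, abs_zero, add_zero, abs_of_neg h1] at i
    have i2 := (abs_le.mp i).1
    have i3 := mul_nonneg lo h3
    nlinarith

lemma lemB {a ax axx at' u ux uxx ut : ℝ → ℝ → ℝ} {M : ℝ} {D : Set (ℝ × ℝ)}
    (C : Coef a ax axx at' M D) (S : Sol a u ux uxx ut M D) {l y0 v ε p : ℝ} (hl : l < y0)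
    (hv : 0 < v) (hε : v * ε = y0 - l)
    (hD : Reg (fun t => l + v * (p - t)) (fun _ => y0) (p - ε) p ⊆ D)
    (h0 : ∀ t ∈ Icc (p - ε) p, ∀ x ∈ Icc (l + v * (p - t)) y0, 0 ≤ u x t)
    (h1 : ∀ t ∈ Icc (p - ε) p, 0 < u y0 t) :
    ∃ κ > 0, ∃ θ > 0, ∀ x ∈ Icc l y0, κ * (Real.exp (θ * (x - l)) - 1) ≤ u x p := by
  have hM := C.Mpos
  have hεp : 0 < ε := by
    by_contra hc; push Not at hc; nlinarith
  have hin : ∀ t ∈ Icc (p - ε) p, l + v * (p - t) ≤ y0 := fun t ht => by nlinarith [ht.1]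
  have cB : ContinuousOn (fun t => u y0 t) (Icc (p - ε) p) :=
    (S.cu.mono hD).comp (continuousOn_const.prodMk continuousOn_id)
      (fun t ht => ⟨ht, right_mem_Icc.mpr (hin t ht)⟩)
  obtain ⟨tB, htB, hminB⟩ := isCompact_Icc.exists_isMinOn (nonempty_Icc.mpr (by linarith)) cB
  have hm0 := h1 tB htB
  set m := u y0 tB
  set θ := M * (M + v) + M ^ 2 + 1 with hθ
  have hθ1 : 1 ≤ θ := by rw [hθ]; nlinarith [mul_pos hM hv]
  have hbr : 0 < θ ^ 2 * M⁻¹ - M - M * θ - θ * v := by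
    have : θ ^ 2 * M⁻¹ = θ * (2 * M + v + M⁻¹) := by
      rw [hθ]; field_simp; ring
    rw [this]
    have : 0 < M⁻¹ := inv_pos.mpr hM
    nlinarith
  set K := Real.exp (θ * (y0 - l)) with hK
  have hK1 : 1 < K := by rw [hK]; apply Real.one_lt_exp_iff.mpr; nlinarith
  set κ := m / K with hκ
  have hκp : 0 < κ := div_pos hm0 (by linarith)
  have hκK : κ * K = m := by rw [hκ]; field_simp
  refine ⟨κ, hκp, θ, by linarith, ?_⟩
  set E : ℝ → ℝ → ℝ := fun x t => Real.exp (θ * (x - l - v * (p - t))) with hEdef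
  have dEx : ∀ x t, HasDerivAt (fun y => E y t) (θ * E x t) x := fun x t => by
    have := ((((hasDerivAt_id x).sub_const l).sub_const (v * (p - t))).const_mul θ).exp
    exact this.congr_deriv (by simp only [hEdef, id]; ring)
  have dEt : ∀ x t, HasDerivAt (fun r => E x r) (θ * v * E x t) t := fun x t => by
    have := ((((((hasDerivAt_id t).const_sub p).const_mul v)).const_sub (x - l)).const_mul θ).exp
    exact this.congr_deriv (by simp only [hEdef, id]; ring)
  have main := wmp (h := fun x t => u x t - κ * (E x t - 1))
    (hx := fun x t => ux x t - κ * (θ * E x t)) (hxx := fun x t => uxx x t - κ * (θ * (θ * E x t)))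
    (ht := fun x t => ut x t - κ * (θ * v * E x t)) (Λ := 0) (σ := p - ε) (p := p)
    (A := fun t => l + v * (p - t)) (B := fun _ => y0)
    (by fun_prop) (by fun_prop) ((S.cu.mono hD).sub (by simp only [hEdef]; fun_prop))
    (fun x t ht hx => by
      have hm : (x, t) ∈ D := hD ⟨⟨ht.1.le, ht.2⟩, hx.1.le, hx.2.le⟩
      exact ⟨(S.dx x t hm).sub (((dEx x t).sub_const 1).const_mul κ),
        (S.dxx x t hm).sub (((dEx x t).const_mul θ).const_mul κ),
        (S.dt x t hm).sub (((dEt x t).sub_const 1).const_mul κ)⟩)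
    (fun x t ht hx g1 g2 g3 => by
      have hm : (x, t) ∈ D := hD ⟨⟨ht.1.le, ht.2⟩, hx.1.le, hx.2.le⟩
      have hu := h0 t ⟨ht.1.le, ht.2⟩ x ⟨hx.1.le, hx.2.le⟩
      have i := S.ineq x t hm
      have lo := C.lo x t hm
      have hEp : 0 < E x t := Real.exp_pos _
      have hP : 0 < κ * E x t := mul_pos hκp hEp
      set P := κ * E x t with hPd
      have e1 : ux x t = θ * P := by rw [hPd]; linarith
      have e2 : θ ^ 2 * P ≤ uxx x t := by rw [hPd]; nlinarith
      have e3 : u x t ≤ P := by rw [hPd]; nlinarith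
      rw [e1, abs_of_nonneg hu, abs_of_pos (show 0 < θ * P by positivity)] at i
      have i2 := (abs_le.mp i).1
      have i3 : M⁻¹ * (θ ^ 2 * P) ≤ a x t * uxx x t :=
        mul_le_mul lo e2 (by positivity) ((inv_nonneg.mpr hM.le).trans lo)
      have i4 := mul_pos hbr hP
      rw [show κ * (θ * v * E x t) = θ * v * P by rw [hPd]; ring]
      nlinarith)
    (fun t ht => by
      have := h0 t ht (l + v * (p - t)) (left_mem_Icc.mpr (hin t ht))
      simp only [hEdef]
      rw [show θ * (l + v * (p - t) - l - v * (p - t)) = 0 by ring, Real.exp_zero]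
      linarith)
    (fun t ht => by
      have h3 : m ≤ u y0 t := hminB ht
      have : E y0 t ≤ K := by
        simp only [hEdef, hK]; apply Real.exp_le_exp.mpr
        have : 0 ≤ v * (p - t) := mul_nonneg hv.le (by linarith [ht.2])
        nlinarith
      nlinarith)
    (fun x hx => by
      have hxy : x ≤ l + v * ε := by linarith [hx.2]
      have : E x (p - ε) ≤ 1 := by
        simp only [hEdef]; rw [Real.exp_le_one_iff]
        have : x - l - v * (p - (p - ε)) ≤ 0 := by ring_nf; linarith
        nlinarith
      have := h0 (p - ε) ⟨le_rfl, by linarith⟩ x hx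
      nlinarith)
  intro x hx
  have := main p ⟨by linarith, le_rfl⟩ x ⟨by simpa using hx.1, hx.2⟩
  simp only [hEdef, sub_self, mul_zero, sub_zero] at this
  linarith

/-- maximum principle between two nonvanishing curves -/
lemma mp_pos {a ax axx at' u ux uxx ut : ℝ → ℝ → ℝ} {M : ℝ} {D : Set (ℝ × ℝ)}
    (C : Coef a ax axx at' M D) (S : Sol a u ux uxx ut M D) {A B : ℝ → ℝ} {τ p : ℝ} (hτ : τ ≤ p)
    (hA : ContinuousOn A (Icc τ p)) (hB : ContinuousOn B (Icc τ p))
    (hD : ∀ t ∈ Icc τ p, ∀ x ∈ uIcc (A t) (B t), (x, t) ∈ D)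
    (bA : ∀ t ∈ Icc τ p, u (A t) t ≠ 0) (bB : ∀ t ∈ Icc τ p, u (B t) t ≠ 0)
    (b0 : ∀ x ∈ uIcc (A τ) (B τ), 0 < u x τ) :
    ∀ t ∈ Icc τ p, ∀ x ∈ uIcc (A t) (B t), 0 < u x t := by
  have hτm : τ ∈ Icc τ p := left_mem_Icc.mpr hτ
  have cA : ContinuousOn (fun t => u (A t) t) (Icc τ p) :=
    S.cu.comp (hA.prodMk continuousOn_id) (fun t ht => hD t ht _ left_mem_uIcc)
  have cB : ContinuousOn (fun t => u (B t) t) (Icc τ p) :=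
    S.cu.comp (hB.prodMk continuousOn_id) (fun t ht => hD t ht _ right_mem_uIcc)
  have pA := pos_of_ne isPreconnected_Icc cA bA hτm (b0 _ left_mem_uIcc)
  have pB := pos_of_ne isPreconnected_Icc cB bB hτm (b0 _ right_mem_uIcc)
  refine mp_strict C S (A := fun t => min (A t) (B t)) (B := fun t => max (A t) (B t)) hτ
    (hA.inf hB) (hA.sup hB) (fun t _ => min_le_max) (fun q hq => hD q.2 hq.1 q.1 hq.2)
    (fun t ht => ?_) (fun t ht => ?_) b0
  · rcases min_choice (A t) (B t) with h | h <;> rw [h]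
    · exact pA t ht
    · exact pB t ht
  · rcases max_choice (A t) (B t) with h | h <;> rw [h]
    · exact pA t ht
    · exact pB t ht

lemma mp_abs {a ax axx at' u ux uxx ut : ℝ → ℝ → ℝ} {M : ℝ} {D : Set (ℝ × ℝ)}
    (C : Coef a ax axx at' M D) (S : Sol a u ux uxx ut M D) {A B : ℝ → ℝ} {τ p : ℝ} (hτ : τ ≤ p)
    (hA : ContinuousOn A (Icc τ p)) (hB : ContinuousOn B (Icc τ p))
    (hD : ∀ t ∈ Icc τ p, ∀ x ∈ uIcc (A t) (B t), (x, t) ∈ D)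
    (bA : ∀ t ∈ Icc τ p, u (A t) t ≠ 0) (bB : ∀ t ∈ Icc τ p, u (B t) t ≠ 0)
    (b0 : ∀ x ∈ uIcc (A τ) (B τ), u x τ ≠ 0) :
    ∀ t ∈ Icc τ p, ∀ x ∈ uIcc (A t) (B t), u x t ≠ 0 := by
  have hτm : τ ∈ Icc τ p := left_mem_Icc.mpr hτ
  have c0 : ContinuousOn (fun x => u x τ) (uIcc (A τ) (B τ)) :=
    S.cu.comp (continuousOn_id.prodMk continuousOn_const) (fun x hx => hD τ hτm x hx)
  have hpc : IsPreconnected (uIcc (A τ) (B τ)) := isPreconnected_Icc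
  rcases lt_or_gt_of_ne (bA τ hτm) with h | h
  · have b0' := pos_of_ne hpc c0.neg (fun x hx => neg_ne_zero.mpr (b0 x hx)) left_mem_uIcc
      (by simpa using h)
    intro t ht x hx
    have := mp_pos C S.neg hτ hA hB hD (fun t ht => neg_ne_zero.mpr (bA t ht))
      (fun t ht => neg_ne_zero.mpr (bB t ht)) b0' t ht x hx
    linarith
  · have b0' := pos_of_ne hpc c0 b0 left_mem_uIcc h
    intro t ht x hx
    exact (mp_pos C S hτ hA hB hD bA bB b0' t ht x hx).ne'

lemma Rec_compact (α β σ p : ℝ) : IsCompact (Rec α β σ p) :=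
  Reg_compact (A := fun _ => α) (B := fun _ => β) continuousOn_const continuousOn_const

def Reach (u : ℝ → ℝ → ℝ) (α β σ y τ : ℝ) : Prop :=
  ∃ η : ℝ → ℝ, Continuous η ∧ η τ = y ∧ ∀ t ∈ Icc σ τ, η t ∈ Icc α β ∧ 0 < u (η t) t

lemma Reach.extend {u : ℝ → ℝ → ℝ} {α β σ y0 τ0 y' τ' xm tm δ : ℝ}
    (hR : Reach u α β σ y0 τ0) (hlt : τ0 < τ')
    (hy0 : y0 ∈ Icc α β) (hy' : y' ∈ Icc α β)
    (h0 : |y0 - xm| < δ) (h1 : |y' - xm| < δ) (h2 : |τ0 - tm| < δ) (h3 : |τ' - tm| < δ)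
    (hbox : ∀ y t, y ∈ Icc α β → t ∈ Icc τ0 τ' → |y - xm| < δ → |t - tm| < δ → 0 < u y t) :
    Reach u α β σ y' τ' := by
  obtain ⟨η, hη, he, hpos⟩ := hR
  have hd : 0 < τ' - τ0 := by linarith
  refine ⟨fun t => η (min t τ0) + (y' - y0) * ((max t τ0 - τ0) / (τ' - τ0)), by fun_prop, ?_, ?_⟩
  · simp only [min_eq_right hlt.le, max_eq_left hlt.le, he]
    rw [div_self hd.ne']; ring
  · intro t ht
    rcases le_total t τ0 with h | h
    · simp only [min_eq_left h, max_eq_right h, sub_self, zero_div, mul_zero, add_zero]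
      exact hpos t ⟨ht.1, h⟩
    · simp only [min_eq_right h, max_eq_left h, he]
      set s := (t - τ0) / (τ' - τ0) with hs
      have hs0 : 0 ≤ s := div_nonneg (by linarith) hd.le
      have hs1 : s ≤ 1 := by rw [hs, div_le_one hd]; linarith [ht.2]
      rw [abs_lt] at h0 h1 h2 h3
      have m1 : y0 + (y' - y0) * s ∈ Icc α β := by
        constructor <;> nlinarith [hy0.1, hy0.2, hy'.1, hy'.2]
      refine ⟨m1, hbox _ _ m1 ⟨h, ht.2⟩ ?_ ?_⟩
      · have hq := (convex_Ioo (xm - δ) (xm + δ)).add_smul_sub_mem (x := y0) (y := y')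
          ⟨by linarith [h0.1], by linarith [h0.2]⟩ ⟨by linarith [h1.1], by linarith [h1.2]⟩
          ⟨hs0, hs1⟩
        rw [smul_eq_mul, mul_comm] at hq
        rw [abs_lt]; constructor <;> linarith [hq.1, hq.2]
      · rw [abs_lt]; constructor <;> linarith [ht.2]

lemma path_pos {a ax axx at' u ux uxx ut : ℝ → ℝ → ℝ} {M α β σ p : ℝ}
    (C : Coef a ax axx at' M (Rec α β σ p)) (S : Sol a u ux uxx ut M (Rec α β σ p))
    (hσ : σ ≤ p)
    (hα : ∀ t ∈ Icc σ p, u α t ≠ 0) (hβ : ∀ t ∈ Icc σ p, u β t ≠ 0)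
    {y : ℝ} (hy : y ∈ Icc α β) (hpos : 0 < u y p) : Reach u α β σ y p := by
  by_contra hcon
  have hM := C.Mpos
  set V : Set (ℝ × ℝ) := {q | q ∈ Rec α β σ p ∧ 0 < u q.1 q.2 ∧ ¬ Reach u α β σ q.1 q.2} with hV
  have hVR : V ⊆ Rec α β σ p := fun q hq => hq.1
  have hcl : closure V ⊆ Rec α β σ p := closure_minimal hVR (Rec_compact α β σ p).isClosed
  have hK : IsCompact (closure V) := (Rec_compact α β σ p).of_isClosed_subset isClosed_closure hcl
  have hyV : (y, p) ∈ V := ⟨⟨⟨hσ, le_rfl⟩, hy⟩, hpos, hcon⟩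
  have hfc : ContinuousOn (fun q : ℝ × ℝ => Real.exp (-(M+1) * q.2) * u q.1 q.2) (closure V) :=
    ContinuousOn.mul (by fun_prop) (S.cu.mono hcl)
  obtain ⟨⟨xm, tm⟩, hmem, hmax⟩ := hK.exists_isMaxOn ⟨(y, p), subset_closure hyV⟩ hfc
  have hmax' : ∀ z r, (z, r) ∈ closure V →
      Real.exp (-(M+1) * r) * u z r ≤ Real.exp (-(M+1) * tm) * u xm tm := fun z r h => hmax h
  obtain ⟨htm, hxm⟩ := hcl hmem
  simp only at htm hxm
  have hum : 0 < u xm tm := by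
    have h1 := hmax' y p (subset_closure hyV)
    have h2 : 0 < Real.exp (-(M+1) * p) * u y p := by positivity
    by_contra hc
    push Not at hc
    have := mul_nonpos_of_nonneg_of_nonpos (Real.exp_pos (-(M+1) * tm)).le hc
    linarith
  obtain ⟨δ, hδ, hb⟩ := Metric.continuousWithinAt_iff.mp (S.cu (xm, tm) (hcl hmem)) _ hum
  have hbox : ∀ y t, y ∈ Icc α β → t ∈ Icc σ p → |y - xm| < δ → |t - tm| < δ → 0 < u y t := by
    intro y t h1 h2 h3 h4
    have := hb (x := (y, t)) ⟨h2, h1⟩ (by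
      rw [Prod.dist_eq, Real.dist_eq, Real.dist_eq]; exact max_lt h3 h4)
    rw [Real.dist_eq, abs_lt] at this
    simp only at this
    linarith
  -- V-points near
  have hnear : ∀ ε > 0, ∃ y' τ', (y', τ') ∈ V ∧ |y' - xm| < ε ∧ |τ' - tm| < ε := by
    intro ε hε
    obtain ⟨q, hq, hd⟩ := Metric.mem_closure_iff.mp hmem ε hε
    rw [dist_comm, Prod.dist_eq, Real.dist_eq, Real.dist_eq] at hd
    exact ⟨q.1, q.2, hq, (le_max_left _ _).trans_lt hd, (le_max_right _ _).trans_lt hd⟩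
  have hσt : σ < tm := by
    rcases eq_or_lt_of_le htm.1 with h | h
    · exfalso
      obtain ⟨y', τ', hV', h1, h2⟩ := hnear δ hδ
      apply hV'.2.2
      refine ⟨fun _ => y', continuous_const, rfl, fun t ht => ⟨hV'.1.2, ?_⟩⟩
      refine hbox _ _ hV'.1.2 ⟨ht.1, ht.2.trans hV'.1.1.2⟩ h1 ?_
      rw [abs_lt] at h2 ⊢
      constructor <;> linarith [ht.1, ht.2]
    · exact h
  -- no reachable points in the box below
  have hno : ∀ z r, z ∈ Icc α β → r ∈ Ico σ tm → |z - xm| < δ → |r - tm| < δ →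
      ¬ Reach u α β σ z r := by
    intro z r hz hr h1 h2 hR
    obtain ⟨y', τ', hV', h3, h4⟩ := hnear (min δ (tm - r)) (lt_min hδ (by linarith [hr.2]))
    have h4' := (abs_lt.mp (h4.trans_le (min_le_right _ _))).1
    apply hV'.2.2
    refine hR.extend (by linarith) hz hV'.1.2 h1 (h3.trans_le (min_le_left _ _)) h2
      (h4.trans_le (min_le_left _ _)) (fun y t g1 g2 g3 g4 => hbox y t g1 ?_ g3 g4)
    exact ⟨hr.1.trans g2.1, g2.2.trans hV'.1.1.2⟩
  have hsubV : ∀ z r, z ∈ Icc α β → r ∈ Ico σ tm → |z - xm| < δ → |r - tm| < δ → (z, r) ∈ V :=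
    fun z r h1 h2 h3 h4 => ⟨⟨⟨h2.1, h2.2.le.trans htm.2⟩, h1⟩,
      hbox z r h1 ⟨h2.1, h2.2.le.trans htm.2⟩ h3 h4, hno z r h1 h2 h3 h4⟩
  have hr0 : max σ (tm - δ / 2) ∈ Ico σ tm := ⟨le_max_left _ _, max_lt hσt (by linarith)⟩
  have hr0' : |max σ (tm - δ / 2) - tm| < δ := by
    rw [abs_lt]; constructor
    · have := le_max_right σ (tm - δ / 2); linarith
    · linarith [hr0.2]
  have hxα : α < xm := by
    rcases eq_or_lt_of_le hxm.1 with h | h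
    · exfalso
      refine hno α _ ⟨le_rfl, hxm.1.trans hxm.2⟩ hr0 (by rw [h]; simpa using hδ) hr0' ?_
      refine ⟨fun _ => α, continuous_const, rfl, fun t ht => ⟨⟨le_rfl, hxm.1.trans hxm.2⟩, ?_⟩⟩
      refine pos_of_ne isPreconnected_Icc (f := fun t => u α t) (S.cu.comp
        (continuousOn_const.prodMk continuousOn_id)
        (fun t ht => ⟨ht, le_rfl, hxm.1.trans hxm.2⟩)) hα htm (h ▸ hum) t ⟨ht.1, ?_⟩
      exact ht.2.trans (hr0.2.le.trans htm.2)
    · exact h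
  have hxβ : xm < β := by
    rcases eq_or_lt_of_le hxm.2 with h | h
    · exfalso
      refine hno β _ ⟨hxm.1.trans hxm.2, le_rfl⟩ hr0 (by rw [h]; simpa using hδ) hr0' ?_
      refine ⟨fun _ => β, continuous_const, rfl, fun t ht => ⟨⟨hxm.1.trans hxm.2, le_rfl⟩, ?_⟩⟩
      refine pos_of_ne isPreconnected_Icc (f := fun t => u β t) (S.cu.comp
        (continuousOn_const.prodMk continuousOn_id)
        (fun t ht => ⟨ht, hxm.1.trans hxm.2, le_rfl⟩)) hβ htm (h ▸ hum) t ⟨ht.1, ?_⟩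
      exact ht.2.trans (hr0.2.le.trans htm.2)
    · exact h
  -- closure at time tm
  have hcltop : ∀ z, z ∈ Icc α β → |z - xm| < δ → (z, tm) ∈ closure V := by
    intro z hz h1
    rw [Metric.mem_closure_iff]
    intro ε hε
    set e := min (min ε δ) (tm - σ) / 2 with he
    have hep : 0 < min (min ε δ) (tm - σ) := lt_min (lt_min hε hδ) (by linarith)
    have l1 : min (min ε δ) (tm - σ) ≤ ε := (min_le_left _ _).trans (min_le_left _ _)
    have l2 : min (min ε δ) (tm - σ) ≤ δ := (min_le_left _ _).trans (min_le_right _ _)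
    have l3 : min (min ε δ) (tm - σ) ≤ tm - σ := (min_le_right _ _)
    refine ⟨(z, tm - e), hsubV z _ hz ⟨by linarith, by linarith⟩ h1
      (by rw [abs_lt]; constructor <;> linarith), ?_⟩
    rw [Prod.dist_eq]
    simp only [dist_self, Real.dist_eq]
    apply max_lt hε
    rw [abs_lt]; constructor <;> linarith
  have hR : (xm, tm) ∈ Rec α β σ p := ⟨htm, hxm⟩
  have hlm : IsLocalMin (fun z => -u z tm) xm := by
    filter_upwards [Ioo_mem_nhds hxα hxβ, Metric.ball_mem_nhds xm hδ] with z hz hz2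
    have := hmax' z tm (hcltop z ⟨hz.1.le, hz.2.le⟩ (by simpa [Real.dist_eq] using hz2))
    have := le_of_mul_le_mul_left this (Real.exp_pos _)
    linarith
  obtain ⟨e1, e2⟩ := second_deriv_nonneg_of_min (k := fun z => -u z tm) (k' := fun z => -ux z tm)
    (by filter_upwards [Ioo_mem_nhds hxα hxβ] with z hz
        exact (S.dx z tm ⟨htm, hz.1.le, hz.2.le⟩).fun_neg) (S.dxx xm tm hR).fun_neg hlm
  have hd : HasDerivAt (fun r => -(Real.exp (-(M+1) * r) * u xm r))
      (-(Real.exp (-(M+1) * tm) * (-(M+1) * 1) * u xm tm + Real.exp (-(M+1) * tm) * ut xm tm)) tm :=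
    ((((hasDerivAt_id tm).const_mul (-(M+1))).exp).mul (S.dt xm tm hR)).fun_neg
  have h3 := deriv_nonpos_of_left_min hd (by
    filter_upwards [Ioo_mem_nhdsLT (max_lt hσt (show tm - δ < tm by linarith))] with r hr
    have hr1 := (le_max_left σ (tm - δ)).trans hr.1.le
    have hr2 := (le_max_right σ (tm - δ)).trans_lt hr.1
    have := hmax' xm r (subset_closure (hsubV xm r hxm ⟨hr1, hr.2⟩ (by simpa using hδ)
      (by rw [abs_lt]; constructor <;> linarith [hr.2])))
    linarith)
  have i := S.ineq xm tm hR
  have hux : ux xm tm = 0 := by linarith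
  rw [hux, abs_zero, add_zero, abs_of_pos hum] at i
  have i2 := (abs_le.mp i).2
  have lo : 0 ≤ a xm tm := le_trans (inv_nonneg.mpr hM.le) (C.lo xm tm hR)
  have hE := Real.exp_pos (-(M+1) * tm)
  have i3 := mul_nonneg lo e2
  have i4 : ut xm tm - (M+1) * u xm tm < 0 := by nlinarith
  nlinarith

lemma path_ne {a ax axx at' u ux uxx ut : ℝ → ℝ → ℝ} {M α β σ p : ℝ}
    (C : Coef a ax axx at' M (Rec α β σ p)) (S : Sol a u ux uxx ut M (Rec α β σ p))
    (hσ : σ ≤ p)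
    (hα : ∀ t ∈ Icc σ p, u α t ≠ 0) (hβ : ∀ t ∈ Icc σ p, u β t ≠ 0)
    {y : ℝ} (hy : y ∈ Icc α β) (hne : u y p ≠ 0) :
    ∃ η : ℝ → ℝ, Continuous η ∧ η p = y ∧ ∀ t ∈ Icc σ p, η t ∈ Icc α β ∧ u (η t) t ≠ 0 := by
  rcases lt_or_gt_of_ne hne with h | h
  · obtain ⟨η, h1, h2, h3⟩ := path_pos C S.neg hσ (fun t ht => neg_ne_zero.mpr (hα t ht))
      (fun t ht => neg_ne_zero.mpr (hβ t ht)) hy (by linarith)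
    exact ⟨η, h1, h2, fun t ht => ⟨(h3 t ht).1, by linarith [(h3 t ht).2]⟩⟩
  · obtain ⟨η, h1, h2, h3⟩ := path_pos C S hσ hα hβ hy h
    exact ⟨η, h1, h2, fun t ht => ⟨(h3 t ht).1, (h3 t ht).2.ne'⟩⟩

lemma TP {a ax axx at' u ux uxx ut : ℝ → ℝ → ℝ} {M : ℝ} {D : Set (ℝ × ℝ)} {σ p : ℝ}
    (C : Coef a ax axx at' M D) (S : Sol a u ux uxx ut M D)
    (hσ : σ ≤ p) {η η' : ℝ → ℝ} (hη : ContinuousOn η (Icc σ p)) (hη' : ContinuousOn η' (Icc σ p))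
    (hD : ∀ t ∈ Icc σ p, ∀ x ∈ uIcc (η t) (η' t), (x, t) ∈ D)
    (h1 : ∀ t ∈ Icc σ p, u (η t) t ≠ 0) (h2 : ∀ t ∈ Icc σ p, u (η' t) t ≠ 0)
    {z : ℝ} (hz : z ∈ Ioo (η p) (η' p)) (hz0 : u z p = 0) :
    ∀ t ∈ Icc σ p, ∃ z ∈ Ioo (η t) (η' t), u z t = 0 := by
  have key : ∀ t ∈ Icc σ p, ∃ z ∈ uIcc (η t) (η' t), u z t = 0 := by
    intro t ht
    by_contra hc
    push Not at hc
    have hs : Icc t p ⊆ Icc σ p := Icc_subset_Icc ht.1 le_rfl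
    have := mp_abs C S ht.2 (hη.mono hs) (hη'.mono hs) (fun r hr => hD r (hs hr))
      (fun r hr => h1 r (hs hr)) (fun r hr => h2 r (hs hr)) hc p ⟨ht.2, le_rfl⟩ z
      (by rw [uIcc_of_le (hz.1.trans hz.2).le]; exact ⟨hz.1.le, hz.2.le⟩)
    exact this hz0
  have hlt := pos_of_ne isPreconnected_Icc (f := fun t => η' t - η t) (hη'.sub hη)
    (fun t ht h => by
      obtain ⟨z, hz, hz0⟩ := key t ht
      have : η' t = η t := by linarith
      rw [this, uIcc_self] at hz
      rw [mem_singleton_iff.mp hz] at hz0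
      exact h1 t ht hz0) (right_mem_Icc.mpr hσ) (by linarith [hz.1, hz.2])
  intro t ht
  obtain ⟨w, hw, hw0⟩ := key t ht
  have := hlt t ht
  rw [uIcc_of_le (by linarith)] at hw
  refine ⟨w, ⟨lt_of_le_of_ne hw.1 ?_, lt_of_le_of_ne hw.2 ?_⟩, hw0⟩
  · rintro rfl; exact h1 t ht hw0
  · rintro rfl; exact h2 t ht hw0

structure Fam (f fy fyy ft : ℝ → ℝ → ℝ) (R L σ p : ℝ) : Prop where
  Rpos : 0 < R
  c0 : ContinuousOn (fun q : ℝ × ℝ => f q.1 q.2) (Rec (-R) R σ p)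
  c1 : ContinuousOn (fun q : ℝ × ℝ => fy q.1 q.2) (Rec (-R) R σ p)
  c2 : ContinuousOn (fun q : ℝ × ℝ => fyy q.1 q.2) (Rec (-R) R σ p)
  ct : ∀ t ∈ Ioo σ p, ContinuousOn (fun y => ft y t) (Icc (-R) R)
  bt : ∀ t ∈ Ioo σ p, ∀ y ∈ Icc (-R) R, |ft y t| ≤ L
  dx : ∀ t ∈ Icc σ p, ∀ y ∈ Ioo (-R) R, HasDerivAt (fun z => f z t) (fy y t) y
  dxx : ∀ t ∈ Icc σ p, ∀ y ∈ Ioo (-R) R, HasDerivAt (fun z => fy z t) (fyy y t) y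
  dt : ∀ t ∈ Ioo σ p, ∀ y ∈ Icc (-R) R, HasDerivAt (fun r => f y r) (ft y t) t

lemma slice_cont {h : ℝ → ℝ → ℝ} {α β σ p t : ℝ}
    (hc : ContinuousOn (fun q : ℝ × ℝ => h q.1 q.2) (Rec α β σ p)) (ht : t ∈ Icc σ p) :
    ContinuousOn (fun y => h y t) (Icc α β) :=
  hc.comp (continuousOn_id.prodMk continuousOn_const) (fun _ hy => ⟨ht, hy⟩)

lemma tslice_cont {h : ℝ → ℝ → ℝ} {α β σ p y : ℝ}
    (hc : ContinuousOn (fun q : ℝ × ℝ => h q.1 q.2) (Rec α β σ p)) (hy : y ∈ Icc α β) :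
    ContinuousOn (fun t => h y t) (Icc σ p) :=
  hc.comp (continuousOn_const.prodMk continuousOn_id) (fun _ ht => ⟨ht, hy⟩)

lemma rec_bound {h : ℝ → ℝ → ℝ} {α β σ p : ℝ}
    (hc : ContinuousOn (fun q : ℝ × ℝ => h q.1 q.2) (Rec α β σ p)) :
    ∃ B, 0 ≤ B ∧ ∀ t ∈ Icc σ p, ∀ y ∈ Icc α β, |h y t| ≤ B := by
  obtain ⟨B, hB⟩ := (Rec_compact α β σ p).exists_bound_of_continuousOn hc
  exact ⟨max B 0, le_max_right _ _, fun t ht y hy =>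
    (hB (y, t) ⟨ht, hy⟩).trans (le_max_left _ _)⟩

lemma ii_of {R : ℝ} (hR : 0 < R) {h : ℝ → ℝ} (hc : ContinuousOn h (Icc (-R) R)) :
    IntervalIntegrable h MeasureTheory.volume (-R) R :=
  ContinuousOn.intervalIntegrable (by rwa [uIcc_of_le (by linarith)])

lemma aesm_of {R : ℝ} (hR : 0 < R) {h : ℝ → ℝ} (hc : ContinuousOn h (Icc (-R) R)) :
    MeasureTheory.AEStronglyMeasurable h (MeasureTheory.volume.restrict (uIoc (-R) R)) :=
  ((hc.mono (by rw [uIoc_of_le (by linarith)]; exact Ioc_subset_Icc_self)).aestronglyMeasurable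
    measurableSet_uIoc)

lemma mem_of_uIoc {R y : ℝ} (hR : 0 < R) (hy : y ∈ uIoc (-R) R) : y ∈ Icc (-R) R := by
  rw [uIoc_of_le (by linarith)] at hy; exact Ioc_subset_Icc_self hy

lemma contI {h : ℝ → ℝ → ℝ} {R σ p : ℝ} (hR : 0 < R)
    (hc : ContinuousOn (fun q : ℝ × ℝ => h q.1 q.2) (Rec (-R) R σ p)) :
    ContinuousOn (fun t => ∫ y in (-R)..R, h y t) (Icc σ p) := by
  obtain ⟨B, -, hB⟩ := rec_bound hc
  intro t0 ht0
  refine intervalIntegral.tendsto_integral_filter_of_dominated_convergence (fun _ => B) ?_ ?_ ?_ ?_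
  · filter_upwards [self_mem_nhdsWithin] with t ht
    exact aesm_of hR (slice_cont hc ht)
  · filter_upwards [self_mem_nhdsWithin] with t ht
    exact Eventually.of_forall fun y hy => hB t ht y (mem_of_uIoc hR hy)
  · exact intervalIntegrable_const
  · exact Eventually.of_forall fun y hy => tslice_cont hc (mem_of_uIoc hR hy) t0 ht0

lemma derK {f fy fyy ft : ℝ → ℝ → ℝ} {R L σ p : ℝ} (F : Fam f fy fyy ft R L σ p) {k : ℝ → ℝ}
    (hk : Continuous k) {t0 : ℝ} (ht0 : t0 ∈ Ioo σ p) :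
    HasDerivAt (fun t => ∫ y in (-R)..R, k y * f y t ^ 2)
      (∫ y in (-R)..R, k y * (2 * f y t0 * ft y t0)) t0 := by
  have hR := F.Rpos
  obtain ⟨B, hB0, hB⟩ := rec_bound F.c0
  obtain ⟨Bk, hBk⟩ := isCompact_Icc.exists_bound_of_continuousOn (s := Icc (-R) R) hk.continuousOn
  have hL : 0 ≤ L := (abs_nonneg _).trans (F.bt t0 ht0 0 ⟨by linarith, hR.le⟩)
  have hI : Ioo σ p ⊆ Icc σ p := Ioo_subset_Icc_self
  refine (intervalIntegral.hasDerivAt_integral_of_dominated_loc_of_deriv_le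
    (F := fun t y => k y * f y t ^ 2)
    (F' := fun t y => k y * (2 * f y t * ft y t)) (s := Ioo σ p) (bound := fun _ => Bk * (2 * B * L))
    (Ioo_mem_nhds ht0.1 ht0.2) ?_ ?_ ?_ ?_ intervalIntegrable_const ?_).2
  · filter_upwards [Ioo_mem_nhds ht0.1 ht0.2] with t ht
    exact aesm_of hR (hk.continuousOn.mul ((slice_cont F.c0 (hI ht)).pow 2))
  · exact ii_of hR (hk.continuousOn.mul ((slice_cont F.c0 (hI ht0)).pow 2))
  · exact aesm_of hR (hk.continuousOn.mul ((continuousOn_const.mul (slice_cont F.c0 (hI ht0))).mul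
      (F.ct t0 ht0)))
  · refine Eventually.of_forall fun y hy t ht => ?_
    have hy' := mem_of_uIoc hR hy
    rw [norm_mul, norm_mul, norm_mul]
    have h1 := hBk y hy'
    have h2 : ‖f y t‖ ≤ B := hB t (hI ht) y hy'
    have h3 : ‖ft y t‖ ≤ L := F.bt t ht y hy'
    have h4 : ‖(2:ℝ)‖ = 2 := by simp
    rw [h4]
    have := (norm_nonneg (k y)).trans h1
    gcongr
  · refine Eventually.of_forall fun y hy t ht => ?_
    have := ((F.dt t ht y (mem_of_uIoc hR hy)).pow 2).const_mul (k y)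
    exact this.congr_deriv (by simp)

lemma derE {f fy fyy ft : ℝ → ℝ → ℝ} {R L σ p : ℝ} (F : Fam f fy fyy ft R L σ p)
    (h0 : ∀ t ∈ Icc σ p, f R t = 0) (h0' : ∀ t ∈ Icc σ p, f (-R) t = 0)
    {t0 : ℝ} (ht0 : t0 ∈ Ioo σ p) :
    HasDerivAt (fun t => ∫ y in (-R)..R, fy y t ^ 2)
      (∫ y in (-R)..R, (-2) * (fyy y t0 * ft y t0)) t0 := by
  have hR := F.Rpos
  obtain ⟨B, hB0, hB⟩ := rec_bound F.c2
  have hL : 0 ≤ L := (abs_nonneg _).trans (F.bt t0 ht0 0 ⟨by linarith, hR.le⟩)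
  have hI : Ioo σ p ⊆ Icc σ p := Ioo_subset_Icc_self
  rw [hasDerivAt_iff_tendsto_slope]
  have hev : ∀ᶠ t in 𝓝[≠] t0, t ∈ Ioo σ p := nhdsWithin_le_nhds (Ioo_mem_nhds ht0.1 ht0.2)
  have key : ∀ t ∈ Ioo σ p, slope (fun t => ∫ y in (-R)..R, fy y t ^ 2) t0 t =
      ∫ y in (-R)..R, -(slope (fun r => f y r) t0 t * (fyy y t + fyy y t0)) := by
    intro t ht
    have c0 := (slice_cont F.c0 (hI ht)).sub (slice_cont F.c0 (hI ht0))
    have c1 := (slice_cont F.c1 (hI ht)).add (slice_cont F.c1 (hI ht0))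
    have c1' := (slice_cont F.c1 (hI ht)).sub (slice_cont F.c1 (hI ht0))
    have c2 := (slice_cont F.c2 (hI ht)).add (slice_cont F.c2 (hI ht0))
    have ibp := intervalIntegral.integral_eq_sub_of_hasDerivAt_of_le (a := -R) (b := R)
      (f := fun y => (f y t - f y t0) * (fy y t + fy y t0))
      (f' := fun y => (fy y t - fy y t0) * (fy y t + fy y t0)
        + (f y t - f y t0) * (fyy y t + fyy y t0)) (by linarith) (c0.mul c1)
      (fun y hy => ((F.dx t (hI ht) y hy).sub (F.dx t0 (hI ht0) y hy)).mul
        ((F.dxx t (hI ht) y hy).add (F.dxx t0 (hI ht0) y hy)))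
      (ii_of hR ((c1'.mul c1).add (c0.mul c2)))
    have j1 := ii_of hR (h := fun y => (fy y t - fy y t0) * (fy y t + fy y t0)) (c1'.mul c1)
    have j2 := ii_of hR (h := fun y => (f y t - f y t0) * (fyy y t + fyy y t0)) (c0.mul c2)
    have j3 := ii_of hR (h := fun y => fy y t ^ 2) ((slice_cont F.c1 (hI ht)).pow 2)
    have j4 := ii_of hR (h := fun y => fy y t0 ^ 2) ((slice_cont F.c1 (hI ht0)).pow 2)
    rw [h0 t (hI ht), h0 t0 (hI ht0), h0' t (hI ht), h0' t0 (hI ht0),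
      intervalIntegral.integral_add j1 j2] at ibp
    rw [slope_def_field, ← intervalIntegral.integral_sub j3 j4]
    have e1 : ∫ y in (-R)..R, (fy y t ^ 2 - fy y t0 ^ 2) =
        ∫ y in (-R)..R, (fy y t - fy y t0) * (fy y t + fy y t0) := by
      congr 1; ext y; ring
    have e2 : ∫ y in (-R)..R, -(slope (fun r => f y r) t0 t * (fyy y t + fyy y t0)) =
        (-(t - t0)⁻¹) * ∫ y in (-R)..R, (f y t - f y t0) * (fyy y t + fyy y t0) := by
      rw [← intervalIntegral.integral_const_mul]
      congr 1; ext y; rw [slope_def_field]; ring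
    rw [e1, e2, div_eq_inv_mul]
    linear_combination (t - t0)⁻¹ * ibp
  rw [tendsto_congr' (hev.mono key)]
  have hsl : ∀ t ∈ Ioo σ p, ∀ y ∈ Icc (-R) R, |slope (fun r => f y r) t0 t| ≤ L := by
    intro t ht y hy
    rcases eq_or_ne t t0 with h | h
    · subst h; simp [hL]
    · have := (convex_Ioo σ p).norm_image_sub_le_of_norm_hasDerivWithin_le (f := fun r => f y r)
        (f' := fun r => ft y r) (C := L)
        (fun r hr => (F.dt r hr y hy).hasDerivWithinAt) (fun r hr => F.bt r hr y hy) ht0 ht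
      rw [slope_def_field, abs_div, div_le_iff₀ (abs_pos.mpr (sub_ne_zero.mpr h))]
      exact this
  refine intervalIntegral.tendsto_integral_filter_of_dominated_convergence
    (fun _ => L * (B + B)) ?_ ?_ intervalIntegrable_const ?_
  · filter_upwards [hev] with t ht
    refine aesm_of hR (ContinuousOn.neg (ContinuousOn.mul ?_
      ((slice_cont F.c2 (hI ht)).add (slice_cont F.c2 (hI ht0)))))
    simp only [slope_def_field]
    exact ((slice_cont F.c0 (hI ht)).sub (slice_cont F.c0 (hI ht0))).div_const _
  · filter_upwards [hev] with t ht
    refine Eventually.of_forall fun y hy => ?_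
    have hy' := mem_of_uIoc hR hy
    rw [norm_neg, norm_mul]
    have h1 : ‖slope (fun r => f y r) t0 t‖ ≤ L := hsl t ht y hy'
    have h2 : ‖fyy y t + fyy y t0‖ ≤ B + B :=
      (norm_add_le _ _).trans (add_le_add (hB t (hI ht) y hy') (hB t0 (hI ht0) y hy'))
    gcongr
  · refine Eventually.of_forall fun y hy => ?_
    have hy' := mem_of_uIoc hR hy
    have h1 := (F.dt t0 ht0 y hy').tendsto_slope
    have h2 : Tendsto (fun t => fyy y t) (𝓝[≠] t0) (𝓝 (fyy y t0)) :=
      ((tslice_cont F.c2 hy').continuousAt (Icc_mem_nhds ht0.1 ht0.2)).tendsto.mono_left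
        nhdsWithin_le_nhds
    have h3 := (h1.mul (h2.add_const (fyy y t0))).neg
    convert h3 using 2
    ring

/-- static identities -/
lemma static1 {F F1 F2 : ℝ → ℝ} {R τ : ℝ} (hR : 0 < R) (hτ : 0 < τ)
    (c0 : ContinuousOn F (Icc (-R) R)) (c1 : ContinuousOn F1 (Icc (-R) R))
    (c2 : ContinuousOn F2 (Icc (-R) R))
    (d1 : ∀ y ∈ Ioo (-R) R, HasDerivAt F (F1 y) y) (d2 : ∀ y ∈ Ioo (-R) R, HasDerivAt F1 (F2 y) y)
    (b1 : F R = 0) (b2 : F (-R) = 0) :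
    ∫ y in (-R)..R, F y * (F2 y - y ^ 2 / (16 * τ ^ 2) * F y + (y / (2 * τ) * F1 y + F y / (4 * τ)))
      = -((∫ y in (-R)..R, F1 y ^ 2) + (∫ y in (-R)..R, y ^ 2 * F y ^ 2) / (16 * τ ^ 2)) := by
  have cy : ContinuousOn (fun y : ℝ => y) (Icc (-R) R) := continuousOn_id
  have ibp := intervalIntegral.integral_eq_sub_of_hasDerivAt_of_le (a := -R) (b := R)
      (f := fun y => F y * F1 y + (1 / (4 * τ)) * (y * F y ^ 2))
      (f' := fun y => (F1 y * F1 y + F y * F2 y) +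
        (1 / (4 * τ)) * (1 * F y ^ 2 + y * (((2:ℕ):ℝ) * F y ^ (2 - 1) * F1 y)))
      (by linarith) (by fun_prop)
      (fun y hy => ((d1 y hy).mul (d2 y hy)).add (((hasDerivAt_id y).mul
        ((d1 y hy).pow 2)).const_mul _))
      (ii_of hR (by fun_prop))
  have i1 := ii_of hR (h := fun y => (F1 y * F1 y + F y * F2 y) +
        (1 / (4 * τ)) * (1 * F y ^ 2 + y * (((2:ℕ):ℝ) * F y ^ (2 - 1) * F1 y))) (by fun_prop)
  have i2 := ii_of hR (h := fun y => F1 y ^ 2) (by fun_prop)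
  have i3 := ii_of hR (h := fun y => y ^ 2 * F y ^ 2) (by fun_prop)
  rw [b1, b2] at ibp
  have : ∫ y in (-R)..R, F y * (F2 y - y ^ 2 / (16 * τ ^ 2) * F y +
      (y / (2 * τ) * F1 y + F y / (4 * τ))) = ∫ y in (-R)..R,
      (((F1 y * F1 y + F y * F2 y) +
        (1 / (4 * τ)) * (1 * F y ^ 2 + y * (((2:ℕ):ℝ) * F y ^ (2 - 1) * F1 y))) - F1 y ^ 2)
        - (16 * τ ^ 2)⁻¹ * (y ^ 2 * F y ^ 2) := by
    congr 1; ext y; push_cast; field_simp; ring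
  rw [this, intervalIntegral.integral_sub (i1.sub i2) (i3.const_mul _),
    intervalIntegral.integral_sub i1 i2, intervalIntegral.integral_const_mul, ibp]
  ring

lemma static2 {F F1 F2 : ℝ → ℝ} {R τ : ℝ} (hR : 0 < R) (hτ : 0 < τ)
    (c0 : ContinuousOn F (Icc (-R) R)) (c1 : ContinuousOn F1 (Icc (-R) R))
    (c2 : ContinuousOn F2 (Icc (-R) R))
    (d1 : ∀ y ∈ Ioo (-R) R, HasDerivAt F (F1 y) y) (d2 : ∀ y ∈ Ioo (-R) R, HasDerivAt F1 (F2 y) y)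
    (b1 : F R = 0) (b2 : F (-R) = 0) (b3 : F1 R = 0) (b4 : F1 (-R) = 0) :
    ∫ y in (-R)..R, (F2 y - y ^ 2 / (16 * τ ^ 2) * F y) * (y / (2 * τ) * F1 y + F y / (4 * τ))
      = -(1 / (2 * τ)) * (∫ y in (-R)..R, F1 y ^ 2)
        + (∫ y in (-R)..R, y ^ 2 * F y ^ 2) / (32 * τ ^ 3) := by
  have cy : ContinuousOn (fun y : ℝ => y) (Icc (-R) R) := continuousOn_id
  set P' : ℝ → ℝ := fun y => (1 / (4 * τ)) * (1 * F1 y ^ 2 + y * (((2:ℕ):ℝ) * F1 y ^ (2 - 1) * F2 y))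
      + (1 / (4 * τ)) * (F1 y * F1 y + F y * F2 y)
      - (1 / (64 * τ ^ 3)) * ((((3:ℕ):ℝ) * y ^ (3 - 1) * 1) * F y ^ 2
        + y ^ 3 * (((2:ℕ):ℝ) * F y ^ (2 - 1) * F1 y)) with hP'
  have cP : ContinuousOn P' (Icc (-R) R) := by rw [hP']; fun_prop
  have ibp := intervalIntegral.integral_eq_sub_of_hasDerivAt_of_le (a := -R) (b := R)
      (f := fun y => (1 / (4 * τ)) * (y * F1 y ^ 2) + (1 / (4 * τ)) * (F y * F1 y)
        - (1 / (64 * τ ^ 3)) * (y ^ 3 * F y ^ 2))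
      (f' := P') (by linarith) (by fun_prop)
      (fun y hy => ((((hasDerivAt_id y).mul ((d2 y hy).pow 2)).const_mul _).add
        (((d1 y hy).mul (d2 y hy)).const_mul _)).sub
        ((((hasDerivAt_id y).pow 3).mul ((d1 y hy).pow 2)).const_mul _))
      (ii_of hR cP)
  have i1 := ii_of hR cP
  have i2 := ii_of hR (h := fun y => F1 y ^ 2) (by fun_prop)
  have i3 := ii_of hR (h := fun y => y ^ 2 * F y ^ 2) (by fun_prop)
  rw [b1, b2, b3, b4] at ibp
  have : ∫ y in (-R)..R, (F2 y - y ^ 2 / (16 * τ ^ 2) * F y) *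
      (y / (2 * τ) * F1 y + F y / (4 * τ)) = ∫ y in (-R)..R,
      (P' y - (1 / (2 * τ)) * F1 y ^ 2) + (32 * τ ^ 3)⁻¹ * (y ^ 2 * F y ^ 2) := by
    congr 1; ext y; rw [hP']; push_cast; field_simp; ring
  rw [this, intervalIntegral.integral_add (i1.sub (i2.const_mul _)) (i3.const_mul _),
    intervalIntegral.integral_sub i1 (i2.const_mul _), intervalIntegral.integral_const_mul,
    intervalIntegral.integral_const_mul, ibp]
  ring

lemma cs_int {F G : ℝ → ℝ} {R : ℝ} (hR : 0 < R)
    (c0 : ContinuousOn F (Icc (-R) R)) (c1 : ContinuousOn G (Icc (-R) R)) :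
    (∫ y in (-R)..R, F y * G y) ^ 2 ≤ (∫ y in (-R)..R, F y ^ 2) * (∫ y in (-R)..R, G y ^ 2) := by
  have i1 := ii_of hR (h := fun y => F y * G y) (by fun_prop)
  have i2 := ii_of hR (h := fun y => F y ^ 2) (by fun_prop)
  have i3 := ii_of hR (h := fun y => G y ^ 2) (by fun_prop)
  have hq : ∀ x : ℝ, 0 ≤ (∫ y in (-R)..R, G y ^ 2) * (x * x) +
      (-2 * (∫ y in (-R)..R, F y * G y)) * x + ∫ y in (-R)..R, F y ^ 2 := by
    intro x
    have h1 : 0 ≤ ∫ y in (-R)..R, (F y - x * G y) ^ 2 :=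
      intervalIntegral.integral_nonneg (by linarith) (fun y _ => sq_nonneg _)
    have h2 : ∫ y in (-R)..R, (F y - x * G y) ^ 2 =
        ∫ y in (-R)..R, (F y ^ 2 - (2 * x) * (F y * G y)) + (x * x) * G y ^ 2 := by
      congr 1; ext y; ring
    rw [h2, intervalIntegral.integral_add (i2.sub (i1.const_mul _)) (i3.const_mul _),
      intervalIntegral.integral_sub i2 (i1.const_mul _), intervalIntegral.integral_const_mul,
      intervalIntegral.integral_const_mul] at h1
    linarith
  have := discrim_le_zero hq
  rw [discrim] at this
  nlinarith

lemma anti_of {φ : ℝ → ℝ} {a b : ℝ} (hc : ContinuousOn φ (Icc a b))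
    (hd : ∀ t ∈ Ioo a b, ∃ d, HasDerivAt φ d t ∧ d ≤ 0) : AntitoneOn φ (Icc a b) := by
  refine antitoneOn_of_deriv_nonpos (convex_Icc a b) hc ?_ ?_
  · rw [interior_Icc]
    intro t ht
    obtain ⟨d, h1, -⟩ := hd t ht
    exact h1.differentiableAt.differentiableWithinAt
  · rw [interior_Icc]
    intro t ht
    obtain ⟨d, h1, h2⟩ := hd t ht
    rw [h1.deriv]; exact h2

lemma static0 {F F1 F2 : ℝ → ℝ} {R τ : ℝ} (hR : 0 < R)
    (c0 : ContinuousOn F (Icc (-R) R)) (c1 : ContinuousOn F1 (Icc (-R) R))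
    (c2 : ContinuousOn F2 (Icc (-R) R))
    (d1 : ∀ y ∈ Ioo (-R) R, HasDerivAt F (F1 y) y) (d2 : ∀ y ∈ Ioo (-R) R, HasDerivAt F1 (F2 y) y)
    (b1 : F R = 0) (b2 : F (-R) = 0) :
    ∫ y in (-R)..R, F y * (F2 y - y ^ 2 / (16 * τ ^ 2) * F y)
      = -((∫ y in (-R)..R, F1 y ^ 2) + (∫ y in (-R)..R, y ^ 2 * F y ^ 2) / (16 * τ ^ 2)) := by
  have cy : ContinuousOn (fun y : ℝ => y) (Icc (-R) R) := continuousOn_id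
  have ibp := intervalIntegral.integral_eq_sub_of_hasDerivAt_of_le (a := -R) (b := R)
      (f := fun y => F y * F1 y) (f' := fun y => (F1 y * F1 y + F y * F2 y))
      (by linarith) (by fun_prop)
      (fun y hy => ((d1 y hy).mul (d2 y hy)))
      (ii_of hR (by fun_prop))
  have i1 := ii_of hR (h := fun y => (F1 y * F1 y + F y * F2 y)) (by fun_prop)
  have i2 := ii_of hR (h := fun y => F1 y ^ 2) (by fun_prop)
  have i3 := ii_of hR (h := fun y => y ^ 2 * F y ^ 2) (by fun_prop)
  rw [b1, b2] at ibp
  have : ∫ y in (-R)..R, F y * (F2 y - y ^ 2 / (16 * τ ^ 2) * F y) = ∫ y in (-R)..R,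
      ((F1 y * F1 y + F y * F2 y) - F1 y ^ 2) - (16 * τ ^ 2)⁻¹ * (y ^ 2 * F y ^ 2) := by
    congr 1; ext y; ring
  rw [this, intervalIntegral.integral_sub (i1.sub i2) (i3.const_mul _),
    intervalIntegral.integral_sub i1 i2, intervalIntegral.integral_const_mul, ibp]
  ring

noncomputable def fH (f : ℝ → ℝ → ℝ) (R t : ℝ) : ℝ := ∫ y in (-R)..R, f y t ^ 2
noncomputable def fQ (f fy : ℝ → ℝ → ℝ) (R c t : ℝ) : ℝ :=
  (∫ y in (-R)..R, fy y t ^ 2) + (∫ y in (-R)..R, y ^ 2 * f y t ^ 2) / (16 * (c - t) ^ 2)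

lemma fQ_nonneg (f fy : ℝ → ℝ → ℝ) {R : ℝ} (hR : 0 < R) (c t : ℝ) : 0 ≤ fQ f fy R c t := by
  have h1 : 0 ≤ ∫ y in (-R)..R, fy y t ^ 2 :=
    intervalIntegral.integral_nonneg (by linarith) (fun y _ => sq_nonneg _)
  have h2 : 0 ≤ ∫ y in (-R)..R, y ^ 2 * f y t ^ 2 :=
    intervalIntegral.integral_nonneg (by linarith) (fun y _ => by positivity)
  unfold fQ; positivity

lemma freq_der {f fy fyy ft g : ℝ → ℝ → ℝ} {R L σ p c : ℝ} (F : Fam f fy fyy ft R L σ p)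
    (hcp : p < c)
    (h0 : ∀ t ∈ Icc σ p, f R t = 0) (h0' : ∀ t ∈ Icc σ p, f (-R) t = 0)
    (h1 : ∀ t ∈ Icc σ p, fy R t = 0) (h1' : ∀ t ∈ Icc σ p, fy (-R) t = 0)
    (hg : ∀ t ∈ Ioo σ p, ContinuousOn (fun y => g y t) (Icc (-R) R))
    (heq : ∀ t ∈ Ioo σ p, ∀ y ∈ Icc (-R) R, ft y t =
      (fyy y t - y ^ 2 / (16 * (c - t) ^ 2) * f y t) +
      (y / (2 * (c - t)) * fy y t + f y t / (4 * (c - t))) + g y t)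
    {t : ℝ} (ht : t ∈ Ioo σ p) :
    ∃ SS Sg fg gg : ℝ, gg = ∫ y in (-R)..R, g y t ^ 2 ∧
      HasDerivAt (fH f R) (-2 * fQ f fy R c t + 2 * fg) t ∧
      HasDerivAt (fQ f fy R c) (-2 * SS - 2 * Sg + fQ f fy R c t / (c - t)) t ∧
      (-fQ f fy R c t + fg / 2) ^ 2 ≤ (SS + Sg + gg / 4) * fH f R t ∧
      0 ≤ gg ∧ fg ^ 2 ≤ gg * fH f R t := by
  have hR := F.Rpos
  have hI : Ioo σ p ⊆ Icc σ p := Ioo_subset_Icc_self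
  have htI := hI ht
  have hτ : 0 < c - t := by linarith [ht.2]
  have cy : ContinuousOn (fun y : ℝ => y) (Icc (-R) R) := continuousOn_id
  have cf := slice_cont F.c0 htI
  have cfy := slice_cont F.c1 htI
  have cfyy := slice_cont F.c2 htI
  have cft := F.ct t ht
  have cg := hg t ht
  set τ := c - t with hτd
  set Sf : ℝ → ℝ := fun y => fyy y t - y ^ 2 / (16 * τ ^ 2) * f y t with hSf
  set Af : ℝ → ℝ := fun y => y / (2 * τ) * fy y t + f y t / (4 * τ) with hAf
  have cS : ContinuousOn Sf (Icc (-R) R) := by rw [hSf]; fun_prop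
  have cA : ContinuousOn Af (Icc (-R) R) := by rw [hAf]; fun_prop
  have s0 := static0 (τ := τ) hR cf cfy cfyy (F.dx t htI) (F.dxx t htI) (h0 t htI) (h0' t htI)
  have s1 := static1 hR hτ cf cfy cfyy (F.dx t htI) (F.dxx t htI) (h0 t htI) (h0' t htI)
  have s2 := static2 hR hτ cf cfy cfyy (F.dx t htI) (F.dxx t htI) (h0 t htI) (h0' t htI)
    (h1 t htI) (h1' t htI)
  change ∫ y in (-R)..R, f y t * Sf y = -fQ f fy R c t at s0
  change ∫ y in (-R)..R, f y t * (Sf y + Af y) = -fQ f fy R c t at s1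
  change ∫ y in (-R)..R, Sf y * Af y = _ at s2
  set E := ∫ y in (-R)..R, fy y t ^ 2 with hE
  set J := ∫ y in (-R)..R, y ^ 2 * f y t ^ 2 with hJ
  have hQ : fQ f fy R c t = E + J / (16 * τ ^ 2) := rfl
  refine ⟨∫ y in (-R)..R, Sf y ^ 2, ∫ y in (-R)..R, Sf y * g y t, ∫ y in (-R)..R, f y t * g y t,
    ∫ y in (-R)..R, g y t ^ 2, rfl, ?_, ?_, ?_, ?_, ?_⟩
  · have d := derK F (k := fun _ => 1) continuous_const ht
    have e0 : (fun t => ∫ y in (-R)..R, (1:ℝ) * f y t ^ 2) = fH f R := by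
      ext t; simp [fH]
    rw [e0] at d
    refine d.congr_deriv ?_
    have i1 := ii_of hR (h := fun y => f y t * (Sf y + Af y)) (by fun_prop)
    have i2 := ii_of hR (h := fun y => f y t * g y t) (by fun_prop)
    have : ∫ y in (-R)..R, (1:ℝ) * (2 * f y t * ft y t) =
        ∫ y in (-R)..R, 2 * (f y t * (Sf y + Af y)) + 2 * (f y t * g y t) := by
      apply intervalIntegral.integral_congr
      intro y hy
      rw [uIcc_of_le (by linarith)] at hy
      simp only
      rw [heq t ht y hy]
      simp only [hSf, hAf]
      ring
    rw [this, intervalIntegral.integral_add (i1.const_mul _) (i2.const_mul _),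
      intervalIntegral.integral_const_mul, intervalIntegral.integral_const_mul, s1]
    ring
  · have d1 := derE F h0 h0' ht
    have d2 := derK F (k := fun y => y ^ 2) (by fun_prop) ht
    have d3 : HasDerivAt (fun t => 16 * (c - t) ^ 2) (16 * (((2:ℕ):ℝ) * (c - t) ^ (2 - 1) * (-1))) t :=
      ((((hasDerivAt_id t).const_sub c).pow 2).const_mul 16)
    have d := d1.add (d2.div d3 (by rw [← hτd]; positivity))
    refine HasDerivAt.congr_deriv (f := fQ f fy R c) d ?_
    have i1 := ii_of hR (h := fun y => Sf y ^ 2) (by fun_prop)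
    have i2 := ii_of hR (h := fun y => Sf y * Af y) (by fun_prop)
    have i3 := ii_of hR (h := fun y => Sf y * g y t) (by fun_prop)
    have i4 := ii_of hR (h := fun y => (-2) * (fyy y t * ft y t)) (by fun_prop)
    have i5 := ii_of hR (h := fun y => y ^ 2 * (2 * f y t * ft y t)) (by fun_prop)
    have key : (∫ y in (-R)..R, (-2) * (fyy y t * ft y t)) +
        (∫ y in (-R)..R, y ^ 2 * (2 * f y t * ft y t)) / (16 * τ ^ 2) =
        -2 * (∫ y in (-R)..R, Sf y ^ 2) + -2 * (∫ y in (-R)..R, Sf y * Af y) +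
        -2 * (∫ y in (-R)..R, Sf y * g y t) := by
      rw [div_eq_inv_mul, ← intervalIntegral.integral_const_mul,
        ← intervalIntegral.integral_const_mul, ← intervalIntegral.integral_const_mul,
        ← intervalIntegral.integral_const_mul,
        ← intervalIntegral.integral_add i4 (i5.const_mul _),
        ← intervalIntegral.integral_add (i1.const_mul _) (i2.const_mul _),
        ← intervalIntegral.integral_add ((i1.const_mul _).add (i2.const_mul _)) (i3.const_mul _)]
      apply intervalIntegral.integral_congr
      intro y hy
      rw [uIcc_of_le (by linarith)] at hy
      simp only
      rw [heq t ht y hy]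
      simp only [hSf, hAf]
      ring
    rw [← hτd, ← hJ, hQ]
    rw [s2] at key
    have hτ0 : τ ≠ 0 := hτ.ne'
    have e : ∀ I4 I5 : ℝ, I4 + (I5 * (16 * τ ^ 2) - J * (16 * (((2:ℕ):ℝ) * τ ^ (2 - 1) * (-1)))) /
        (16 * τ ^ 2) ^ 2 = (I4 + I5 / (16 * τ ^ 2)) + J / (8 * τ ^ 3) := by
      intro I4 I5; push_cast; field_simp; ring
    rw [e, key]
    field_simp
    ring
  · have i1 := ii_of hR (h := fun y => Sf y ^ 2) (by fun_prop)
    have i3 := ii_of hR (h := fun y => Sf y * g y t) (by fun_prop)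
    have i4 := ii_of hR (h := fun y => g y t ^ 2) (by fun_prop)
    have i5 := ii_of hR (h := fun y => f y t * Sf y) (by fun_prop)
    have i6 := ii_of hR (h := fun y => f y t * g y t) (by fun_prop)
    have cs := cs_int hR (F := fun y => Sf y + g y t / 2) (G := fun y => f y t) (by fun_prop) cf
    have e1 : ∫ y in (-R)..R, (Sf y + g y t / 2) * f y t =
        -fQ f fy R c t + (∫ y in (-R)..R, f y t * g y t) / 2 := by
      rw [← s0, div_eq_inv_mul, ← intervalIntegral.integral_const_mul,
        ← intervalIntegral.integral_add i5 (i6.const_mul _)]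
      congr 1; ext y; ring
    have e2 : ∫ y in (-R)..R, (Sf y + g y t / 2) ^ 2 = (∫ y in (-R)..R, Sf y ^ 2) +
        (∫ y in (-R)..R, Sf y * g y t) + (∫ y in (-R)..R, g y t ^ 2) / 4 := by
      rw [div_eq_inv_mul, ← intervalIntegral.integral_const_mul,
        ← intervalIntegral.integral_add i1 i3,
        ← intervalIntegral.integral_add (i1.add i3) (i4.const_mul _)]
      congr 1; ext y; ring
    rw [e1, e2] at cs
    exact cs
  · exact intervalIntegral.integral_nonneg (by linarith) (fun y _ => sq_nonneg _)
  · have cs := cs_int hR (F := fun y => g y t) (G := fun y => f y t) cg cf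
    have e1 : ∫ y in (-R)..R, g y t * f y t = ∫ y in (-R)..R, f y t * g y t := by
      congr 1; ext y; ring
    rw [e1] at cs
    exact cs

lemma freq {f fy fyy ft g : ℝ → ℝ → ℝ} {R L σ p ε K N0 : ℝ} (F : Fam f fy fyy ft R L σ p)
    (hε : 0 < ε) (hε1 : ε ≤ 1) (hσp : σ ≤ p) (hσ1 : p - σ ≤ 1) (hK : 0 ≤ K) (hN0 : 0 ≤ N0)
    (h0 : ∀ t ∈ Icc σ p, f R t = 0) (h0' : ∀ t ∈ Icc σ p, f (-R) t = 0)
    (h1 : ∀ t ∈ Icc σ p, fy R t = 0) (h1' : ∀ t ∈ Icc σ p, fy (-R) t = 0)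
    (hg : ∀ t ∈ Ioo σ p, ContinuousOn (fun y => g y t) (Icc (-R) R))
    (heq : ∀ t ∈ Ioo σ p, ∀ y ∈ Icc (-R) R, ft y t =
      (fyy y t - y ^ 2 / (16 * (p + ε - t) ^ 2) * f y t) +
      (y / (2 * (p + ε - t)) * fy y t + f y t / (4 * (p + ε - t))) + g y t)
    (hgK : ∀ t ∈ Ioo σ p, ∫ y in (-R)..R, g y t ^ 2 ≤ K * (fH f R t + fQ f fy R (p + ε) t))
    (hH : ∀ t ∈ Icc σ p, 0 < fH f R t)
    (hN : (p + ε - σ) * fQ f fy R (p + ε) σ ≤ N0 * fH f R σ) :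
    fH f R σ * Real.exp ((K + 1) * σ -
        ((2 + K) * ((N0 + 2) * Real.exp (K / 2))) * Real.log (p + ε - σ)) ≤
    fH f R p * Real.exp ((K + 1) * p -
        ((2 + K) * ((N0 + 2) * Real.exp (K / 2))) * Real.log ε) := by
  have hR := F.Rpos
  set c := p + ε with hc
  have hτ : ∀ t ∈ Icc σ p, 0 < c - t := fun t ht => by linarith [ht.2]
  have hτ2 : ∀ t ∈ Icc σ p, c - t ≤ 2 := fun t ht => by linarith [ht.1]
  have hI : Ioo σ p ⊆ Icc σ p := Ioo_subset_Icc_self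
  have cH : ContinuousOn (fH f R) (Icc σ p) := contI hR (h := fun y t => f y t ^ 2) (F.c0.pow 2)
  have cQ : ContinuousOn (fQ f fy R c) (Icc σ p) := by
    refine (contI hR (h := fun y t => fy y t ^ 2) (F.c1.pow 2)).add
      ((contI hR (h := fun y t => y ^ 2 * f y t ^ 2)
        ((continuousOn_fst.pow 2).mul (F.c0.pow 2))).div (by fun_prop) ?_)
    intro t ht
    have := hτ t ht
    positivity
  have hD := fun t ht => freq_der (t := t) F (by linarith : p < c) h0 h0' h1 h1' hg heq ht
  set N : ℝ → ℝ := fun t => (c - t) * fQ f fy R c t / fH f R t with hNd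
  have cN : ContinuousOn N (Icc σ p) :=
    (ContinuousOn.mul (by fun_prop) cQ).div cH (fun t ht => (hH t ht).ne')
  have hNnn : ∀ t ∈ Icc σ p, 0 ≤ N t := fun t ht =>
    div_nonneg (mul_nonneg (hτ t ht).le (fQ_nonneg f fy hR c t)) (hH t ht).le
  have a1 : AntitoneOn (fun t => (N t + 2) * Real.exp (-(K / 2) * (t - σ))) (Icc σ p) := by
    refine anti_of (ContinuousOn.mul (cN.add continuousOn_const) (by fun_prop)) ?_
    intro t ht
    obtain ⟨SS, Sg, fg, gg, hgg, dH, dQ, cs, gg0, cs2⟩ := hD t ht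
    have dτ : HasDerivAt (fun t => c - t) (-1) t := (hasDerivAt_id t).const_sub c
    have dN := (dτ.mul dQ).div dH (hH t (hI ht)).ne'
    have dE : HasDerivAt (fun t => Real.exp (-(K / 2) * (t - σ)))
        (Real.exp (-(K / 2) * (t - σ)) * (-(K / 2) * 1)) t :=
      (((hasDerivAt_id t).sub_const σ).const_mul (-(K / 2))).exp
    refine ⟨_, (dN.add_const 2).mul dE, ?_⟩
    have hHt := hH t (hI ht)
    have hτt := hτ t (hI ht)
    have hτ2t := hτ2 t (hI ht)
    have hgg' := hgK t ht
    rw [← hgg] at hgg'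
    have hNt : N t = (c - t) * fQ f fy R c t / fH f R t := rfl
    set H := fH f R t
    set Q := fQ f fy R c t
    set τ := c - t
    have hEp := Real.exp_pos (-(K / 2) * (t - σ))
    set e := Real.exp (-(K / 2) * (t - σ))
    have hb : ((-1 * Q + τ * (-2 * SS - 2 * Sg + Q / τ)) * H - τ * Q * (-2 * Q + 2 * fg)) / H ^ 2
        ≤ K / 2 * (N t + 2) := by
      rw [div_le_iff₀ (by positivity)]
      have e1 : (-1 * Q + τ * (-2 * SS - 2 * Sg + Q / τ)) * H - τ * Q * (-2 * Q + 2 * fg)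
          = 2 * τ * (-((SS + Sg + gg / 4) * H) + (-Q + fg / 2) ^ 2 - fg ^ 2 / 4 + gg * H / 4) := by
        field_simp; ring
      have e2 : K / 2 * (N t + 2) * H ^ 2 = (K / 2) * (τ * Q + 2 * H) * H := by
        rw [hNt]; field_simp
      rw [e1, e2]
      have e3 : 2 * τ * (-((SS + Sg + gg / 4) * H) + (-Q + fg / 2) ^ 2 - fg ^ 2 / 4 + gg * H / 4)
          ≤ 2 * τ * (gg * H / 4) := by
        apply mul_le_mul_of_nonneg_left _ (by linarith)
        nlinarith [sq_nonneg fg]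
      have e4 : 2 * τ * (gg * H / 4) ≤ 2 * τ * ((K * (H + Q)) * H / 4) := by gcongr
      have e5 : τ * (K * H * H) ≤ 2 * (K * H * H) := by gcongr
      nlinarith
    have : ((-1 * Q + τ * (-2 * SS - 2 * Sg + Q / τ)) * H - τ * Q * (-2 * Q + 2 * fg)) / H ^ 2 * e
        + (N t + 2) * (e * (-(K / 2) * 1)) ≤ 0 := by
      nlinarith
    exact this
  set N1 := (N0 + 2) * Real.exp (K / 2) with hN1
  have hNb : ∀ t ∈ Icc σ p, N t ≤ N1 := by
    intro t ht
    have h := a1 (left_mem_Icc.mpr hσp) ht ht.1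
    simp only [sub_self, mul_zero, Real.exp_zero, mul_one] at h
    have hNσ : N σ ≤ N0 := by
      rw [hNd]; simp only
      rw [div_le_iff₀ (hH σ (left_mem_Icc.mpr hσp))]; exact hN
    have hE : Real.exp (-(K / 2)) ≤ Real.exp (-(K / 2) * (t - σ)) := by
      apply Real.exp_le_exp.mpr
      nlinarith [ht.2]
    have h2 : (N t + 2) * Real.exp (-(K / 2)) ≤ N0 + 2 := by
      have := hNnn t ht
      nlinarith
    have h3 : Real.exp (-(K / 2)) * Real.exp (K / 2) = 1 := by rw [← Real.exp_add]; simp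
    have h4 : (N t + 2) * Real.exp (-(K / 2)) * Real.exp (K / 2) ≤ N1 :=
      mul_le_mul_of_nonneg_right h2 (Real.exp_pos _).le
    rw [mul_assoc, h3] at h4
    linarith
  have hN1p : 0 ≤ N1 := by positivity
  have a2 : AntitoneOn (fun t => -(fH f R t * Real.exp ((K + 1) * t - ((2 + K) * N1) *
      Real.log (c - t)))) (Icc σ p) := by
    refine anti_of (ContinuousOn.neg (cH.mul ?_)) ?_
    · refine Real.continuous_exp.comp_continuousOn ?_
      refine ContinuousOn.sub (by fun_prop) (continuousOn_const.mul ?_)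
      exact ContinuousOn.log (by fun_prop) (fun t ht => (hτ t ht).ne')
    intro t ht
    obtain ⟨SS, Sg, fg, gg, hgg, dH, dQ, cs, gg0, cs2⟩ := hD t ht
    have hHt := hH t (hI ht)
    have hτt := hτ t (hI ht)
    have dτ : HasDerivAt (fun t => c - t) (-1) t := (hasDerivAt_id t).const_sub c
    have dE := ((((hasDerivAt_id t).const_mul (K + 1)).sub
      ((dτ.log hτt.ne').const_mul ((2 + K) * N1))).exp)
    refine ⟨_, (dH.mul dE).neg, ?_⟩
    have hgg' := hgK t ht
    rw [← hgg] at hgg'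
    have hNt : N t = (c - t) * fQ f fy R c t / fH f R t := rfl
    have hNbt := hNb t (hI ht)
    rw [hNt, div_le_iff₀ hHt] at hNbt
    have hQ0 := fQ_nonneg f fy hR c t
    simp only [Pi.sub_apply]
    set H := fH f R t
    set Q := fQ f fy R c t
    set τ := c - t
    set e := Real.exp ((K + 1) * id t - (2 + K) * N1 * Real.log τ)
    have hep : 0 < e := Real.exp_pos _
    have hQb : Q ≤ N1 * H / τ := by rw [le_div_iff₀ hτt]; linarith
    have hfg : -(gg + H) ≤ 2 * fg := by
      have : (2 * fg) ^ 2 ≤ (gg + H) ^ 2 := by nlinarith [sq_nonneg (gg - H)]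
      have := abs_le_of_sq_le_sq this (by linarith)
      exact (abs_le.mp this).1
    have hmain : 0 ≤ (-2 * Q + 2 * fg) + H * ((K + 1) * 1 - (2 + K) * N1 * (-1 / τ)) := by
      have : (2 + K) * Q ≤ (2 + K) * (N1 * H / τ) := by gcongr
      have e : H * ((K + 1) * 1 - (2 + K) * N1 * (-1 / τ)) = (K + 1) * H + (2 + K) * (N1 * H / τ) := by
        field_simp
        ring
      rw [e]
      nlinarith
    have : (-2 * Q + 2 * fg) * e + H * (e * ((K + 1) * 1 - (2 + K) * N1 * (-1 / τ))) =
      e * ((-2 * Q + 2 * fg) + H * ((K + 1) * 1 - (2 + K) * N1 * (-1 / τ))) := by ring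
    have h2 := mul_nonneg hep.le hmain
    rw [← this] at h2
    exact neg_nonpos.mpr h2
  have := a2 (left_mem_Icc.mpr hσp) (right_mem_Icc.mpr hσp) hσp
  simp only at this
  rw [show c - p = ε by rw [hc]; ring] at this
  linarith

lemma Rec_sub_t {α β σ q p : ℝ} (h : σ ≤ q) : Rec α β q p ⊆ Rec α β σ p :=
  fun z hz => ⟨⟨h.trans hz.1.1, hz.1.2⟩, hz.2⟩

lemma Fam.restr {f fy fyy ft : ℝ → ℝ → ℝ} {R L σ p q : ℝ} (F : Fam f fy fyy ft R L σ p)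
    (h : σ ≤ q) : Fam f fy fyy ft R L q p := by
  have h1 : Ioo q p ⊆ Ioo σ p := Ioo_subset_Ioo_left h
  have h2 : Icc q p ⊆ Icc σ p := Icc_subset_Icc_left h
  exact ⟨F.Rpos, F.c0.mono (Rec_sub_t h), F.c1.mono (Rec_sub_t h), F.c2.mono (Rec_sub_t h),
    fun t ht => F.ct t (h1 ht), fun t ht => F.bt t (h1 ht), fun t ht => F.dx t (h2 ht),
    fun t ht => F.dxx t (h2 ht), fun t ht => F.dt t (h1 ht)⟩

lemma cutoff {R R1 : ℝ} (hR1 : 0 < R1) (h : R1 < R) : ∃ φ φ1 φ2 : ℝ → ℝ,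
    Continuous φ ∧ Continuous φ1 ∧ Continuous φ2 ∧ (∀ y, HasDerivAt φ (φ1 y) y) ∧
    (∀ y, HasDerivAt φ1 (φ2 y) y) ∧ (∀ y, 0 ≤ φ y) ∧ (∀ y, φ y ≤ 1) ∧
    (∀ y, |y| ≤ R1 → φ y = 1) ∧ φ R = 0 ∧ φ (-R) = 0 ∧ φ1 R = 0 ∧ φ1 (-R) = 0 ∧
    (∀ y, |y| < R1 → φ1 y = 0) ∧ (∀ y, |y| < R1 → φ2 y = 0) := by
  have hpos : 0 < R ^ 2 - R1 ^ 2 := by nlinarith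
  set φ : ℝ → ℝ := fun y => Real.smoothTransition ((R ^ 2 - y ^ 2) / (R ^ 2 - R1 ^ 2)) with hφ
  have hC : ContDiff ℝ 2 φ := by
    have : ContDiff ℝ 2 Real.smoothTransition := Real.smoothTransition.contDiff (n := 2)
    exact this.comp (by fun_prop)
  have hC1 : ContDiff ℝ 1 (deriv φ) := by
    have := (contDiff_succ_iff_deriv (n := 1) (f := φ)).mp hC
    exact this.2.2
  have hC2 : Continuous (deriv (deriv φ)) := hC1.continuous_deriv le_rfl
  have d1 : ∀ y, HasDerivAt φ (deriv φ y) y := fun y =>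
    (hC.differentiable (by norm_num) y).hasDerivAt
  have d2 : ∀ y, HasDerivAt (deriv φ) (deriv (deriv φ) y) y := fun y =>
    (hC1.differentiable (by norm_num) y).hasDerivAt
  have z1 : φ R = 0 := by simp [hφ, Real.smoothTransition.zero]
  have z2 : φ (-R) = 0 := by simp [hφ, Real.smoothTransition.zero]
  have nn : ∀ y, 0 ≤ φ y := fun y => Real.smoothTransition.nonneg _
  have one : ∀ y, |y| ≤ R1 → φ y = 1 := by
    intro y hy
    refine Real.smoothTransition.one_of_one_le ?_
    rw [le_div_iff₀ hpos]
    have := sq_le_sq' (by linarith [(abs_le.mp hy).1]) (abs_le.mp hy).2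
    linarith
  have w1 : ∀ y, |y| < R1 → deriv φ y = 0 := by
    intro y hy
    have : φ =ᶠ[𝓝 y] fun _ => 1 := by
      filter_upwards [(continuous_abs.isOpen_preimage _ isOpen_Iio).mem_nhds
        (show y ∈ (fun y : ℝ => |y|) ⁻¹' Iio R1 from hy)] with z hz
      exact one z (le_of_lt hz)
    rw [this.deriv_eq]; simp
  have w2 : ∀ y, |y| < R1 → deriv (deriv φ) y = 0 := by
    intro y hy
    have : deriv φ =ᶠ[𝓝 y] fun _ => 0 := by
      filter_upwards [(continuous_abs.isOpen_preimage _ isOpen_Iio).mem_nhds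
        (show y ∈ (fun y : ℝ => |y|) ⁻¹' Iio R1 from hy)] with z hz
      exact w1 z hz
    rw [this.deriv_eq]; simp
  refine ⟨φ, deriv φ, deriv (deriv φ), hC.continuous, hC1.continuous, hC2, d1, d2, nn,
    fun y => Real.smoothTransition.le_one _, one, z1, z2, ?_, ?_, w1, w2⟩
  · exact IsLocalMin.deriv_eq_zero (Eventually.of_forall fun y => by rw [z1]; exact nn y)
  · exact IsLocalMin.deriv_eq_zero (Eventually.of_forall fun y => by rw [z2]; exact nn y)

lemma conj_fam {w wy wyy wt : ℝ → ℝ → ℝ} {R L σ p c : ℝ} (W : Fam w wy wyy wt R L σ p)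
    (hc : p < c) : ∃ L', Fam (fun y t => Real.exp (-y ^ 2 / (8 * (c - t))) * w y t)
      (fun y t => Real.exp (-y ^ 2 / (8 * (c - t))) * (wy y t - y / (4 * (c - t)) * w y t))
      (fun y t => Real.exp (-y ^ 2 / (8 * (c - t))) * (wyy y t - y / (2 * (c - t)) * wy y t
        + (y ^ 2 / (16 * (c - t) ^ 2) - 1 / (4 * (c - t))) * w y t))
      (fun y t => Real.exp (-y ^ 2 / (8 * (c - t))) * (wt y t - y ^ 2 / (8 * (c - t) ^ 2) * w y t))
      R L' σ p := by
  have hτ : ∀ t ∈ Icc σ p, 0 < c - t := fun t ht => by linarith [ht.2]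
  have hτ' : ∀ q ∈ Rec (-R) R σ p, c - q.2 ≠ 0 := fun q hq => (hτ q.2 hq.1).ne'
  have cE : ContinuousOn (fun q : ℝ × ℝ => Real.exp (-q.1 ^ 2 / (8 * (c - q.2)))) (Rec (-R) R σ p) := by
    refine Real.continuous_exp.comp_continuousOn (ContinuousOn.div (by fun_prop) (by fun_prop) ?_)
    intro q hq; exact mul_ne_zero (by norm_num) (hτ' q hq)
  obtain ⟨B, hB0, hB⟩ := rec_bound (h := fun y t => y ^ 2 / (8 * (c - t) ^ 2) * w y t)
    (α := -R) (β := R) (σ := σ) (p := p) (by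
      refine ContinuousOn.mul (ContinuousOn.div (by fun_prop) (by fun_prop) ?_) W.c0
      intro q hq; exact mul_ne_zero (by norm_num) (pow_ne_zero _ (hτ' q hq)))
  have dE : ∀ y t, HasDerivAt (fun z => Real.exp (-z ^ 2 / (8 * (c - t))))
      (Real.exp (-y ^ 2 / (8 * (c - t))) * (-(y / (4 * (c - t))))) y := by
    intro y t
    have := (((hasDerivAt_id y).pow 2).neg.div_const (8 * (c - t))).exp
    simp only [Pi.neg_apply, Pi.pow_apply, id] at this
    refine this.congr_deriv ?_
    congr 1
    by_cases h : c - t = 0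
    · simp [h]
    · norm_num; field_simp; ring
  refine ⟨L + B, W.Rpos, cE.mul W.c0, cE.mul (W.c1.sub ?_), cE.mul ((W.c2.sub ?_).add ?_),
    ?_, ?_, ?_, ?_, ?_⟩
  · refine ContinuousOn.mul (ContinuousOn.div (by fun_prop) (by fun_prop) ?_) W.c0
    intro q hq; exact mul_ne_zero (by norm_num) (hτ' q hq)
  · refine ContinuousOn.mul (ContinuousOn.div (by fun_prop) (by fun_prop) ?_) W.c1
    intro q hq; exact mul_ne_zero (by norm_num) (hτ' q hq)
  · refine ContinuousOn.mul (ContinuousOn.sub (ContinuousOn.div (by fun_prop) (by fun_prop) ?_)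
      (ContinuousOn.div (by fun_prop) (by fun_prop) ?_)) W.c0
    · intro q hq; exact mul_ne_zero (by norm_num) (pow_ne_zero _ (hτ' q hq))
    · intro q hq; exact mul_ne_zero (by norm_num) (hτ' q hq)
  · intro t ht
    have h1 : ContinuousOn (fun y => w y t) (Icc (-R) R) := slice_cont W.c0 (Ioo_subset_Icc_self ht)
    have h2 := W.ct t ht
    exact ContinuousOn.mul (by fun_prop) (h2.sub (ContinuousOn.mul (by fun_prop) h1))
  · intro t ht y hy
    have h1 := W.bt t ht y hy
    have h2 := hB t (Ioo_subset_Icc_self ht) y hy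
    have hτt := hτ t (Ioo_subset_Icc_self ht)
    have h3 : Real.exp (-y ^ 2 / (8 * (c - t))) ≤ 1 := by
      rw [Real.exp_le_one_iff]
      exact div_nonpos_of_nonpos_of_nonneg (by nlinarith [sq_nonneg y]) (by linarith)
    rw [abs_mul, abs_of_pos (Real.exp_pos _)]
    have h4 := (abs_sub (wt y t) (y ^ 2 / (8 * (c - t) ^ 2) * w y t)).trans (add_le_add h1 h2)
    calc _ ≤ 1 * (L + B) := mul_le_mul h3 h4 (abs_nonneg _) zero_le_one
      _ = _ := one_mul _
  · intro t ht y hy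
    refine ((dE y t).mul (W.dx t ht y hy)).congr_deriv ?_
    ring
  · intro t ht y hy
    have hτt := (hτ t ht).ne'
    have d1 := ((W.dxx t ht y hy).sub ((((hasDerivAt_id y).div_const (4 * (c - t)))).mul (W.dx t ht y hy)))
    simp only [id] at d1
    refine ((dE y t).mul d1).congr_deriv ?_
    simp only [Pi.sub_apply, Pi.mul_apply]
    field_simp
    ring
  · intro t ht y hy
    have hτt := (hτ t (Ioo_subset_Icc_self ht)).ne'
    have d1 := (((((hasDerivAt_id t).const_sub c).const_mul 8).fun_inv
      (mul_ne_zero (by norm_num) hτt)).const_mul (-y ^ 2)).exp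
    simp only [id] at d1
    have := d1.mul (W.dt t ht y hy)
    simp only [← div_eq_mul_inv] at this
    refine this.congr_deriv ?_
    field_simp
    ring

lemma int_le_const {R B : ℝ} (hR : 0 < R) {h : ℝ → ℝ} (hc : ContinuousOn h (Icc (-R) R))
    (hb : ∀ y ∈ Icc (-R) R, h y ≤ B) : ∫ y in (-R)..R, h y ≤ 2 * R * B := by
  have := intervalIntegral.integral_mono_on (by linarith) (ii_of hR hc)
    (intervalIntegrable_const (c := B)) hb
  rw [intervalIntegral.integral_const] at this
  simp only [smul_eq_mul] at this
  linarith

lemma int_lower {R y1 y2 B : ℝ} (hR : 0 < R) {h : ℝ → ℝ} (hc : ContinuousOn h (Icc (-R) R))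
    (h1 : -R ≤ y1) (h12 : y1 ≤ y2) (h2 : y2 ≤ R) (hn : ∀ y, 0 ≤ h y)
    (hb : ∀ y ∈ Icc y1 y2, B ≤ h y) : (y2 - y1) * B ≤ ∫ y in (-R)..R, h y := by
  have hi : IntervalIntegrable h MeasureTheory.volume y1 y2 :=
    ContinuousOn.intervalIntegrable (by
      rw [uIcc_of_le h12]; exact hc.mono (Icc_subset_Icc h1 h2))
  have e1 := intervalIntegral.integral_mono_on h12 (intervalIntegrable_const (c := B)) hi hb
  rw [intervalIntegral.integral_const] at e1
  simp only [smul_eq_mul] at e1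
  have e2 : ∫ y in y1..y2, h y ≤ ∫ y in (-R)..R, h y :=
    intervalIntegral.integral_mono_interval h1 h12 h2 (Eventually.of_forall hn) (ii_of hR hc)
  linarith

set_option maxHeartbeats 2000000 in
/-- error estimate -/
lemma uc_w {w wy wyy wt : ℝ → ℝ → ℝ} {R R1 L Lc M m ρ y1 y2 q p : ℝ}
    (W : Fam w wy wyy wt R L q p) (hqp : q < p) (hq1 : p - q ≤ 1) (hM : 0 ≤ M) (hLc : 0 ≤ Lc)
    (h0 : ∀ t ∈ Icc q p, w R t = 0) (h0' : ∀ t ∈ Icc q p, w (-R) t = 0)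
    (h1 : ∀ t ∈ Icc q p, wy R t = 0) (h1' : ∀ t ∈ Icc q p, wy (-R) t = 0)
    (hR1 : 0 < R1) (hR1R : R1 < R)
    (hin : ∀ t ∈ Ioo q p, ∀ y ∈ Icc (-R) R, |wt y t - wyy y t| ≤ M * (|w y t| + |wy y t|) + Lc)
    (hin' : ∀ t ∈ Ioo q p, ∀ y ∈ Icc (-R) R, |y| < R1 →
      |wt y t - wyy y t| ≤ M * (|w y t| + |wy y t|))
    (hy1 : -R1 ≤ y1) (hy12 : y1 < y2) (hy2 : y2 ≤ R1) (hm : 0 < m)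
    (hlow : ∀ t ∈ Icc q p, ∀ y ∈ Icc y1 y2, m ≤ |w y t|)
    (hρ : 0 < ρ) (hz : ∀ y, |y| ≤ ρ → w y p = 0) : False := by
  have hR := W.Rpos
  obtain ⟨B0, hB0, hB0'⟩ := rec_bound W.c0
  obtain ⟨B1, hB1, hB1'⟩ := rec_bound W.c1
  set δ := p - q with hδ
  have hδ0 : 0 < δ := by rw [hδ]; linarith
  set c0 := (y2 - y1) * (m ^ 2 * Real.exp (-R1 ^ 2 / (4 * δ))) with hc0
  have hc0p : 0 < c0 := by
    have : 0 < y2 - y1 := by linarith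
    positivity
  set Bq := 2 * R * (B1 + R / (4 * δ) * B0) ^ 2 + 2 * R * (R ^ 2 * B0 ^ 2) / (16 * δ ^ 2) with hBq
  have hBq0 : 0 ≤ Bq := by positivity
  set N0 := 2 * Bq / c0 with hN0
  have hN00 : 0 ≤ N0 := by positivity
  set K := 6 * M ^ 2 + 6 * R * Lc ^ 2 / ((y2 - y1) * m ^ 2) with hK
  have hd : 0 < (y2 - y1) * m ^ 2 := by
    have : 0 < y2 - y1 := by linarith
    positivity
  have hK0 : 0 ≤ K := by positivity
  set C1 := (2 + K) * ((N0 + 2) * Real.exp (K / 2)) with hC1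
  have hC10 : 0 < C1 := by positivity
  have key : ∀ ε, 0 < ε → ε ≤ 1 →
      c0 * Real.exp ((K + 1) * q - C1 * Real.log 2) ≤
      (2 * R * B0 ^ 2 * Real.exp ((K + 1) * p)) * Real.exp (-(ρ ^ 2 / (4 * ε)) - C1 * Real.log ε) := by
    intro ε hε hε1
    set c := p + ε with hc
    obtain ⟨L', F⟩ := conj_fam W (c := c) (by linarith)
    have hτ : ∀ t ∈ Icc q p, 0 < c - t := fun t ht => by linarith [ht.2]
    have hI : Ioo q p ⊆ Icc q p := Ioo_subset_Icc_self
    set f : ℝ → ℝ → ℝ := fun y t => Real.exp (-y ^ 2 / (8 * (c - t))) * w y t with hf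
    set fy : ℝ → ℝ → ℝ := fun y t =>
      Real.exp (-y ^ 2 / (8 * (c - t))) * (wy y t - y / (4 * (c - t)) * w y t) with hfy
    have e2 : ∀ y t, Real.exp (-y ^ 2 / (8 * (c - t))) ^ 2 = Real.exp (-y ^ 2 / (4 * (c - t))) := by
      intro y t
      rw [← Real.exp_nat_mul]
      congr 1
      by_cases h : c - t = 0
      · simp [h]
      · push_cast; field_simp; ring
    have hlowH : ∀ t ∈ Icc q p, (y2 - y1) * (m ^ 2 * Real.exp (-R1 ^ 2 / (4 * (c - t)))) ≤ fH f R t := by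
      intro t ht
      refine int_lower hR (h := fun y => f y t ^ 2) ((slice_cont F.c0 ht).pow 2) (by linarith)
        hy12.le (by linarith) (fun y => sq_nonneg _) ?_
      intro y hy
      have h1 := hlow t ht y hy
      have h2 : m ^ 2 ≤ w y t ^ 2 := by rw [← sq_abs (w y t)]; gcongr
      have h3 : y ^ 2 ≤ R1 ^ 2 := sq_le_sq' (by linarith [hy.1]) (by linarith [hy.2])
      have hτt := hτ t ht
      have h4 : Real.exp (-R1 ^ 2 / (4 * (c - t))) ≤ Real.exp (-y ^ 2 / (4 * (c - t))) := by gcongr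
      simp only [hf]
      rw [mul_pow, e2, mul_comm]
      gcongr
    have hH : ∀ t ∈ Icc q p, 0 < fH f R t := by
      intro t ht
      refine lt_of_lt_of_le ?_ (hlowH t ht)
      have : 0 < y2 - y1 := by linarith
      positivity
    have hHq : c0 ≤ fH f R q := by
      refine le_trans ?_ (hlowH q ⟨le_rfl, hqp.le⟩)
      have : 0 ≤ y2 - y1 := by linarith
      have h5 : δ ≤ c - q := by rw [hδ, hc]; linarith
      have h6 : -R1 ^ 2 / (4 * δ) ≤ -R1 ^ 2 / (4 * (c - q)) := by
        rw [neg_div, neg_div, neg_le_neg_iff]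
        gcongr
      rw [hc0]
      gcongr
    have hQq : fQ f fy R c q ≤ Bq := by
      have hq : q ∈ Icc q p := ⟨le_rfl, hqp.le⟩
      have h5 : δ ≤ c - q := by rw [hδ, hc]; linarith
      have hE1 : ∀ y, Real.exp (-y ^ 2 / (8 * (c - q))) ≤ 1 := by
        intro y
        rw [Real.exp_le_one_iff]
        exact div_nonpos_of_nonpos_of_nonneg (by linarith [sq_nonneg y]) (by linarith)
      have hfb : ∀ y ∈ Icc (-R) R, f y q ^ 2 ≤ B0 ^ 2 := by
        intro y hy
        rw [← sq_abs]
        have : |f y q| ≤ B0 := by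
          simp only [hf]
          rw [abs_mul, abs_of_pos (Real.exp_pos _)]
          calc _ ≤ 1 * B0 := mul_le_mul (hE1 y) (hB0' q hq y hy) (abs_nonneg _) zero_le_one
            _ = _ := one_mul _
        gcongr
      have a1 : ∫ y in (-R)..R, fy y q ^ 2 ≤ 2 * R * (B1 + R / (4 * δ) * B0) ^ 2 := by
        refine int_le_const hR (h := fun y => fy y q ^ 2) ((slice_cont F.c1 hq).pow 2) ?_
        intro y hy
        rw [← sq_abs]
        have : |fy y q| ≤ B1 + R / (4 * δ) * B0 := by
          simp only [hfy]
          rw [abs_mul, abs_of_pos (Real.exp_pos _)]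
          have h7 : |wy y q - y / (4 * (c - q)) * w y q| ≤ B1 + R / (4 * δ) * B0 := by
            refine (abs_sub _ _).trans ?_
            rw [abs_mul, abs_div, abs_of_pos (show 0 < 4 * (c - q) by linarith)]
            have := hB0' q hq y hy
            have := hB1' q hq y hy
            have : |y| ≤ R := abs_le.mpr hy
            gcongr
          calc _ ≤ 1 * (B1 + R / (4 * δ) * B0) := mul_le_mul (hE1 y) h7 (abs_nonneg _) zero_le_one
            _ = _ := one_mul _
        gcongr
      have a2 : ∫ y in (-R)..R, y ^ 2 * f y q ^ 2 ≤ 2 * R * (R ^ 2 * B0 ^ 2) := by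
        refine int_le_const hR (h := fun y => y ^ 2 * f y q ^ 2)
          ((continuousOn_id.pow 2).mul ((slice_cont F.c0 hq).pow 2)) ?_
        intro y hy
        have h8 : y ^ 2 ≤ R ^ 2 := sq_le_sq' hy.1 hy.2
        have := hfb y hy
        gcongr
      unfold fQ
      rw [hBq]
      gcongr
    have hfr := freq (g := fun y t => Real.exp (-y ^ 2 / (8 * (c - t))) * (wt y t - wyy y t))
      (K := K) (N0 := N0) F hε hε1 hqp.le hq1 hK0 hN00 ?_ ?_ ?_ ?_ ?_ ?_ ?_ hH ?_
    rotate_left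
    · intro t ht; simp [hf, h0 t ht]
    · intro t ht; simp [hf, h0' t ht]
    · intro t ht; simp [hfy, h0 t ht, h1 t ht]
    · intro t ht; simp [hfy, h0' t ht, h1' t ht]
    · intro t ht
      have := W.ct t ht
      have := slice_cont W.c2 (hI ht)
      exact ContinuousOn.mul (by fun_prop) (by fun_prop)
    · intro t ht y hy
      have := (hτ t (hI ht)).ne'
      simp only [hf, hfy]
      rw [← hc]
      field_simp
      ring
    · intro t ht
      have hτt := hτ t (hI ht)
      have c0' := slice_cont F.c0 (hI ht)
      have c1' := slice_cont F.c1 (hI ht)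
      have i1 := ii_of hR (h := fun y => f y t ^ 2) (c0'.pow 2)
      have i2 := ii_of hR (h := fun y => fy y t ^ 2) (c1'.pow 2)
      have i3 := ii_of hR (h := fun y => y ^ 2 * f y t ^ 2) ((continuousOn_id.pow 2).mul (c0'.pow 2))
      set Z := 3 * (Lc ^ 2 * Real.exp (-R1 ^ 2 / (4 * (c - t)))) with hZ
      have mono := intervalIntegral.integral_mono_on (μ := MeasureTheory.volume)
        (a := -R) (b := R) (by linarith)
        (f := fun y => (Real.exp (-y ^ 2 / (8 * (c - t))) * (wt y t - wyy y t)) ^ 2)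
        (g := fun y => 3 * M ^ 2 * f y t ^ 2 + 6 * M ^ 2 * fy y t ^ 2 +
          6 * M ^ 2 / (16 * (c - t) ^ 2) * (y ^ 2 * f y t ^ 2) + Z)
        (ii_of hR (by
          have := W.ct t ht
          have := slice_cont W.c2 (hI ht)
          exact ContinuousOn.pow (ContinuousOn.mul (by fun_prop) (by fun_prop)) 2))
        ((((i1.const_mul _).add (i2.const_mul _)).add (i3.const_mul _)).add intervalIntegrable_const) ?_
      · have i12 := (i1.const_mul (3 * M ^ 2)).add (i2.const_mul (6 * M ^ 2))
        have i123 := i12.add (i3.const_mul (6 * M ^ 2 / (16 * (c - t) ^ 2)))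
        rw [intervalIntegral.integral_add i123 intervalIntegrable_const,
          intervalIntegral.integral_add i12 (i3.const_mul _),
          intervalIntegral.integral_add (i1.const_mul _) (i2.const_mul _),
          intervalIntegral.integral_const_mul, intervalIntegral.integral_const_mul,
          intervalIntegral.integral_const_mul, intervalIntegral.integral_const] at mono
        simp only [smul_eq_mul] at mono
        refine mono.trans ?_
        have hl := hlowH t (hI ht)
        have hQ0 := fQ_nonneg f fy hR c t
        have hHt := hH t (hI ht)
        have e5 : (R - -R) * Z = 6 * R * Lc ^ 2 / ((y2 - y1) * m ^ 2) *
            ((y2 - y1) * (m ^ 2 * Real.exp (-R1 ^ 2 / (4 * (c - t))))) := by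
          rw [hZ]
          have : y2 - y1 ≠ 0 := by linarith
          field_simp; ring
        have e6 : (R - -R) * Z ≤ 6 * R * Lc ^ 2 / ((y2 - y1) * m ^ 2) * fH f R t := by
          rw [e5]; gcongr
        have e7 : 0 ≤ 6 * R * Lc ^ 2 / ((y2 - y1) * m ^ 2) * fQ f fy R c t := by positivity
        have e8 : 6 * M ^ 2 * (∫ y in (-R)..R, fy y t ^ 2) +
          6 * M ^ 2 / (16 * (c - t) ^ 2) * (∫ y in (-R)..R, y ^ 2 * f y t ^ 2)
          = 6 * M ^ 2 * fQ f fy R c t := by unfold fQ; ring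
        have e9 : (∫ y in (-R)..R, f y t ^ 2) = fH f R t := rfl
        have e10 : 0 ≤ 3 * M ^ 2 * fH f R t := by positivity
        rw [e9, hK]
        generalize 6 * R * Lc ^ 2 / ((y2 - y1) * m ^ 2) = κ at *
        have e11 : (6 * M ^ 2 + κ) * (fH f R t + fQ f fy R c t) = 2 * (3 * M ^ 2 * fH f R t)
          + κ * fH f R t + 6 * M ^ 2 * fQ f fy R c t + κ * fQ f fy R c t := by ring
        rw [e11]
        linarith
      · intro y hy
        have hw : Real.exp (-y ^ 2 / (8 * (c - t))) * wy y t = fy y t + y / (4 * (c - t)) * f y t := by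
          simp only [hf, hfy]; ring
        have hab : ∀ X A B C : ℝ, 0 ≤ X → X ≤ A + B + C → X ^ 2 ≤ 3 * A ^ 2 + 3 * B ^ 2 + 3 * C ^ 2 := by
          intro X A B C h1 h2
          have : X ^ 2 ≤ (A + B + C) ^ 2 := by gcongr
          linarith [sq_nonneg (A - B), sq_nonneg (A - C), sq_nonneg (B - C)]
        set E := Real.exp (-y ^ 2 / (8 * (c - t))) with hE
        have hEp : 0 < E := Real.exp_pos _
        have main : ∀ χ, 0 ≤ χ → |wt y t - wyy y t| ≤ M * (|w y t| + |wy y t|) + χ →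
            (E * (wt y t - wyy y t)) ^ 2 ≤ 3 * M ^ 2 * f y t ^ 2 + 6 * M ^ 2 * fy y t ^ 2 +
          6 * M ^ 2 / (16 * (c - t) ^ 2) * (y ^ 2 * f y t ^ 2) + 3 * (E * χ) ^ 2 := by
          intro χ hχ hh
          have h1 : |E * (wt y t - wyy y t)| ≤ M * |f y t| + M * |fy y t + y / (4 * (c - t)) * f y t|
              + E * χ := by
            rw [← hw, abs_mul, abs_of_pos hEp]
            simp only [hf]
            rw [← hE, abs_mul, abs_mul, abs_of_pos hEp]
            linarith [mul_le_mul_of_nonneg_left hh hEp.le]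
          have h2 := hab _ _ _ _ (abs_nonneg _) h1
          rw [sq_abs, mul_pow M, mul_pow M, sq_abs, sq_abs] at h2
          have h3 : (fy y t + y / (4 * (c - t)) * f y t) ^ 2 ≤
              2 * fy y t ^ 2 + 2 * (y / (4 * (c - t)) * f y t) ^ 2 := by
            linarith [sq_nonneg (fy y t - y / (4 * (c - t)) * f y t)]
          have h4 : 6 * M ^ 2 / (16 * (c - t) ^ 2) * (y ^ 2 * f y t ^ 2) =
              6 * M ^ 2 * (y / (4 * (c - t)) * f y t) ^ 2 := by
            field_simp; ring
          rw [h4]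
          have h5 := mul_le_mul_of_nonneg_left h3 (show 0 ≤ 3 * M ^ 2 by positivity)
          linarith
        by_cases hyR : |y| < R1
        · have := main 0 le_rfl (by simpa using hin' t ht y hy hyR)
          have hZ0 : 0 ≤ Z := by positivity
          linarith
        · have := main Lc hLc (hin t ht y hy)
          have h6 : (E * Lc) ^ 2 ≤ Lc ^ 2 * Real.exp (-R1 ^ 2 / (4 * (c - t))) := by
            rw [mul_pow, hE, e2, mul_comm]
            have : R1 ^ 2 ≤ y ^ 2 := by
              rw [← sq_abs y]
              push Not at hyR
              gcongr
            gcongr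
          linarith
    · have h5 : p + ε - q ≤ 2 := by linarith
      have h6 := fQ_nonneg f fy hR c q
      rw [← hc] at *
      calc (c - q) * fQ f fy R c q ≤ 2 * Bq := by
            have : 0 ≤ c - q := by linarith
            gcongr
        _ = N0 * c0 := by rw [hN0]; field_simp
        _ ≤ _ := by gcongr
    have hHp : fH f R p ≤ 2 * R * (B0 ^ 2 * Real.exp (-(ρ ^ 2 / (4 * ε)))) := by
      have hp : p ∈ Icc q p := ⟨hqp.le, le_rfl⟩
      refine int_le_const hR (h := fun y => f y p ^ 2) ((slice_cont F.c0 hp).pow 2) ?_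
      intro y hy
      simp only [hf]
      rw [mul_pow, e2, show c - p = ε by rw [hc]; ring]
      by_cases hyρ : |y| ≤ ρ
      · rw [hz y hyρ]; simp only [ne_eq, OfNat.ofNat_ne_zero, not_false_eq_true, zero_pow, mul_zero]; positivity
      · push Not at hyρ
        rw [mul_comm]
        have h1 : ρ ^ 2 ≤ y ^ 2 := by rw [← sq_abs y]; gcongr
        have h2 := hB0' p hp y hy
        have h3 : w y p ^ 2 ≤ B0 ^ 2 := by rw [← sq_abs (w y p)]; gcongr
        have h4 : -y ^ 2 / (4 * ε) ≤ -(ρ ^ 2 / (4 * ε)) := by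
          rw [neg_div, neg_le_neg_iff]; gcongr
        gcongr
    calc c0 * Real.exp ((K + 1) * q - C1 * Real.log 2)
        ≤ fH f R q * Real.exp ((K + 1) * q - C1 * Real.log (p + ε - q)) := by
          have : Real.log (p + ε - q) ≤ Real.log 2 := Real.log_le_log (by linarith) (by linarith)
          have := (hH q ⟨le_rfl, hqp.le⟩).le
          gcongr
      _ ≤ fH f R p * Real.exp ((K + 1) * p - C1 * Real.log ε) := hfr
      _ ≤ 2 * R * (B0 ^ 2 * Real.exp (-(ρ ^ 2 / (4 * ε)))) * Real.exp ((K + 1) * p - C1 * Real.log ε) := by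
          gcongr
      _ = _ := by
          rw [sub_eq_add_neg, Real.exp_add, sub_eq_add_neg (-(ρ ^ 2 / (4 * ε))), Real.exp_add]; ring
  have hlim := (tendsto_rpow_mul_exp_neg_mul_atTop_nhds_zero C1 (ρ ^ 2 / 4) (by positivity)).const_mul
    (2 * R * B0 ^ 2 * Real.exp ((K + 1) * p))
  rw [mul_zero] at hlim
  have hpos : 0 < c0 * Real.exp ((K + 1) * q - C1 * Real.log 2) := by positivity
  obtain ⟨x, hx1, hx2⟩ := ((hlim.eventually (gt_mem_nhds hpos)).and (eventually_ge_atTop 1)).exists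
  have hx0 : 0 < x := by linarith
  have := key x⁻¹ (by positivity) (inv_le_one_of_one_le₀ hx2)
  have e : Real.exp (-(ρ ^ 2 / (4 * x⁻¹)) - C1 * Real.log x⁻¹) = x ^ C1 * Real.exp (-(ρ ^ 2 / 4) * x) := by
    rw [Real.rpow_def_of_pos hx0, ← Real.exp_add, Real.log_inv]
    congr 1
    field_simp
    ring
  rw [e] at this
  linarith

lemma uc_core {v vy vyy vt : ℝ → ℝ → ℝ} {R L M ρ y0 σ p : ℝ}
    (V : Fam v vy vyy vt R L σ p) (hσp : σ < p) (hM : 0 ≤ M)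
    (hin : ∀ t ∈ Ioo σ p, ∀ y ∈ Icc (-R) R, |vt y t - vyy y t| ≤ M * (|v y t| + |vy y t|))
    (hρ : 0 < ρ) (hz : ∀ y, |y| ≤ ρ → v y p = 0) (hy0 : |y0| < R) (hv : v y0 p ≠ 0) : False := by
  have hR := V.Rpos
  obtain ⟨hy0a, hy0b⟩ := abs_lt.mp hy0
  -- lower bound near (y0,p)
  set m := |v y0 p| / 2 with hm
  have hm0 : 0 < m := by have := abs_pos.mpr hv; positivity
  have hmem : (y0, p) ∈ Rec (-R) R σ p := ⟨⟨hσp.le, le_rfl⟩, hy0a.le, hy0b.le⟩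
  have hca := V.c0.abs (y0, p) hmem
  have hev : ∀ᶠ z in 𝓝[Rec (-R) R σ p] (y0, p), m < |v z.1 z.2| :=
    hca.eventually (lt_mem_nhds (by simp only [hm]; have := abs_pos.mpr hv; linarith))
  rw [eventually_nhdsWithin_iff, Metric.eventually_nhds_iff] at hev
  obtain ⟨η, hη, hev⟩ := hev
  set r := min (η / 2) ((R - |y0|) / 2) with hr
  have hr0 : 0 < r := lt_min (by linarith) (by linarith)
  have hrη : r < η := lt_of_le_of_lt (min_le_left _ _) (by linarith)
  have hrR : r ≤ (R - |y0|) / 2 := min_le_right _ _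
  set R1 := |y0| + r with hR1
  have hR1p : 0 < R1 := by have := abs_nonneg y0; linarith
  have hR1R : R1 < R := by rw [hR1]; linarith
  set δ := min (min (η / 2) 1) (p - σ) with hδ
  have hδ0 : 0 < δ := lt_min (lt_min (by linarith) one_pos) (by linarith)
  have hδη : δ < η := lt_of_le_of_lt ((min_le_left _ _).trans (min_le_left _ _)) (by linarith)
  have hδ1 : δ ≤ 1 := (min_le_left _ _).trans (min_le_right _ _)
  have hδσ : δ ≤ p - σ := min_le_right _ _
  have hσq : σ ≤ p - δ := by linarith
  have V' := V.restr hσq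
  obtain ⟨φ, φ1, φ2, cφ, cφ1, cφ2, dφ, dφ1, φ0, φle, φone, zR, zR', z1, z1', w1, w2⟩ := cutoff hR1p hR1R
  have hy1 : -R1 ≤ y0 - r := by rw [hR1]; have := neg_abs_le y0; linarith
  have hy2 : y0 + r ≤ R1 := by rw [hR1]; have := le_abs_self y0; linarith
  obtain ⟨Bχ, hBχ, hχ⟩ := rec_bound (α := -R) (β := R) (σ := p - δ) (p := p)
    (h := fun y t => M * |φ1 y * v y t| + 2 * |φ1 y * vy y t| + |φ2 y * v y t|) (by
      have c1 : ContinuousOn (fun q : ℝ × ℝ => φ1 q.1) (Rec (-R) R (p - δ) p) :=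
        (cφ1.comp continuous_fst).continuousOn
      have c2 : ContinuousOn (fun q : ℝ × ℝ => φ2 q.1) (Rec (-R) R (p - δ) p) :=
        (cφ2.comp continuous_fst).continuousOn
      exact ((continuousOn_const.mul (c1.mul V'.c0).abs).add
        (continuousOn_const.mul (c1.mul V'.c1).abs)).add (c2.mul V'.c0).abs)
  have c0 : ContinuousOn (fun q : ℝ × ℝ => φ q.1) (Rec (-R) R (p - δ) p) :=
    (cφ.comp continuous_fst).continuousOn
  have c1 : ContinuousOn (fun q : ℝ × ℝ => φ1 q.1) (Rec (-R) R (p - δ) p) :=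
    (cφ1.comp continuous_fst).continuousOn
  have c2 : ContinuousOn (fun q : ℝ × ℝ => φ2 q.1) (Rec (-R) R (p - δ) p) :=
    (cφ2.comp continuous_fst).continuousOn
  have W : Fam (fun y t => φ y * v y t) (fun y t => φ1 y * v y t + φ y * vy y t)
      (fun y t => φ2 y * v y t + 2 * φ1 y * vy y t + φ y * vyy y t) (fun y t => φ y * vt y t)
      R L (p - δ) p := by
    refine ⟨hR, c0.mul V'.c0, (c1.mul V'.c0).add (c0.mul V'.c1),
      ((c2.mul V'.c0).add ((continuousOn_const.mul c1).mul V'.c1)).add (c0.mul V'.c2),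
      fun t ht => cφ.continuousOn.mul (V'.ct t ht), ?_, ?_, ?_, ?_⟩
    · intro t ht y hy
      rw [abs_mul, abs_of_nonneg (φ0 y)]
      have := V'.bt t ht y hy
      nlinarith [φ0 y, φle y, abs_nonneg (vt y t)]
    · intro t ht y hy
      exact (dφ y).mul (V'.dx t ht y hy)
    · intro t ht y hy
      refine (((dφ1 y).mul (V'.dx t ht y hy)).add ((dφ y).mul (V'.dxx t ht y hy))).congr_deriv ?_
      ring
    · intro t ht y hy
      exact (V'.dt t ht y hy).const_mul _
  have hin2 : ∀ t ∈ Ioo (p - δ) p, ∀ y ∈ Icc (-R) R,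
      |φ y * vt y t - (φ2 y * v y t + 2 * φ1 y * vy y t + φ y * vyy y t)| ≤
      M * (|φ y * v y t| + |φ1 y * v y t + φ y * vy y t|) +
        (M * |φ1 y * v y t| + 2 * |φ1 y * vy y t| + |φ2 y * v y t|) := by
    intro t ht y hy
    have h1 := hin t ⟨lt_of_le_of_lt hσq ht.1, ht.2⟩ y hy
    have e : φ y * vt y t - (φ2 y * v y t + 2 * φ1 y * vy y t + φ y * vyy y t) =
      φ y * (vt y t - vyy y t) - 2 * (φ1 y * vy y t) - φ2 y * v y t := by ring
    rw [e]
    have a1 := abs_sub (φ y * (vt y t - vyy y t) - 2 * (φ1 y * vy y t)) (φ2 y * v y t)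
    have a2 := abs_sub (φ y * (vt y t - vyy y t)) (2 * (φ1 y * vy y t))
    have a3 : |2 * (φ1 y * vy y t)| = 2 * |φ1 y * vy y t| := by rw [abs_mul]; norm_num
    have a4 : |φ y * (vt y t - vyy y t)| ≤ M * (|φ y * v y t| + |φ y * vy y t|) := by
      rw [abs_mul, abs_mul, abs_mul, abs_of_nonneg (φ0 y)]
      have := mul_le_mul_of_nonneg_left h1 (φ0 y)
      linarith
    have a5 : |φ y * vy y t| ≤ |φ1 y * v y t + φ y * vy y t| + |φ1 y * v y t| := by
      have := abs_sub (φ1 y * v y t + φ y * vy y t) (φ1 y * v y t)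
      simpa using this
    have a6 := mul_le_mul_of_nonneg_left a5 hM
    linarith
  refine uc_w W (R1 := R1) (Lc := Bχ) (M := M) (m := m) (ρ := ρ) (y1 := y0 - r) (y2 := y0 + r)
    (by linarith) (by linarith) hM hBχ ?_ ?_ ?_ ?_ hR1p hR1R ?_ ?_ hy1 (by linarith) hy2 hm0 ?_ hρ ?_
  · intro t ht; simp [zR]
  · intro t ht; simp [zR']
  · intro t ht; simp [zR, z1]
  · intro t ht; simp [zR', z1']
  · intro t ht y hy
    have := hin2 t ht y hy
    have h2 := (le_abs_self _).trans (hχ t (Ioo_subset_Icc_self ht) y hy)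
    linarith
  · intro t ht y hy hy'
    have := hin2 t ht y hy
    simpa [w1 y hy', w2 y hy'] using this
  · intro t ht y hy
    have hyR : |y| ≤ R1 := abs_le.mpr ⟨by linarith [hy.1], by linarith [hy.2]⟩
    rw [φone y hyR, one_mul]
    have hyR2 := abs_le.mp hyR
    refine (hev (y := (y, t)) ?_ ⟨⟨by linarith [ht.1], ht.2⟩, by linarith, by linarith⟩).le
    rw [Prod.dist_eq, max_lt_iff, Real.dist_eq, Real.dist_eq]
    constructor
    · exact lt_of_le_of_lt (abs_le.mpr ⟨by linarith [hy.1], by linarith [hy.2]⟩) hrη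
    · exact lt_of_le_of_lt (abs_le.mpr ⟨by linarith [ht.1], by linarith [ht.2]⟩) hδη
  · intro y hy; rw [hz y hy, mul_zero]

structure SFam (s st : ℝ → ℝ → ℝ) (k C σ p : ℝ) : Prop where
  kpos : 0 < k
  Cnn : 0 ≤ C
  cz : ∀ t ∈ Icc σ p, Continuous (fun z => s z t)
  lo : ∀ t ∈ Icc σ p, ∀ z, k⁻¹ ≤ s z t
  hi : ∀ t ∈ Icc σ p, ∀ z, s z t ≤ k
  lip : ∀ t ∈ Icc σ p, ∀ t' ∈ Icc σ p, ∀ z, |s z t - s z t'| ≤ C * |t - t'|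
  dt : ∀ t ∈ Ioo σ p, ∀ z, HasDerivAt (fun r => s z r) (st z t) t
  bt : ∀ t ∈ Ioo σ p, ∀ z, |st z t| ≤ C

noncomputable def YY (s : ℝ → ℝ → ℝ) (x1 x t : ℝ) : ℝ := ∫ z in x1..x, s z t

lemma int_abs_le {h : ℝ → ℝ} {B x y : ℝ} (hb : ∀ z, |h z| ≤ B) :
    |∫ z in x..y, h z| ≤ B * |y - x| :=
  intervalIntegral.norm_integral_le_of_norm_le_const (f := h) (C := B) (fun z _ => hb z)

section
variable {s st : ℝ → ℝ → ℝ} {k C σ p : ℝ}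

lemma SFam.joint (S : SFam s st k C σ p) :
    ContinuousOn (fun q : ℝ × ℝ => s q.1 q.2) (univ ×ˢ Icc σ p) := by
  rintro ⟨z, t⟩ ⟨-, ht⟩
  have ht : t ∈ Icc σ p := ht
  have h1 : Tendsto (fun q : ℝ × ℝ => s q.1 t) (𝓝[univ ×ˢ Icc σ p] (z, t)) (𝓝 (s z t)) :=
    (((S.cz t ht).comp continuous_fst).tendsto (z, t)).mono_left nhdsWithin_le_nhds
  have h2 : Tendsto (fun q : ℝ × ℝ => s q.1 q.2 - s q.1 t) (𝓝[univ ×ˢ Icc σ p] (z, t)) (𝓝 0) := by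
    have h3 : Tendsto (fun q : ℝ × ℝ => C * |q.2 - t|) (𝓝[univ ×ˢ Icc σ p] (z, t)) (𝓝 0) := by
      have : Continuous (fun q : ℝ × ℝ => C * |q.2 - t|) := by fun_prop
      have := (this.tendsto (z, t)).mono_left (nhdsWithin_le_nhds (s := univ ×ˢ Icc σ p))
      simpa using this
    refine squeeze_zero_norm' ?_ h3
    filter_upwards [self_mem_nhdsWithin] with q hq
    exact S.lip q.2 hq.2 t ht q.1
  have := h2.add h1
  simpa [ContinuousWithinAt] using this

lemma SFam.ii (S : SFam s st k C σ p) {t : ℝ} (ht : t ∈ Icc σ p) (x y : ℝ) :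
    IntervalIntegrable (fun z => s z t) MeasureTheory.volume x y :=
  (S.cz t ht).intervalIntegrable _ _

lemma SFam.dY (S : SFam s st k C σ p) {t : ℝ} (ht : t ∈ Icc σ p) (x1 x : ℝ) :
    HasDerivAt (fun x => YY s x1 x t) (s x t) x :=
  intervalIntegral.integral_hasDerivAt_right (S.ii ht _ _)
    ((S.cz t ht).stronglyMeasurableAtFilter _ _) (S.cz t ht).continuousAt

lemma SFam.mvt (S : SFam s st k C σ p) {t : ℝ} (ht : t ∈ Icc σ p) (x1 x y : ℝ) :
    ∃ ζ, |ζ - x| ≤ |y - x| ∧ YY s x1 y t - YY s x1 x t = s ζ t * (y - x) := by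
  have hc : Continuous (fun x => YY s x1 x t) := continuous_iff_continuousAt.mpr
    fun x => (S.dY ht x1 x).continuousAt
  rcases lt_trichotomy x y with h | h | h
  · obtain ⟨ζ, hζ, e⟩ := exists_hasDerivAt_eq_slope (fun x => YY s x1 x t) (fun x => s x t) h
      hc.continuousOn (fun z _ => S.dY ht x1 z)
    refine ⟨ζ, ?_, ?_⟩
    · rw [abs_of_pos (by linarith [hζ.1]), abs_of_pos (by linarith)]; linarith [hζ.2]
    · rw [e]; have : y - x ≠ 0 := by linarith
      field_simp
  · exact ⟨x, by simp, by simp [h]⟩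
  · obtain ⟨ζ, hζ, e⟩ := exists_hasDerivAt_eq_slope (fun x => YY s x1 x t) (fun x => s x t) h
      hc.continuousOn (fun z _ => S.dY ht x1 z)
    refine ⟨ζ, ?_, ?_⟩
    · rw [abs_of_neg (by linarith [hζ.2]), abs_of_neg (by linarith)]; linarith [hζ.1]
    · rw [e]; have : x - y ≠ 0 := by linarith
      field_simp; ring

lemma SFam.spos (S : SFam s st k C σ p) {t : ℝ} (ht : t ∈ Icc σ p) (z : ℝ) : 0 < s z t :=
  lt_of_lt_of_le (inv_pos.mpr S.kpos) (S.lo t ht z)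

lemma SFam.explo (S : SFam s st k C σ p) {t : ℝ} (ht : t ∈ Icc σ p) (x1 x y : ℝ) :
    |y - x| ≤ k * |YY s x1 y t - YY s x1 x t| := by
  obtain ⟨ζ, -, e⟩ := S.mvt ht x1 x y
  rw [e, abs_mul, abs_of_pos (S.spos ht ζ), ← mul_assoc]
  have h1 := S.lo t ht ζ
  have hk := S.kpos
  have : 1 ≤ k * s ζ t := by
    calc (1:ℝ) = k * k⁻¹ := by field_simp
      _ ≤ _ := by gcongr
  nlinarith [abs_nonneg (y - x)]

lemma SFam.exphi (S : SFam s st k C σ p) {t : ℝ} (ht : t ∈ Icc σ p) (x1 x y : ℝ) :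
    |YY s x1 y t - YY s x1 x t| ≤ k * |y - x| := by
  obtain ⟨ζ, -, e⟩ := S.mvt ht x1 x y
  rw [e, abs_mul, abs_of_pos (S.spos ht ζ)]
  have h1 := S.hi t ht ζ
  gcongr

lemma SFam.surj (S : SFam s st k C σ p) {t : ℝ} (ht : t ∈ Icc σ p) (x1 y : ℝ) :
    ∃ x, YY s x1 x t = y := by
  have hc : Continuous (fun x => YY s x1 x t) := continuous_iff_continuousAt.mpr
    fun x => (S.dY ht x1 x).continuousAt
  have hk := S.kpos
  have h0 : YY s x1 x1 t = 0 := by simp [YY]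
  have up : y ≤ YY s x1 (x1 + k * |y|) t := by
    obtain ⟨ζ, -, e⟩ := S.mvt ht x1 x1 (x1 + k * |y|)
    rw [h0] at e
    have h1 := S.lo t ht ζ
    have : k⁻¹ * (k * |y|) ≤ s ζ t * (k * |y|) := by gcongr
    have e2 : k⁻¹ * (k * |y|) = |y| := by field_simp
    have := le_abs_self y
    have e3 : x1 + k * |y| - x1 = k * |y| := by ring
    rw [e3] at e
    linarith
  have dn : YY s x1 (x1 - k * |y|) t ≤ y := by
    obtain ⟨ζ, -, e⟩ := S.mvt ht x1 x1 (x1 - k * |y|)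
    rw [h0] at e
    have h1 := S.lo t ht ζ
    have : k⁻¹ * (k * |y|) ≤ s ζ t * (k * |y|) := by gcongr
    have e2 : k⁻¹ * (k * |y|) = |y| := by field_simp
    have := neg_abs_le y
    have e3 : x1 - k * |y| - x1 = -(k * |y|) := by ring
    rw [e3] at e
    linarith
  exact mem_range_of_exists_le_of_exists_ge hc ⟨_, dn⟩ ⟨_, up⟩

lemma SFam.Yt (S : SFam s st k C σ p) {t : ℝ} (ht : t ∈ Ioo σ p) (x1 x : ℝ) :
    IntervalIntegrable (fun z => st z t) MeasureTheory.volume x1 x ∧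
    HasDerivAt (fun t => YY s x1 x t) (∫ z in x1..x, st z t) t := by
  have hI : Ioo σ p ⊆ Icc σ p := Ioo_subset_Icc_self
  have meas : MeasureTheory.AEStronglyMeasurable (fun z => st z t)
      (MeasureTheory.volume.restrict (uIoc x1 x)) := by
    obtain ⟨τ, hτ1, hτ2, hτ3⟩ := exists_seq_strictAnti_tendsto' ht.2
    refine aestronglyMeasurable_of_tendsto_ae atTop
      (f := fun n z => (τ n - t)⁻¹ * (s z (τ n) - s z t)) ?_ ?_
    · intro n
      have h1 : τ n ∈ Icc σ p := ⟨ht.1.le.trans (hτ2 n).1.le, (hτ2 n).2.le⟩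
      exact (continuous_const.mul ((S.cz _ h1).sub (S.cz t (hI ht)))).aestronglyMeasurable
    · refine Eventually.of_forall fun z => ?_
      have := (hasDerivAt_iff_tendsto_slope.mp (S.dt t ht z))
      have h2 : Tendsto τ atTop (𝓝[≠] t) := tendsto_nhdsWithin_iff.mpr
        ⟨hτ3, Eventually.of_forall fun n => (hτ2 n).1.ne'⟩
      have := this.comp h2
      simpa [slope_def_field, Function.comp_def, div_eq_inv_mul] using this
  refine intervalIntegral.hasDerivAt_integral_of_dominated_loc_of_deriv_le
    (F := fun t z => s z t) (F' := fun t z => st z t) (s := Ioo σ p) (bound := fun _ => C)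
    (Ioo_mem_nhds ht.1 ht.2) ?_ (S.ii (hI ht) _ _) meas ?_ intervalIntegrable_const ?_
  · filter_upwards [Ioo_mem_nhds ht.1 ht.2] with r hr
    exact (S.cz r (hI hr)).aestronglyMeasurable
  · exact Eventually.of_forall fun z _ r hr => S.bt r hr z
  · exact Eventually.of_forall fun z _ r hr => S.dt r hr z

lemma SFam.Ylip (S : SFam s st k C σ p) {t t' : ℝ} (ht : t ∈ Icc σ p) (ht' : t' ∈ Icc σ p) (x1 x : ℝ) :
    |YY s x1 x t - YY s x1 x t'| ≤ C * |t - t'| * |x - x1| := by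
  unfold YY
  rw [← intervalIntegral.integral_sub (S.ii ht _ _) (S.ii ht' _ _)]
  exact int_abs_le (S.lip t ht t' ht')

lemma inv_lemma (S : SFam s st k C σ p) (x1 : ℝ) : ∃ X Xt : ℝ → ℝ → ℝ,
    (∀ t ∈ Icc σ p, ∀ y, HasDerivAt (fun y => X y t) ((s (X y t) t)⁻¹) y) ∧
    (∀ t ∈ Icc σ p, ∀ y, |X y t - x1| ≤ k * |y|) ∧
    (∀ t ∈ Icc σ p, ∀ x, ∃ y, X y t = x ∧ |y| ≤ k * |x - x1|) ∧
    ContinuousOn (fun q : ℝ × ℝ => X q.1 q.2) (univ ×ˢ Icc σ p) ∧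
    (∀ t ∈ Ioo σ p, ∀ y, HasDerivAt (fun r => X y r) (Xt y t) t) ∧
    (∀ t ∈ Ioo σ p, ∀ y, |Xt y t| ≤ C * k * (k * |y|)) ∧
    (∀ t ∈ Ioo σ p, Continuous (fun y => Xt y t)) := by
  classical
  have hk := S.kpos
  have hC := S.Cnn
  have hI : Ioo σ p ⊆ Icc σ p := Ioo_subset_Icc_self
  have hex : ∀ y t, ∃ x, t ∈ Icc σ p → YY s x1 x t = y := by
    intro y t
    by_cases ht : t ∈ Icc σ p
    · obtain ⟨x, hx⟩ := S.surj ht x1 y; exact ⟨x, fun _ => hx⟩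
    · exact ⟨0, fun h => absurd h ht⟩
  choose X hX using hex
  have Y0 : ∀ t, YY s x1 x1 t = 0 := by intro t; simp [YY]
  have inj : ∀ t ∈ Icc σ p, ∀ x x', YY s x1 x t = YY s x1 x' t → x = x' := by
    intro t ht x x' h
    have := S.explo ht x1 x x'
    rw [h] at this
    simp at this
    linarith [sub_eq_zero.mp this]
  have XL : ∀ t ∈ Icc σ p, ∀ y y', |X y t - X y' t| ≤ k * |y - y'| := by
    intro t ht y y'
    have := S.explo ht x1 (X y' t) (X y t)
    rwa [hX y t ht, hX y' t ht] at this
  have Xc : ∀ t ∈ Icc σ p, Continuous (fun y => X y t) := by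
    intro t ht
    refine LipschitzWith.continuous (K := ⟨k, hk.le⟩) (LipschitzWith.of_dist_le_mul fun y y' => ?_)
    exact XL t ht y y'
  have Xb : ∀ t ∈ Icc σ p, ∀ y, |X y t - x1| ≤ k * |y| := by
    intro t ht y
    have := S.explo ht x1 x1 (X y t)
    rwa [hX y t ht, Y0, sub_zero] at this
  have XLt : ∀ t ∈ Icc σ p, ∀ t' ∈ Icc σ p, ∀ y, |X y t - X y t'| ≤ k * (C * |t - t'| * (k * |y|)) := by
    intro t ht t' ht' y
    have h1 := S.explo ht' x1 (X y t') (X y t)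
    rw [hX y t' ht'] at h1
    have h2 := S.Ylip ht' ht x1 (X y t)
    rw [hX y t ht, abs_sub_comm t'] at h2
    have h3 := Xb t ht y
    refine h1.trans ?_
    gcongr
    refine h2.trans ?_
    gcongr
  have Xj : ContinuousOn (fun q : ℝ × ℝ => X q.1 q.2) (univ ×ˢ Icc σ p) := by
    rintro ⟨y, t⟩ ⟨-, ht⟩
    have ht : t ∈ Icc σ p := ht
    have h1 : Tendsto (fun q : ℝ × ℝ => X q.1 t) (𝓝[univ ×ˢ Icc σ p] (y, t)) (𝓝 (X y t)) :=
      (((Xc t ht).comp continuous_fst).tendsto (y, t)).mono_left nhdsWithin_le_nhds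
    have h2 : Tendsto (fun q : ℝ × ℝ => X q.1 q.2 - X q.1 t) (𝓝[univ ×ˢ Icc σ p] (y, t)) (𝓝 0) := by
      have h3 : Tendsto (fun q : ℝ × ℝ => k * (C * |q.2 - t| * (k * |q.1|)))
          (𝓝[univ ×ˢ Icc σ p] (y, t)) (𝓝 0) := by
        have : Continuous (fun q : ℝ × ℝ => k * (C * |q.2 - t| * (k * |q.1|))) := by fun_prop
        have := (this.tendsto (y, t)).mono_left (nhdsWithin_le_nhds (s := univ ×ˢ Icc σ p))
        simpa using this
      refine squeeze_zero_norm' ?_ h3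
      filter_upwards [self_mem_nhdsWithin] with q hq
      exact XLt q.2 hq.2 t ht q.1
    have := h2.add h1
    simpa [ContinuousWithinAt] using this
  have sj := S.joint
  refine ⟨X, fun y t => -(∫ z in x1..(X y t), st z t) / s (X y t) t, ?_, Xb, ?_, Xj, ?_, ?_, ?_⟩
  · intro t ht y
    refine HasDerivAt.of_local_left_inverse (f := fun x => YY s x1 x t) (Xc t ht).continuousAt
      (S.dY ht x1 _) (S.spos ht _).ne' (Eventually.of_forall fun y => hX y t ht)
  · intro t ht x
    refine ⟨YY s x1 x t, inj t ht _ _ (hX _ t ht), ?_⟩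
    have := S.exphi ht x1 x1 x
    rwa [Y0, sub_zero] at this
  · intro t ht y
    rw [hasDerivAt_iff_tendsto_slope]
    have hz : ∀ r, ∃ ζ, r ∈ Icc σ p → |ζ - X y t| ≤ |X y r - X y t| ∧
        YY s x1 (X y r) r - YY s x1 (X y t) r = s ζ r * (X y r - X y t) := by
      intro r
      by_cases hr : r ∈ Icc σ p
      · obtain ⟨ζ, h⟩ := S.mvt hr x1 (X y t) (X y r); exact ⟨ζ, fun _ => h⟩
      · exact ⟨0, fun h => absurd h hr⟩
    choose ζ hζ using hz
    have hYt := (S.Yt ht x1 (X y t)).2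
    rw [hasDerivAt_iff_tendsto_slope] at hYt
    have hnI : Icc σ p ∈ 𝓝[≠] t := mem_nhdsWithin_of_mem_nhds (Icc_mem_nhds ht.1 ht.2)
    have hXt : Tendsto (fun r => X y r) (𝓝[≠] t) (𝓝 (X y t)) := by
      have h1 := (tslice_cont (h := X) (α := y) (β := y) (σ := σ) (p := p) (y := y)
        (Xj.mono fun q hq => ⟨mem_univ _, hq.1⟩) ⟨le_rfl, le_rfl⟩)
      exact (h1.continuousAt (Icc_mem_nhds ht.1 ht.2)).tendsto.mono_left nhdsWithin_le_nhds
    have hζt : Tendsto ζ (𝓝[≠] t) (𝓝 (X y t)) := by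
      rw [tendsto_iff_dist_tendsto_zero] at hXt ⊢
      refine squeeze_zero' (Eventually.of_forall fun _ => dist_nonneg) ?_ hXt
      filter_upwards [hnI] with r hr
      exact (hζ r hr).1
    have hst : Tendsto (fun r => s (ζ r) r) (𝓝[≠] t) (𝓝 (s (X y t) t)) := by
      have h1 := sj (X y t, t) ⟨mem_univ _, hI ht⟩
      refine h1.tendsto.comp (tendsto_nhdsWithin_iff.mpr ⟨?_, ?_⟩ : Tendsto (fun r => (ζ r, r)) _ _)
      · exact hζt.prodMk_nhds (tendsto_id.mono_left nhdsWithin_le_nhds)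
      · filter_upwards [hnI] with r hr using ⟨mem_univ _, hr⟩
    refine (hYt.neg.div hst (S.spos (hI ht) _).ne').congr' ?_
    filter_upwards [hnI] with r hr
    have e := (hζ r hr).2
    have e1 : YY s x1 (X y r) r = YY s x1 (X y t) t := by rw [hX y r hr, hX y t (hI ht)]
    have hs := (S.spos hr (ζ r)).ne'
    simp only [slope_def_field, Pi.div_apply, Pi.neg_apply]
    rw [e1] at e
    by_cases h : r - t = 0
    · simp [h]
    field_simp
    linarith
  · intro t ht y
    rw [abs_div, abs_neg, abs_of_pos (S.spos (hI ht) _), div_le_iff₀ (S.spos (hI ht) _)]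
    have h1 : |∫ z in x1..(X y t), st z t| ≤ C * |X y t - x1| :=
      int_abs_le (S.bt t ht)
    have h2 := Xb t (hI ht) y
    have h3 := S.lo t (hI ht) (X y t)
    have h4 : 1 ≤ k * s (X y t) t := by
      calc (1:ℝ) = k * k⁻¹ := by field_simp
        _ ≤ _ := by gcongr
    calc _ ≤ C * |X y t - x1| := h1
      _ ≤ C * (k * |y|) * 1 := by rw [mul_one]; gcongr
      _ ≤ C * (k * |y|) * (k * s (X y t) t) := by gcongr
      _ = _ := by ring
  · intro t ht
    have h1 : Continuous (fun x => ∫ z in x1..x, st z t) := by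
      refine LipschitzWith.continuous (K := ⟨C, hC⟩) (LipschitzWith.of_dist_le_mul fun x x' => ?_)
      rw [Real.dist_eq, intervalIntegral.integral_interval_sub_left (S.Yt ht _ _).1 (S.Yt ht _ _).1]
      exact int_abs_le (S.bt t ht)
    exact ((h1.comp (Xc t (hI ht))).neg).div ((S.cz t (hI ht)).comp (Xc t (hI ht)))
      (fun y => (S.spos (hI ht) _).ne')
end

structure WSol (a u ux uxx ut : ℝ → ℝ → ℝ) (M α β σ p : ℝ) : Prop where
  cu : ContinuousOn (fun q : ℝ × ℝ => u q.1 q.2) (Rec α β σ p)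
  cux : ContinuousOn (fun q : ℝ × ℝ => ux q.1 q.2) (Rec α β σ p)
  cuxx : ContinuousOn (fun q : ℝ × ℝ => uxx q.1 q.2) (Rec α β σ p)
  cut : ContinuousOn (fun q : ℝ × ℝ => ut q.1 q.2) (Rec α β σ p)
  dx : ∀ t ∈ Icc σ p, ∀ x ∈ Ioo α β, HasDerivAt (fun y => u y t) (ux x t) x
  dxx : ∀ t ∈ Icc σ p, ∀ x ∈ Ioo α β, HasDerivAt (fun y => ux y t) (uxx x t) x
  dt : ∀ t ∈ Ioo σ p, ∀ x ∈ Ioo α β, HasDerivAt (fun r => u x r) (ut x t) t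
  ineq : ∀ t ∈ Icc σ p, ∀ x ∈ Icc α β, |ut x t - a x t * uxx x t| ≤ M * (|u x t| + |ux x t|)

lemma lip_of {f f' : ℝ → ℝ} {l r C : ℝ} (hd : ∀ x ∈ Icc l r, HasDerivAt f (f' x) x)
    (hb : ∀ x ∈ Icc l r, |f' x| ≤ C) {x y : ℝ} (hx : x ∈ Icc l r) (hy : y ∈ Icc l r) :
    |f y - f x| ≤ C * |y - x| :=
  (convex_Icc l r).norm_image_sub_le_of_norm_hasDerivWithin_le
    (fun z hz => (hd z hz).hasDerivWithinAt) hb hx hy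

lemma mvt_abs {f f' : ℝ → ℝ} {l r : ℝ} (hd : ∀ x ∈ Icc l r, HasDerivAt f (f' x) x)
    {x y : ℝ} (hx : x ∈ Icc l r) (hy : y ∈ Icc l r) :
    ∃ ζ ∈ Icc l r, |ζ - x| ≤ |y - x| ∧ f y - f x = f' ζ * (y - x) := by
  have hsub : ∀ {a b}, a ∈ Icc l r → b ∈ Icc l r → Icc a b ⊆ Icc l r :=
    fun ha hb => Icc_subset_Icc ha.1 hb.2
  rcases lt_trichotomy x y with h | h | h
  · obtain ⟨ζ, hζ, e⟩ := exists_hasDerivAt_eq_slope f f' h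
      (fun z hz => (hd z (hsub hx hy hz)).continuousAt.continuousWithinAt)
      (fun z hz => hd z (hsub hx hy (Ioo_subset_Icc_self hz)))
    refine ⟨ζ, hsub hx hy (Ioo_subset_Icc_self hζ), ?_, ?_⟩
    · rw [abs_of_pos (by linarith [hζ.1]), abs_of_pos (by linarith)]; linarith [hζ.2]
    · rw [e]; have : y - x ≠ 0 := by linarith
      field_simp
  · exact ⟨x, hx, by simp, by simp [h]⟩
  · obtain ⟨ζ, hζ, e⟩ := exists_hasDerivAt_eq_slope f f' h
      (fun z hz => (hd z (hsub hy hx hz)).continuousAt.continuousWithinAt)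
      (fun z hz => hd z (hsub hy hx (Ioo_subset_Icc_self hz)))
    refine ⟨ζ, hsub hy hx (Ioo_subset_Icc_self hζ), ?_, ?_⟩
    · rw [abs_of_neg (by linarith [hζ.2]), abs_of_neg (by linarith)]; linarith [hζ.1]
    · rw [e]; have : x - y ≠ 0 := by linarith
      field_simp; ring

section
variable {a ax axx at' : ℝ → ℝ → ℝ} {M α β σ p : ℝ}

lemma joint_of {h : ℝ → ℝ → ℝ} (hx : ∀ t ∈ Icc σ p, ∀ x ∈ Icc α β, ∀ y ∈ Icc α β,
      |h y t - h x t| ≤ M * |y - x|)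
    (ht : ∀ x ∈ Icc α β, ContinuousOn (fun t => h x t) (Icc σ p)) :
    ContinuousOn (fun q : ℝ × ℝ => h q.1 q.2) (Rec α β σ p) := by
  rintro ⟨x, t⟩ ⟨ht0, hx0⟩
  have ht0 : t ∈ Icc σ p := ht0
  have hx0 : x ∈ Icc α β := hx0
  have h1 : Tendsto (fun q : ℝ × ℝ => h x q.2) (𝓝[Rec α β σ p] (x, t)) (𝓝 (h x t)) := by
    refine (ht x hx0 t ht0).tendsto.comp (tendsto_nhdsWithin_iff.mpr ⟨?_, ?_⟩)
    · exact (continuous_snd.tendsto (x, t)).mono_left nhdsWithin_le_nhds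
    · filter_upwards [self_mem_nhdsWithin] with q hq using hq.1
  have h2 : Tendsto (fun q : ℝ × ℝ => h q.1 q.2 - h x q.2) (𝓝[Rec α β σ p] (x, t)) (𝓝 0) := by
    have h3 : Tendsto (fun q : ℝ × ℝ => M * |q.1 - x|) (𝓝[Rec α β σ p] (x, t)) (𝓝 0) := by
      have : Continuous (fun q : ℝ × ℝ => M * |q.1 - x|) := by fun_prop
      have := (this.tendsto (x, t)).mono_left (nhdsWithin_le_nhds (s := Rec α β σ p))
      simpa using this
    refine squeeze_zero_norm' ?_ h3
    filter_upwards [self_mem_nhdsWithin] with q hq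
    exact hx q.2 hq.1 x hx0 q.1 hq.2
  have := h2.add h1
  simpa [ContinuousWithinAt] using this

lemma Coef.ca (A : Coef a ax axx at' M (Rec α β σ p)) :
    ContinuousOn (fun q : ℝ × ℝ => a q.1 q.2) (Rec α β σ p) :=
  joint_of (M := M) (fun t ht x hx y hy => lip_of (fun z hz => A.dx z t ⟨ht, hz⟩)
    (fun z hz => A.bx z t ⟨ht, hz⟩) hx hy)
    (fun x hx t ht => (A.dt x t ⟨ht, hx⟩).continuousAt.continuousWithinAt)

lemma Coef.cax (A : Coef a ax axx at' M (Rec α β σ p)) (hαβ : α < β) :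
    ContinuousOn (fun q : ℝ × ℝ => ax q.1 q.2) (Rec α β σ p) := by
  have hM := A.Mpos
  refine joint_of (M := M) (fun t ht x hx y hy => lip_of (fun z hz => A.dxx z t ⟨ht, hz⟩)
    (fun z hz => A.bxx z t ⟨ht, hz⟩) hx hy) ?_
  intro x hx t0 ht0
  have key : ∀ h, x + h ∈ Icc α β → h ≠ 0 → ∀ t ∈ Icc σ p,
      |ax x t - ax x t0| ≤ 2 * M * |h| + 2 * M * |t - t0| / |h| := by
    intro h hh h0 t ht
    have g1 : ∀ t ∈ Icc σ p, |(a (x + h) t - a x t) / h - ax x t| ≤ M * |h| := by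
      intro t ht
      obtain ⟨ζ, hζ, h1, e⟩ := mvt_abs (fun z hz => A.dx z t ⟨ht, hz⟩) hx hh
      rw [e, show x + h - x = h by ring, mul_div_assoc, div_self h0, mul_one]
      have := lip_of (fun z hz => A.dxx z t ⟨ht, hz⟩) (fun z hz => A.bxx z t ⟨ht, hz⟩) hx hζ
      rw [show x + h - x = h by ring] at h1
      refine this.trans ?_
      gcongr
    have g2 : ∀ z ∈ Icc α β, |a z t - a z t0| ≤ M * |t - t0| := fun z hz =>
      lip_of (f := fun r => a z r) (fun r hr => A.dt z r ⟨hr, hz⟩) (fun r hr => A.bt z r ⟨hr, hz⟩) ht0 ht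
    have k1 := g1 t ht
    have k2 := g1 t0 ht0
    have k3 : |(a (x + h) t - a x t) / h - (a (x + h) t0 - a x t0) / h| ≤ 2 * M * |t - t0| / |h| := by
      rw [← sub_div, abs_div]
      have e : a (x + h) t - a x t - (a (x + h) t0 - a x t0) =
        (a (x + h) t - a (x + h) t0) - (a x t - a x t0) := by ring
      rw [e]
      have := (abs_sub (a (x + h) t - a (x + h) t0) (a x t - a x t0)).trans
        (add_le_add (g2 _ hh) (g2 _ hx))
      gcongr
      linarith
    have e : ax x t - ax x t0 = ((a (x + h) t - a x t) / h - (a (x + h) t0 - a x t0) / h)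
      - ((a (x + h) t - a x t) / h - ax x t) + ((a (x + h) t0 - a x t0) / h - ax x t0) := by ring
    rw [e]
    refine (abs_add_le _ _).trans ?_
    have := abs_sub ((a (x + h) t - a x t) / h - (a (x + h) t0 - a x t0) / h)
      ((a (x + h) t - a x t) / h - ax x t)
    linarith
  rw [Metric.continuousWithinAt_iff]
  intro ε hε
  set h1 := min ((β - α) / 2) (ε / (8 * M)) with hh1
  have h1p : 0 < h1 := lt_min (by linarith) (by positivity)
  have h1a : h1 ≤ (β - α) / 2 := min_le_left _ _
  have h1b : h1 ≤ ε / (8 * M) := min_le_right _ _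
  have h1c : 2 * M * h1 ≤ ε / 4 := by
    calc 2 * M * h1 ≤ 2 * M * (ε / (8 * M)) := by gcongr
      _ = _ := by field_simp; norm_num
  obtain ⟨h, hh, hab⟩ : ∃ h, x + h ∈ Icc α β ∧ |h| = h1 := by
    by_cases hc : x ≤ (α + β) / 2
    · exact ⟨h1, ⟨by linarith [hx.1], by linarith⟩, abs_of_pos h1p⟩
    · push Not at hc
      exact ⟨-h1, ⟨by linarith, by linarith [hx.2]⟩, by rw [abs_neg, abs_of_pos h1p]⟩
  have h0 : h ≠ 0 := by rintro rfl; simp at hab; linarith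
  refine ⟨ε * h1 / (8 * M), by positivity, fun {t} ht hd => ?_⟩
  rw [Real.dist_eq] at *
  have := key h hh h0 t ht
  rw [hab] at this
  have h3 : 2 * M * |t - t0| / h1 ≤ ε / 4 := by
    rw [div_le_iff₀ h1p]
    calc 2 * M * |t - t0| ≤ 2 * M * (ε * h1 / (8 * M)) := by gcongr
      _ = _ := by field_simp; norm_num
  linarith

lemma Coef.sfam (A : Coef a ax axx at' M (Rec α β σ p)) (hαβ : α < β) : 
    ∃ C, SFam (fun z t => (√(a (max α (min z β)) t))⁻¹)
      (fun z t => -(at' (max α (min z β)) t / (2 * √(a (max α (min z β)) t))) /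
        √(a (max α (min z β)) t) ^ 2) (√M) C σ p := by
  have hM := A.Mpos
  have hcl : ∀ z, max α (min z β) ∈ Icc α β := fun z =>
    ⟨le_max_left _ _, max_le hαβ.le (min_le_right _ _)⟩
  have hk : 0 < √M := Real.sqrt_pos.mpr hM
  have sp : ∀ t ∈ Icc σ p, ∀ x ∈ Icc α β, 0 < a x t := fun t ht x hx =>
    lt_of_lt_of_le (inv_pos.mpr hM) (A.lo x t ⟨ht, hx⟩)
  have s1 : ∀ t ∈ Icc σ p, ∀ x ∈ Icc α β, (√(a x t))⁻¹ ≤ √M := by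
    intro t ht x hx
    rw [← Real.sqrt_inv]
    apply Real.sqrt_le_sqrt
    rw [inv_le_comm₀ (sp t ht x hx) hM]
    exact A.lo x t ⟨ht, hx⟩
  have s2 : ∀ t ∈ Icc σ p, ∀ x ∈ Icc α β, (√M)⁻¹ ≤ (√(a x t))⁻¹ := by
    intro t ht x hx
    have h := sp t ht x hx
    have := Real.sqrt_pos.mpr h
    gcongr
    exact A.hi x t ⟨ht, hx⟩
  have dt : ∀ x ∈ Icc α β, ∀ t ∈ Icc σ p, HasDerivAt (fun r => (√(a x r))⁻¹)
      (-(at' x t / (2 * √(a x t))) / √(a x t) ^ 2) t := by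
    intro x hx t ht
    have h := sp t ht x hx
    exact ((A.dt x t ⟨ht, hx⟩).sqrt h.ne').fun_inv (Real.sqrt_pos.mpr h).ne'
  have bt : ∀ x ∈ Icc α β, ∀ t ∈ Icc σ p,
      |-(at' x t / (2 * √(a x t))) / √(a x t) ^ 2| ≤ M * √M ^ 3 := by
    intro x hx t ht
    have h := Real.sqrt_pos.mpr (sp t ht x hx)
    have h1 := s1 t ht x hx
    have e : -(at' x t / (2 * √(a x t))) / √(a x t) ^ 2 = -(at' x t / 2) * (√(a x t))⁻¹ ^ 3 := by
      field_simp
    rw [e, abs_mul, abs_neg, abs_div, abs_of_pos (show 0 < (√(a x t))⁻¹ ^ 3 by positivity), abs_two]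
    have h2 := A.bt x t ⟨ht, hx⟩
    have h3 : |at' x t| / 2 ≤ M := by have := abs_nonneg (at' x t); linarith
    gcongr
  refine ⟨M * √M ^ 3, hk, by positivity, ?_, fun t ht z => s2 t ht _ (hcl z),
    fun t ht z => s1 t ht _ (hcl z), ?_, fun t ht z => dt _ (hcl z) t (Ioo_subset_Icc_self ht),
    fun t ht z => bt _ (hcl z) t (Ioo_subset_Icc_self ht)⟩
  · intro t ht
    have h1 : Continuous (fun z => a (max α (min z β)) t) :=
      (slice_cont A.ca ht).comp_continuous (by fun_prop) hcl
    exact h1.sqrt.inv₀ (fun z => (Real.sqrt_pos.mpr (sp t ht _ (hcl z))).ne')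
  · intro t ht t' ht' z
    exact lip_of (dt _ (hcl z)) (bt _ (hcl z)) ht' ht
end

lemma chain_t {u ux : ℝ → ℝ → ℝ} {α β σ p t X' ut l r0 : ℝ} {X : ℝ → ℝ}
    (cux : ContinuousOn (fun q : ℝ × ℝ => ux q.1 q.2) (Rec α β σ p))
    (dx : ∀ t ∈ Icc σ p, ∀ x ∈ Ioo α β, HasDerivAt (fun y => u y t) (ux x t) x)
    (hl : α < l) (hr : r0 < β) (ht : t ∈ Ioo σ p) (hX : ∀ r ∈ Icc σ p, X r ∈ Icc l r0)
    (hXd : HasDerivAt X X' t) (hut : HasDerivAt (fun r => u (X t) r) ut t) :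
    HasDerivAt (fun r => u (X r) r) (ut + ux (X t) t * X') t := by
  have htI := Ioo_subset_Icc_self ht
  have hin : ∀ x ∈ Icc l r0, x ∈ Ioo α β := fun x hx => ⟨hl.trans_le hx.1, hx.2.trans_lt hr⟩
  have hζ : ∀ r, ∃ ζ, r ∈ Icc σ p → ζ ∈ Icc l r0 ∧ |ζ - X t| ≤ |X r - X t| ∧
      u (X r) r - u (X t) r = ux ζ r * (X r - X t) := by
    intro r
    by_cases h : r ∈ Icc σ p
    · obtain ⟨ζ, h1, h2, h3⟩ := mvt_abs (fun x hx => dx r h x (hin x hx)) (hX t htI) (hX r h)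
      exact ⟨ζ, fun _ => ⟨h1, h2, h3⟩⟩
    · exact ⟨0, fun h' => absurd h' h⟩
  choose ζ hζ using hζ
  have hev : ∀ᶠ r in 𝓝 t, r ∈ Icc σ p := Icc_mem_nhds ht.1 ht.2
  have hζt : Tendsto ζ (𝓝 t) (𝓝 (X t)) := by
    rw [tendsto_iff_dist_tendsto_zero]
    refine squeeze_zero' (g := fun r => |X r - X t|) (Eventually.of_forall fun r => dist_nonneg) ?_ ?_
    · filter_upwards [hev] with r hr using (hζ r hr).2.1
    · have := (hXd.continuousAt.tendsto.sub_const (X t)).abs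
      simpa using this
  have hux : Tendsto (fun r => ux (ζ r) r) (𝓝 t) (𝓝 (ux (X t) t)) := by
    have hc := cux (X t, t) ⟨htI, Ioo_subset_Icc_self (hin _ (hX t htI))⟩
    refine hc.tendsto.comp (f := fun r => (ζ r, r)) (tendsto_nhdsWithin_iff.mpr ⟨?_, ?_⟩)
    · exact hζt.prodMk_nhds tendsto_id
    · filter_upwards [hev] with r hr
      exact ⟨hr, Ioo_subset_Icc_self (hin _ (hζ r hr).1)⟩
  have hg : HasDerivAt (fun r => u (X r) r - u (X t) r) (ux (X t) t * X') t := by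
    rw [hasDerivAt_iff_tendsto_slope]
    refine Tendsto.congr' ?_ ((hux.mono_left nhdsWithin_le_nhds).mul (hasDerivAt_iff_tendsto_slope.1 hXd))
    filter_upwards [nhdsWithin_le_nhds hev] with r hr
    simp only [slope_def_field, (hζ r hr).2.2]; ring
  refine (hut.add hg).congr_of_eventuallyEq (Eventually.of_forall fun r => ?_)
  simp

set_option maxHeartbeats 2000000 in
lemma uc_local {a ax axx at' u ux uxx ut : ℝ → ℝ → ℝ} {M α β σ p x1 x' ρ0 : ℝ}
    (A : Coef a ax axx at' M (Rec α β σ p)) (W : WSol a u ux uxx ut M α β σ p)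
    (hσ : σ < p) (h1 : M * |x' - x1| < x1 - α) (h2 : M * |x' - x1| < β - x1) (hρ : 0 < ρ0)
    (hz : ∀ x, |x - x1| ≤ ρ0 → u x p = 0) : u x' p = 0 := by
  by_contra hne
  have hM := A.Mpos
  have hnn : 0 ≤ M * |x' - x1| := by positivity
  obtain ⟨C, S⟩ := A.sfam (by linarith)
  obtain ⟨X, Xt, d1, d2, d3, d4, d5, d6, d7⟩ := inv_lemma S x1
  set k := √M with hk
  have hk0 : 0 < k := S.kpos
  have hkk : k * k = M := Real.mul_self_sqrt hM.le
  have hpI : p ∈ Icc σ p := ⟨hσ.le, le_rfl⟩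
  obtain ⟨y0, hy0, hy0'⟩ := d3 p hpI x'
  set d := min (x1 - α) (β - x1) with hd
  have hyd : k * |y0| < d := by
    have : k * |y0| ≤ k * (k * |x' - x1|) := by gcongr
    rw [← mul_assoc, hkk] at this
    exact this.trans_lt (lt_min h1 h2)
  obtain ⟨R, hR1, hR2⟩ : ∃ R, |y0| < R ∧ k * R < d := by
    refine ⟨(|y0| + d / k) / 2, ?_, ?_⟩
    · have : |y0| < d / k := by rw [lt_div_iff₀ hk0]; linarith
      linarith
    · have : k * ((|y0| + d / k) / 2) = (k * |y0| + d) / 2 := by field_simp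
      linarith
  have hR : 0 < R := (abs_nonneg _).trans_lt hR1
  have hd1 : d ≤ x1 - α := min_le_left _ _
  have hd2 : d ≤ β - x1 := min_le_right _ _
  have hXm : ∀ t ∈ Icc σ p, ∀ y ∈ Icc (-R) R, X y t ∈ Icc (x1 - k * R) (x1 + k * R) := by
    intro t ht y hy
    have h3 := d2 t ht y
    have h4 : k * |y| ≤ k * R := by gcongr; exact abs_le.2 hy
    have := abs_le.1 (h3.trans h4)
    exact ⟨by linarith [this.1], by linarith [this.2]⟩
  have hXo : ∀ t ∈ Icc σ p, ∀ y ∈ Icc (-R) R, X y t ∈ Ioo α β := fun t ht y hy =>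
    ⟨by linarith [(hXm t ht y hy).1], by linarith [(hXm t ht y hy).2]⟩
  have hcl : ∀ x ∈ Ioo α β, max α (min x β) = x := fun x hx => by
    rw [min_eq_left hx.2.le, max_eq_right hx.1.le]
  have d1' : ∀ t ∈ Icc σ p, ∀ y ∈ Icc (-R) R,
      HasDerivAt (fun y => X y t) (√(a (X y t) t)) y := fun t ht y hy => by
    have := d1 t ht y
    rwa [hcl _ (hXo t ht y hy), inv_inv] at this
  have hcomp : ∀ {h : ℝ → ℝ → ℝ}, ContinuousOn (fun q : ℝ × ℝ => h q.1 q.2) (Rec α β σ p) →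
      ContinuousOn (fun q : ℝ × ℝ => h (X q.1 q.2) q.2) (Rec (-R) R σ p) := by
    intro h hc
    refine hc.comp (f := fun q : ℝ × ℝ => (X q.1 q.2, q.2)) (ContinuousOn.prodMk
      (d4.mono fun q hq => ⟨trivial, hq.1⟩) continuousOn_snd) ?_
    intro q hq
    exact ⟨hq.1, Ioo_subset_Icc_self (hXo q.2 hq.1 q.1 hq.2)⟩
  have hap : ∀ t ∈ Icc σ p, ∀ x ∈ Ioo α β, 0 < a x t := fun t ht x hx =>
    (inv_pos.2 hM).trans_le (A.lo x t ⟨ht, Ioo_subset_Icc_self hx⟩)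
  obtain ⟨B1, hB1, hb1⟩ := rec_bound W.cux
  obtain ⟨B2, hB2, hb2⟩ := rec_bound W.cut
  have hXt : ∀ t ∈ Ioo σ p, ∀ y ∈ Icc (-R) R, |Xt y t| ≤ C * k * (k * R) := fun t ht y hy => by
    have h4 : |y| ≤ R := abs_le.2 hy
    have := S.Cnn
    exact (d6 t ht y).trans (by gcongr)
  have V : Fam (fun y t => u (X y t) t) (fun y t => ux (X y t) t * √(a (X y t) t))
      (fun y t => a (X y t) t * uxx (X y t) t + ux (X y t) t * (ax (X y t) t / 2))
      (fun y t => ut (X y t) t + ux (X y t) t * Xt y t) R (B2 + B1 * (C * k * (k * R))) σ p := by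
    refine ⟨hR, hcomp W.cu, (hcomp W.cux).mul (hcomp A.ca).sqrt, ((hcomp A.ca).mul (hcomp W.cuxx)).add
      ((hcomp W.cux).mul ((hcomp (A.cax (by linarith))).div_const 2)), ?_, ?_, ?_, ?_, ?_⟩
    · intro t ht
      have htI := Ioo_subset_Icc_self ht
      exact (slice_cont (h := fun y t => ut (X y t) t) (hcomp W.cut) htI).add
        ((slice_cont (h := fun y t => ux (X y t) t) (hcomp W.cux) htI).mul (d7 t ht).continuousOn)
    · intro t ht y hy
      have htI := Ioo_subset_Icc_self ht
      have hx := Ioo_subset_Icc_self (hXo t htI y hy)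
      refine (abs_add_le _ _).trans (add_le_add (hb2 t htI _ hx) ?_)
      rw [abs_mul]
      exact mul_le_mul (hb1 t htI _ hx) (hXt t ht y hy) (abs_nonneg _) hB1
    · intro t ht y hy
      have hy := Ioo_subset_Icc_self hy
      exact (W.dx t ht _ (hXo t ht y hy)).comp y (d1' t ht y hy)
    · intro t ht y hy
      have hy := Ioo_subset_Icc_self hy
      have hx := hXo t ht y hy
      have h5 := (W.dxx t ht _ hx).comp y (d1' t ht y hy)
      have h6 := ((A.dx (X y t) t ⟨ht, Ioo_subset_Icc_self hx⟩).comp y (d1' t ht y hy)).sqrt (by exact (hap t ht _ hx).ne')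
      have hs := Real.sqrt_pos.2 (hap t ht _ hx)
      have hs2 := Real.mul_self_sqrt (hap t ht _ hx).le
      refine (h5.mul h6).congr_deriv ?_
      simp only [Function.comp]
      set q := √(a (X y t) t)
      rw [← hs2]; field_simp
    · intro t ht y hy
      have htI := Ioo_subset_Icc_self ht
      exact chain_t (X := fun r => X y r) W.cux W.dx (l := x1 - k * R) (r0 := x1 + k * R) (by linarith)
        (by linarith) ht (fun r hr => hXm r hr y hy) (d5 t ht y) (W.dt t ht _ (hXo t htI y hy))
  refine uc_core V hσ (M := M + (C * k * (k * R) + M + M) * k) ?_ ?_ (ρ := ρ0 / k) (by positivity) ?_ hR1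
    (by simpa [hy0] using hne)
  · have := S.Cnn; positivity
  · intro t ht y hy
    have htI := Ioo_subset_Icc_self ht
    have hx := hXo t htI y hy
    have hxI : (X y t, t) ∈ Rec α β σ p := ⟨htI, Ioo_subset_Icc_self hx⟩
    have e1 := W.ineq t htI _ hxI.2
    have e2 := hXt t ht y hy
    have e3 := A.bx _ _ hxI
    have e4 : |ux (X y t) t| ≤ k * |ux (X y t) t * √(a (X y t) t)| := by
      rw [abs_mul, abs_of_nonneg (Real.sqrt_nonneg _)]
      have : k⁻¹ ≤ √(a (X y t) t) := by
        rw [hk, ← Real.sqrt_inv]; exact Real.sqrt_le_sqrt (A.lo _ _ hxI)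
      have h7 : 1 ≤ k * √(a (X y t) t) := by
        calc 1 = k * k⁻¹ := by field_simp
          _ ≤ _ := by gcongr
      nlinarith [abs_nonneg (ux (X y t) t)]
    have := S.Cnn
    have hCk : 0 ≤ C * k * (k * R) := by positivity
    generalize C * k * (k * R) = Q at *
    generalize |ux (X y t) t * √(a (X y t) t)| = P at *
    generalize X y t = x at *
    have e5 : |ut x t + ux x t * Xt y t - (a x t * uxx x t + ux x t * (ax x t / 2))| ≤
        M * (|u x t| + |ux x t|) + |ux x t| * (Q + M) := by
      have : ut x t + ux x t * Xt y t - (a x t * uxx x t + ux x t * (ax x t / 2)) =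
        (ut x t - a x t * uxx x t) + ux x t * (Xt y t - ax x t / 2) := by ring
      rw [this]
      refine (abs_add_le _ _).trans (add_le_add e1 ?_)
      rw [abs_mul]
      gcongr
      rw [abs_le] at *
      constructor <;> linarith [e2.1, e2.2, e3.1, e3.2]
    have e6 : |ux x t| * (Q + M + M) ≤ k * P * (Q + M + M) := by gcongr
    have e7 := abs_nonneg (u x t)
    have e8 : 0 ≤ P := by
      by_contra hh
      nlinarith [abs_nonneg (ux x t)]
    have e9 : 0 ≤ (Q + M + M) * k * |u x t| + M * P := by positivity
    linarith
  · intro y hy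
    refine hz _ ((d2 p hpI y).trans ?_)
    calc k * |y| ≤ k * (ρ0 / k) := by gcongr
      _ = ρ0 := by field_simp

lemma uc_right {a ax axx at' u ux uxx ut : ℝ → ℝ → ℝ} {M α β σ p x0 : ℝ}
    (A : Coef a ax axx at' M (Rec α β σ p)) (W : WSol a u ux uxx ut M α β σ p)
    (hσ : σ < p) (hx0 : α < x0) (hx0β : x0 ≤ β)
    (hz : ∀ x ∈ Icc α x0, u x p = 0) : ∀ x ∈ Ico α β, u x p = 0 := by
  have hM := A.Mpos
  set Z := {y | y ∈ Icc x0 β ∧ ∀ x ∈ Icc α y, u x p = 0} with hZ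
  have hbd : BddAbove Z := ⟨β, fun y hy => hy.1.2⟩
  have hx0Z : x0 ∈ Z := ⟨⟨le_rfl, hx0β⟩, hz⟩
  set q := sSup Z with hq
  have hq0 : x0 ≤ q := le_csSup hbd hx0Z
  have hqβ : q ≤ β := csSup_le ⟨x0, hx0Z⟩ fun y hy => hy.1.2
  have hlow : ∀ x, α ≤ x → x < q → u x p = 0 := by
    intro x h1 h2
    obtain ⟨y, hy, hxy⟩ := exists_lt_of_lt_csSup ⟨x0, hx0Z⟩ h2
    exact hy.2 x ⟨h1, hxy.le⟩
  rcases hqβ.eq_or_lt with h | h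
  · exact fun x hx => hlow x hx.1 (by rw [h]; exact hx.2)
  exfalso
  set d := min (q - α) (β - q) with hd
  have hd0 : 0 < d := lt_min (by linarith) (by linarith)
  have hd1 : d ≤ q - α := min_le_left _ _
  have hd2 : d ≤ β - q := min_le_right _ _
  set h' := d / (4 * M + 4) with hh
  have hh0 : 0 < h' := by positivity
  have hh1 : h' * (4 * M + 4) = d := by rw [hh]; field_simp
  have hMh : 0 < M * h' := by positivity
  have : q + h' ∈ Z := by
    refine ⟨⟨by linarith, by linarith⟩, fun x hx => ?_⟩
    rcases lt_or_ge x q with h3 | h3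
    · exact hlow x hx.1 h3
    · have hab : M * |x - (q - h')| ≤ M * (2 * h') := by
        gcongr
        rw [abs_of_nonneg (by linarith)]; linarith [hx.2]
      refine uc_local A W hσ (x1 := q - h') (ρ0 := h' / 2) (by linarith) (by linarith) (by positivity) ?_
      intro z hz
      have := abs_le.1 hz
      exact hlow z (by linarith [this.1]) (by linarith [this.2])
  linarith [le_csSup hbd this]

section
variable {a ax axx at' u ux uxx ut : ℝ → ℝ → ℝ} {M α β σ p : ℝ}

lemma Sol.w (S : Sol a u ux uxx ut M (Rec α β σ p)) : WSol a u ux uxx ut M α β σ p :=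
  ⟨S.cu, S.cux, S.cuxx, S.cut, fun t ht x hx => S.dx x t ⟨ht, Ioo_subset_Icc_self hx⟩,
    fun t ht x hx => S.dxx x t ⟨ht, Ioo_subset_Icc_self hx⟩,
    fun t ht x hx => S.dt x t ⟨Ioo_subset_Icc_self ht, Ioo_subset_Icc_self hx⟩,
    fun t ht x hx => S.ineq x t ⟨ht, hx⟩⟩

lemma Rec_sub {α' β' σ' p' : ℝ} (h1 : α ≤ α') (h2 : β' ≤ β) (h3 : σ ≤ σ') (h4 : p' ≤ p) :
    Rec α' β' σ' p' ⊆ Rec α β σ p :=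
  fun _ hq => ⟨⟨h3.trans hq.1.1, hq.1.2.trans h4⟩, ⟨h1.trans hq.2.1, hq.2.2.trans h2⟩⟩

lemma uc_ne (C : Coef a ax axx at' M (Rec α β σ p)) (S : Sol a u ux uxx ut M (Rec α β σ p))
    {t : ℝ} (ht : t ∈ Ioc σ p) (hβ : u β t ≠ 0) {l r : ℝ} (hl : α ≤ l) (hlr : l < r) (hr : r ≤ β) :
    ∃ y ∈ Ioo l r, u y t ≠ 0 := by
  by_contra hcon
  push Not at hcon
  have hlr' : l < (l + r) / 2 := by linarith
  have hsub : Rec ((l + r) / 2) β σ t ⊆ Rec α β σ p := Rec_sub (by linarith) le_rfl le_rfl ht.2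
  have h1 := uc_right (x0 := ((l + r) / 2 + r) / 2) (C.mono hsub) (S.mono hsub).w ht.1 (by linarith) (by linarith)
    (fun x hx => hcon x ⟨by linarith [hx.1], by linarith [hx.2]⟩)
  have htm : t ∈ Icc σ p := Ioc_subset_Icc_self ht
  have hc : ContinuousWithinAt (fun y => u y t) (Ico ((l + r) / 2) β) β :=
    (slice_cont S.cu htm β ⟨by linarith, le_rfl⟩).mono (fun x hx => ⟨by linarith [hx.1], hx.2.le⟩)
  have hne : (𝓝[Ico ((l + r) / 2) β] β).NeBot := by
    rw [← mem_closure_iff_nhdsWithin_neBot, closure_Ico (by linarith)]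
    exact ⟨by linarith, le_rfl⟩
  exact hβ (tendsto_nhds_unique_of_eventuallyEq hc.tendsto tendsto_const_nhds
    (by filter_upwards [self_mem_nhdsWithin] with x hx using h1 x hx))

lemma sturm_aux (C : Coef a ax axx at' M (Rec α β σ p)) (S : Sol a u ux uxx ut M (Rec α β σ p))
    (hσ : σ < p) (hα : ∀ t ∈ Icc σ p, u α t ≠ 0) (hβ : ∀ t ∈ Icc σ p, u β t ≠ 0) (F : Finset ℝ) :
    ∀ η' : ℝ → ℝ, Continuous η' → (∀ t ∈ Icc σ p, η' t ∈ Icc α β ∧ u (η' t) t ≠ 0) →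
    (∀ z ∈ F, z ∈ Ioo α (η' p) ∧ u z p = 0) →
    (F.card : ℕ∞) ≤ {x | x ∈ Ioo α (η' σ) ∧ u x σ = 0}.encard := by
  have hpI : p ∈ Icc σ p := ⟨hσ.le, le_rfl⟩
  have hσI : σ ∈ Icc σ p := ⟨le_rfl, hσ.le⟩
  induction F using Finset.induction_on_max with
  | empty => intro η' _ _ _; simp
  | insert z F hzF ih =>
    intro η' hη' hη1 hF
    obtain ⟨hz, hz0⟩ := hF z (Finset.mem_insert_self _ _)
    have hm := Finset.max'_mem (insert α F) ⟨α, by simp⟩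
    have hle := fun f hf => Finset.le_max' (insert α F) f hf
    set m := (insert α F).max' ⟨α, by simp⟩
    have hmz : m < z := by
      rcases Finset.mem_insert.1 hm with h | h
      · rw [h]; exact hz.1
      · exact hzF _ h
    have hzβ := hz.2.le.trans (hη1 p hpI).1.2
    obtain ⟨y, hy, hy0⟩ := uc_ne C S ⟨hσ, le_rfl⟩ (hβ p hpI) (hle α (by simp)) hmz hzβ
    have hyI : y ∈ Icc α β := ⟨(hle α (by simp)).trans hy.1.le, hy.2.le.trans hzβ⟩
    obtain ⟨η, hη, hηp, hη2⟩ := path_ne C S hσ.le hα hβ hyI hy0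
    have h1 := ih η hη hη2 (fun f hf => ⟨⟨(hF f (Finset.mem_insert_of_mem hf)).1.1, by
      rw [hηp]; exact (hle f (Finset.mem_insert_of_mem hf)).trans_lt hy.1⟩,
      (hF f (Finset.mem_insert_of_mem hf)).2⟩)
    obtain ⟨w, hw, hw0⟩ := TP C S hσ.le hη.continuousOn hη'.continuousOn
      (fun t ht x hx => ⟨ht, uIcc_subset_Icc (hη2 t ht).1 (hη1 t ht).1 hx⟩) (fun t ht => (hη2 t ht).2)
      (fun t ht => (hη1 t ht).2) (z := z) ⟨by rw [hηp]; exact hy.2, hz.2⟩ hz0 σ hσI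
    rw [Finset.card_insert_of_notMem (fun h => lt_irrefl _ (hzF z h))]
    push_cast
    have hnot : w ∉ {x | x ∈ Ioo α (η σ) ∧ u x σ = 0} := fun h => lt_asymm h.1.2 hw.1
    calc (F.card : ℕ∞) + 1 ≤ _ + 1 := by gcongr
      _ = (insert w {x | x ∈ Ioo α (η σ) ∧ u x σ = 0}).encard := (encard_insert_of_notMem hnot).symm
      _ ≤ _ := by
        refine encard_le_encard (insert_subset ⟨⟨(hη2 σ hσI).1.1.trans_lt hw.1, hw.2⟩, hw0⟩ ?_)
        exact fun x hx => ⟨⟨hx.1.1, hx.1.2.trans (hw.1.trans hw.2)⟩, hx.2⟩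

lemma finset_of_le {s : Set ℝ} {n : ℕ} (h : (n : ℕ∞) ≤ s.encard) : ∃ F : Finset ℝ, ↑F ⊆ s ∧ F.card = n := by
  obtain ⟨r, hr, hn⟩ := exists_subset_encard_eq h
  have hf : r.Finite := finite_of_encard_eq_coe hn
  refine ⟨hf.toFinset, by simpa using hr, ?_⟩
  rw [hf.encard_eq_coe_toFinset_card] at hn
  exact_mod_cast hn

lemma sturm (C : Coef a ax axx at' M (Rec α β σ p)) (S : Sol a u ux uxx ut M (Rec α β σ p))
    (hσ : σ < p) (hα : ∀ t ∈ Icc σ p, u α t ≠ 0) (hβ : ∀ t ∈ Icc σ p, u β t ≠ 0) (hαβ : α ≤ β) :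
    {x | x ∈ Ioo α β ∧ u x p = 0}.encard ≤ {x | x ∈ Ioo α β ∧ u x σ = 0}.encard := by
  refine ENat.forall_natCast_le_iff_le.1 fun n hn => ?_
  obtain ⟨F, hF, rfl⟩ := finset_of_le hn
  exact sturm_aux C S hσ hα hβ F (fun _ => β) continuous_const
    (fun t ht => ⟨⟨hαβ, le_rfl⟩, hβ t ht⟩) (fun z hz => hF hz)

end

lemma hd_zero {f F : ℝ → ℝ} {t : ℝ} (hf : HasDerivAt f 0 t) (h0 : f t = 0)
    (hF : ∀ᶠ r in 𝓝 t, |F r| ≤ |f r|) : HasDerivAt F 0 t := by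
  have hFt : F t = 0 := by
    have := hF.self_of_nhds
    rw [h0, abs_zero] at this
    exact abs_eq_zero.1 (le_antisymm this (abs_nonneg _))
  rw [hasDerivAt_iff_isLittleO] at hf ⊢
  simp only [h0, hFt, sub_zero, smul_zero] at hf ⊢
  exact (Asymptotics.IsBigO.of_bound 1 (by
    filter_upwards [hF] with r hr; simpa using hr)).trans_isLittleO hf

lemma cut_dx {f f' : ℝ → ℝ} {g x : ℝ} (hd : g ≤ x → HasDerivAt f (f' x) x) (h0 : f g = 0)
    (h1 : f' g = 0) : HasDerivAt (fun y => f (max y g)) (f' (max x g)) x := by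
  rcases lt_trichotomy x g with h | h | h
  · rw [max_eq_right h.le, h1]
    refine (hasDerivAt_const x (0 : ℝ)).congr_of_eventuallyEq ?_
    filter_upwards [Iio_mem_nhds h] with y hy
    rw [max_eq_right (le_of_lt hy), h0]
  · subst h
    have := hd le_rfl
    rw [max_self, h1]; rw [h1] at this
    refine hd_zero this h0 (Eventually.of_forall fun y => ?_)
    rcases le_total x y with h | h
    · rw [max_eq_left h]
    · rw [max_eq_right h, h0]; simp
  · rw [max_eq_left h.le]
    refine (hd h.le).congr_of_eventuallyEq ?_
    filter_upwards [Ioi_mem_nhds h] with y hy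
    rw [max_eq_left (le_of_lt hy)]

lemma rolle_acc {f f' : ℝ → ℝ} {α β g : ℝ} (hd : ∀ x ∈ Icc α β, HasDerivAt f (f' x) x)
    {w : ℕ → ℝ} (hw : StrictAnti w) (hI : ∀ i, w i ∈ Icc α β) (hg : Tendsto w atTop (𝓝 g))
    (h0 : ∀ i, f (w i) = 0) : f g = 0 ∧ ∃ w' : ℕ → ℝ, StrictAnti w' ∧ (∀ i, w' i ∈ Icc α β) ∧
      Tendsto w' atTop (𝓝 g) ∧ ∀ i, f' (w' i) = 0 := by
  have hgI : g ∈ Icc α β := isClosed_Icc.mem_of_tendsto hg (Eventually.of_forall hI)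
  refine ⟨tendsto_nhds_unique ((hd g hgI).continuousAt.tendsto.comp hg)
    (by simp [Function.comp_def, h0]), ?_⟩
  have : ∀ i, ∃ z ∈ Ioo (w (i + 1)) (w i), f' z = 0 := fun i =>
    exists_hasDerivAt_eq_zero (hw (Nat.lt_succ_self i))
      (fun x hx => (hd x ⟨(hI _).1.trans hx.1, hx.2.trans (hI _).2⟩).continuousAt.continuousWithinAt)
      (by rw [h0, h0]) (fun x hx => hd x ⟨(hI _).1.trans hx.1.le, hx.2.le.trans (hI _).2⟩)
  choose w' h1 h2 using this
  refine ⟨w', strictAnti_nat_of_succ_lt fun n => (h1 (n + 1)).2.trans (h1 n).1,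
    fun i => ⟨(hI _).1.trans (h1 i).1.le, (h1 i).2.le.trans (hI _).2⟩, ?_, h2⟩
  exact tendsto_of_tendsto_of_tendsto_of_le_of_le ((tendsto_add_atTop_iff_nat 1).2 hg) hg
    (fun i => (h1 i).1.le) (fun i => (h1 i).2.le)

section
variable {a ax axx at' u ux uxx ut : ℝ → ℝ → ℝ} {M α β σ p : ℝ}

set_option maxHeartbeats 1000000 in
lemma fin_aux (C : Coef a ax axx at' M (Rec α β σ p)) (S : Sol a u ux uxx ut M (Rec α β σ p))
    (hσ : σ < p) (hα : ∀ t ∈ Icc σ p, u α t ≠ 0) (hβ : ∀ t ∈ Icc σ p, u β t ≠ 0)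
    {z : ℕ → ℝ} (hz : StrictAnti z) (hzI : ∀ i, z i ∈ Ioo α β) (hz0 : ∀ i, u (z i) p = 0) : False := by
  have hpI : p ∈ Icc σ p := ⟨hσ.le, le_rfl⟩
  have h1 : ∀ i, ∃ y ∈ Ioo (z (i + 1)) (z i), u y p ≠ 0 := fun i =>
    uc_ne C S ⟨hσ, le_rfl⟩ (hβ p hpI) (hzI _).1.le (hz (Nat.lt_succ_self i)) (hzI _).2.le
  choose y hy hy0 using h1
  have hyI : ∀ i, y i ∈ Icc α β := fun i =>
    ⟨(hzI _).1.le.trans (hy i).1.le, (hy i).2.le.trans (hzI _).2.le⟩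
  have h2 := fun i => path_ne C S hσ.le hα hβ (hyI i) (hy0 i)
  choose η hηc hηp hη using h2
  have h3 : ∀ t ∈ Icc σ p, ∀ i, ∃ w ∈ Ioo (η (i + 1) t) (η i t), u w t = 0 := fun t ht i =>
    TP C S hσ.le (hηc (i+1)).continuousOn (hηc i).continuousOn
      (fun t ht x hx => ⟨ht, uIcc_subset_Icc (hη _ t ht).1 (hη _ t ht).1 hx⟩) (fun t ht => (hη _ t ht).2)
      (fun t ht => (hη _ t ht).2) (z := z (i + 1))
      ⟨by rw [hηp]; exact (hy _).2, by rw [hηp]; exact (hy _).1⟩ (hz0 _) t ht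
  have hanti : ∀ t ∈ Icc σ p, StrictAnti (fun i => η i t) := fun t ht =>
    strictAnti_nat_of_succ_lt fun n => by
      obtain ⟨w, hw, _⟩ := h3 t ht n
      exact hw.1.trans hw.2
  set Γ : ℝ → ℝ := fun t => ⨅ i, η i t with hΓ
  have hbdd : ∀ t ∈ Icc σ p, BddBelow (range fun i => η i t) := fun t ht =>
    ⟨α, by rintro _ ⟨i, rfl⟩; exact (hη i t ht).1.1⟩
  have hlim : ∀ t ∈ Icc σ p, Tendsto (fun i => η i t) atTop (𝓝 (Γ t)) := fun t ht =>
    tendsto_atTop_ciInf (hanti t ht).antitone (hbdd t ht)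
  have hle : ∀ t ∈ Icc σ p, ∀ i, Γ t < η i t := fun t ht i =>
    (ciInf_le (hbdd t ht) (i + 1)).trans_lt (hanti t ht (Nat.lt_succ_self i))
  have hall : ∀ t ∈ Icc σ p, u (Γ t) t = 0 ∧ ux (Γ t) t = 0 ∧ uxx (Γ t) t = 0 ∧ ut (Γ t) t = 0 ∧
      Γ t ∈ Icc α β := by
    intro t ht
    choose w hw hw0 using h3 t ht
    have hwI : ∀ i, w i ∈ Icc α β := fun i =>
      ⟨(hη _ t ht).1.1.trans (hw i).1.le, (hw i).2.le.trans (hη _ t ht).1.2⟩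
    have hwa : StrictAnti w := strictAnti_nat_of_succ_lt fun n => (hw (n+1)).2.trans (hw n).1
    have hwl : Tendsto w atTop (𝓝 (Γ t)) := tendsto_of_tendsto_of_tendsto_of_le_of_le
      ((tendsto_add_atTop_iff_nat 1).2 (hlim t ht)) (hlim t ht) (fun i => (hw i).1.le) (fun i => (hw i).2.le)
    have hgI : Γ t ∈ Icc α β := isClosed_Icc.mem_of_tendsto hwl (Eventually.of_forall hwI)
    obtain ⟨e0, w1, a1, b1, c1, d1⟩ := rolle_acc (fun x hx => S.dx x t ⟨ht, hx⟩) hwa hwI hwl hw0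
    obtain ⟨e1, w2, a2, b2, c2, d2⟩ := rolle_acc (fun x hx => S.dxx x t ⟨ht, hx⟩) a1 b1 c1 d1
    have e2 : uxx (Γ t) t = 0 := by
      have h5 := (slice_cont S.cuxx ht (Γ t) hgI).tendsto.comp
        (tendsto_nhdsWithin_iff.2 ⟨c2, Eventually.of_forall b2⟩)
      exact tendsto_nhds_unique h5 (by simp [Function.comp_def, d2])
    refine ⟨e0, e1, e2, ?_, hgI⟩
    have := S.ineq (Γ t) t ⟨ht, hgI⟩
    simp only [e0, e1, e2, mul_zero, sub_zero, abs_zero, add_zero] at this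
    exact abs_eq_zero.1 (le_antisymm this (abs_nonneg _))
  -- crossing
  have hcross : ∀ B ∈ Icc α β, ∀ t ∈ Icc σ p, ∀ t' ∈ Icc σ p, t ≤ t' → (∀ r ∈ Icc t t', u B r ≠ 0) →
      (Γ t < B ↔ Γ t' < B) := by
    intro B hB t ht t' ht' htt hBne
    have hmem : ∀ r ∈ Icc t t', r ∈ Icc σ p := fun r hr => ⟨ht.1.trans hr.1, hr.2.trans ht'.2⟩
    have hne : ∀ r ∈ Icc t t', Γ r ≠ B := fun r hr h => hBne r hr (h ▸ (hall r (hmem r hr)).1)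
    constructor <;> intro h
    · by_contra hcon
      have hcon : B < Γ t' := lt_of_le_of_ne (not_lt.1 hcon) (hne t' ⟨htt, le_rfl⟩).symm
      obtain ⟨i, hi⟩ := exists_lt_of_ciInf_lt h
      have hi' := (hanti t ht (Nat.lt_succ_self i)).trans hi
      have key := mp_abs C S (A := fun r => max B (η (i+1) r)) (B := fun r => max B (η i r)) htt
        (by have := hηc (i+1); fun_prop) (by have := hηc i; fun_prop)
        (fun r hr x hx => ⟨hmem r hr, uIcc_subset_Icc (a₂ := α) (b₂ := β)
          (by rcases max_choice B (η (i+1) r) with h | h <;> rw [h]; exacts [hB, (hη _ r (hmem r hr)).1])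
          (by rcases max_choice B (η i r) with h | h <;> rw [h]; exacts [hB, (hη _ r (hmem r hr)).1]) hx⟩)
        (fun r hr => by
          rcases max_choice B (η (i+1) r) with h | h <;> rw [h]; exacts [hBne r hr, (hη _ r (hmem r hr)).2])
        (fun r hr => by
          rcases max_choice B (η i r) with h | h <;> rw [h]; exacts [hBne r hr, (hη _ r (hmem r hr)).2])
        (by
          intro x hx
          have e1 : max B (η (i+1) t) = B := max_eq_left hi'.le
          have e2 : max B (η i t) = B := max_eq_left hi.le
          simp only [e1, e2, uIcc_self, mem_singleton_iff] at hx
          rw [hx]; exact hBne t ⟨le_rfl, htt⟩) t' ⟨htt, le_rfl⟩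
      obtain ⟨w, hw, hw0⟩ := h3 t' ht' i
      refine key w ?_ hw0
      simp only [max_eq_right (hcon.trans (hle t' ht' _)).le]
      exact Icc_subset_uIcc (Ioo_subset_Icc_self hw)
    · by_contra hcon
      have hcon : B < Γ t := lt_of_le_of_ne (not_lt.1 hcon) (hne t ⟨le_rfl, htt⟩).symm
      obtain ⟨i, hi⟩ := exists_lt_of_ciInf_lt h
      have hi' := (hanti t' ht' (Nat.lt_succ_self i)).trans hi
      have key := mp_abs C S (A := fun r => min B (η (i+1) r)) (B := fun r => min B (η i r)) htt
        (by have := hηc (i+1); fun_prop) (by have := hηc i; fun_prop)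
        (fun r hr x hx => ⟨hmem r hr, uIcc_subset_Icc (a₂ := α) (b₂ := β)
          (by rcases min_choice B (η (i+1) r) with h | h <;> rw [h]; exacts [hB, (hη _ r (hmem r hr)).1])
          (by rcases min_choice B (η i r) with h | h <;> rw [h]; exacts [hB, (hη _ r (hmem r hr)).1]) hx⟩)
        (fun r hr => by
          rcases min_choice B (η (i+1) r) with h | h <;> rw [h]; exacts [hBne r hr, (hη _ r (hmem r hr)).2])
        (fun r hr => by
          rcases min_choice B (η i r) with h | h <;> rw [h]; exacts [hBne r hr, (hη _ r (hmem r hr)).2])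
        (by
          intro x hx
          simp only [min_eq_left (hcon.trans (hle t ht _)).le, uIcc_self, mem_singleton_iff] at hx
          rw [hx]; exact hBne t ⟨le_rfl, htt⟩) t' ⟨htt, le_rfl⟩
      obtain ⟨w, hw, hw0⟩ := h3 t' ht' i
      refine key w ?_ hw0
      have e1 : min B (η (i+1) t') = η (i+1) t' := min_eq_right hi'.le
      have e2 : min B (η i t') = η i t' := min_eq_right hi.le
      simp only [e1, e2]
      exact Icc_subset_uIcc (Ioo_subset_Icc_self hw)
  have hloc : ∀ B ∈ Icc α β, ∀ t ∈ Icc σ p, u B t ≠ 0 → ∀ᶠ r in 𝓝[Icc σ p] t, (Γ t < B ↔ Γ r < B) := by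
    intro B hB t ht hBt
    have hc := (tslice_cont S.cu hB t ht).eventually_ne hBt
    rw [eventually_nhdsWithin_iff, Metric.eventually_nhds_iff] at hc
    obtain ⟨δ, hδ, hc⟩ := hc
    rw [eventually_nhdsWithin_iff, Metric.eventually_nhds_iff]
    refine ⟨δ, hδ, fun r hr hrI => ?_⟩
    rw [Real.dist_eq, abs_lt] at hr
    have hc' : ∀ q, |q - t| < δ → q ∈ Icc σ p → u B q ≠ 0 := fun q h1 h2 => hc (by rwa [Real.dist_eq]) h2
    rcases le_total t r with h | h
    · exact hcross B hB t ht r hrI h fun q hq => hc' q (abs_lt.2 ⟨by linarith [hq.1], by linarith [hq.2]⟩)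
        ⟨ht.1.trans hq.1, hq.2.trans hrI.2⟩
    · exact (hcross B hB r hrI t ht h fun q hq => hc' q (abs_lt.2 ⟨by linarith [hq.1], by linarith [hq.2]⟩)
        ⟨hrI.1.trans hq.1, hq.2.trans ht.2⟩).symm
  have hαΓ : ∀ t ∈ Icc σ p, α < Γ t := fun t ht =>
    lt_of_le_of_ne (hall t ht).2.2.2.2.1 fun h => hα t ht (h ▸ (hall t ht).1)
  have hΓβ : ∀ t ∈ Icc σ p, Γ t < β := fun t ht => (hle t ht 0).trans_le (hη 0 t ht).1.2
  have hΓc : ContinuousOn Γ (Ioc σ p) := by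
    intro t ht
    have htI := Ioc_subset_Icc_self ht
    have hnh : 𝓝[Ioc σ p] t ≤ 𝓝[Icc σ p] t := nhdsWithin_mono _ Ioc_subset_Icc_self
    refine tendsto_order.2 ⟨fun x hx => ?_, fun x hx => ?_⟩
    · obtain ⟨B, hB, hB0⟩ := uc_ne C S ht (hβ t htI) (le_max_right x α) (max_lt hx (hαΓ t htI)) (hΓβ t htI).le
      have hBI : B ∈ Icc α β := ⟨(le_max_right x α).trans hB.1.le, hB.2.le.trans (hΓβ t htI).le⟩
      filter_upwards [hnh (hloc B hBI t htI hB0)] with r hr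
      have h5 : ¬ Γ r < B := fun h => lt_asymm (hr.2 h) hB.2
      exact ((le_max_left x α).trans_lt hB.1).trans_le (not_lt.1 h5)
    · obtain ⟨B, hB, hB0⟩ := uc_ne C S ht (hβ t htI) (hαΓ t htI).le (lt_min hx (hΓβ t htI)) (min_le_right x β)
      have hBI : B ∈ Icc α β := ⟨(hαΓ t htI).le.trans hB.1.le, hB.2.le.trans (min_le_right x β)⟩
      filter_upwards [hnh (hloc B hBI t htI hB0)] with r hr
      exact (hr.1 hB.1).trans (hB.2.trans_le (min_le_left _ _))
  set σ' := (σ + p) / 2 with hσ'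
  have hsI : ∀ t ∈ Icc σ' p, t ∈ Ioc σ p := fun t ht => ⟨by linarith [ht.1], ht.2⟩
  have hsI' : ∀ t ∈ Icc σ' p, t ∈ Icc σ p := fun t ht => Ioc_subset_Icc_self (hsI t ht)
  have hmaxI : ∀ t ∈ Icc σ' p, ∀ x ∈ Icc α β, max x (Γ t) ∈ Icc α β := fun t ht x hx =>
    ⟨hx.1.trans (le_max_left _ _), max_le hx.2 (hΓβ t (hsI' t ht)).le⟩
  have hcomp : ∀ {h : ℝ → ℝ → ℝ}, ContinuousOn (fun q : ℝ × ℝ => h q.1 q.2) (Rec α β σ p) →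
      ContinuousOn (fun q : ℝ × ℝ => h (max q.1 (Γ q.2)) q.2) (Rec α β σ' p) := by
    intro h hc
    refine hc.comp (f := fun q : ℝ × ℝ => (max q.1 (Γ q.2), q.2)) (ContinuousOn.prodMk
      (ContinuousOn.sup continuousOn_fst (hΓc.comp continuousOn_snd fun q hq => hsI _ hq.1)) continuousOn_snd) ?_
    intro q hq
    exact ⟨hsI' _ hq.1, hmaxI _ hq.1 _ hq.2⟩
  have hW : WSol a (fun x t => u (max x (Γ t)) t) (fun x t => ux (max x (Γ t)) t)
      (fun x t => uxx (max x (Γ t)) t) (fun x t => ut (max x (Γ t)) t) M α β σ' p := by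
    refine ⟨hcomp S.cu, hcomp S.cux, hcomp S.cuxx, hcomp S.cut, ?_, ?_, ?_, ?_⟩
    · intro t ht x hx
      exact cut_dx (f := fun y => u y t) (f' := fun y => ux y t)
        (fun _ => S.dx x t ⟨hsI' t ht, Ioo_subset_Icc_self hx⟩) (hall t (hsI' t ht)).1 (hall t (hsI' t ht)).2.1
    · intro t ht x hx
      exact cut_dx (f := fun y => ux y t) (f' := fun y => uxx y t)
        (fun _ => S.dxx x t ⟨hsI' t ht, Ioo_subset_Icc_self hx⟩) (hall t (hsI' t ht)).2.1
        (hall t (hsI' t ht)).2.2.1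
    · intro t ht x hx
      have htI := Ioo_subset_Icc_self ht
      have hd := S.dt x t ⟨hsI' t htI, Ioo_subset_Icc_self hx⟩
      have hev : ∀ᶠ r in 𝓝 t, r ∈ Icc σ' p := Icc_mem_nhds ht.1 ht.2
      have hca : ContinuousAt Γ t := hΓc.continuousAt
        (mem_of_superset hev hsI)
      rcases lt_trichotomy x (Γ t) with h | h | h
      · simp only [max_eq_right h.le, (hall t (hsI' t htI)).2.2.2.1]
        refine (hasDerivAt_const t (0 : ℝ)).congr_of_eventuallyEq ?_
        filter_upwards [hev, hca.eventually (lt_mem_nhds h)] with r hr hr2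
        rw [max_eq_right (le_of_lt hr2), (hall r (hsI' r hr)).1]
      · subst h
        simp only [max_self, (hall t (hsI' t htI)).2.2.2.1] at hd ⊢
        refine hd_zero hd (hall t (hsI' t htI)).1 ?_
        filter_upwards [hev] with r hr
        rcases max_choice (Γ t) (Γ r) with h | h <;> rw [h]
        rw [(hall r (hsI' r hr)).1]; simp
      · simp only [max_eq_left h.le]
        refine hd.congr_of_eventuallyEq ?_
        filter_upwards [hca.eventually (gt_mem_nhds h)] with r hr2
        rw [max_eq_left (le_of_lt hr2)]
    · intro t ht x hx
      rcases le_total (Γ t) x with h | h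
      · simp only [max_eq_left h]; exact S.ineq x t ⟨hsI' t ht, hx⟩
      · obtain ⟨e0, e1, e2, e3, _⟩ := hall t (hsI' t ht)
        simp [max_eq_right h, e0, e1, e2, e3]
  have hfin := uc_right (C.mono (Rec_sub le_rfl le_rfl (by linarith) le_rfl)) hW (by linarith)
    (hαΓ p hpI) (hΓβ p hpI).le (fun x hx => by simp [max_eq_right hx.2, (hall p hpI).1])
  have h6 := hle p hpI 0
  rw [hηp] at h6
  have h7 := hfin (y 0) ⟨(hyI 0).1, (hy 0).2.trans (hzI 0).2⟩
  simp only [max_eq_left h6.le] at h7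
  exact hy0 0 h7

lemma fin_zeros (C : Coef a ax axx at' M (Rec α β σ p)) (S : Sol a u ux uxx ut M (Rec α β σ p))
    (hσ : σ < p) (hα : ∀ t ∈ Icc σ p, u α t ≠ 0) (hβ : ∀ t ∈ Icc σ p, u β t ≠ 0) :
    {x | x ∈ Ioo α β ∧ u x p = 0}.Finite := by
  by_contra hinf
  have hinf : {x | x ∈ Ioo α β ∧ u x p = 0}.Infinite := hinf
  set f := hinf.natEmbedding
  obtain ⟨g, hg⟩ := exists_increasing_or_nonincreasing_subseq (fun x y : ℝ => x < y) (fun n => (f n : ℝ))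
  have hm : ∀ n, (f n : ℝ) ∈ Ioo α β ∧ u (f n) p = 0 := fun n => (f n).2
  rcases hg with hg | hg
  · refine fin_aux C.refl S.refl hσ (z := fun n => -(f (g n) : ℝ)) (by simpa using hβ) (by simpa using hα)
      (fun m n hmn => neg_lt_neg (hg m n hmn)) (fun i => ?_) (fun i => by simpa using (hm (g i)).2)
    exact ⟨neg_lt_neg (hm (g i)).1.2, neg_lt_neg (hm (g i)).1.1⟩
  · refine fin_aux C S hσ hα hβ (z := fun n => (f (g n) : ℝ)) (fun m n hmn => ?_) (fun i => (hm (g i)).1)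
      (fun i => (hm (g i)).2)
    refine lt_of_le_of_ne (not_lt.1 (hg m n hmn)) fun h => ?_
    have := g.injective (f.injective (Subtype.ext h))
    omega
end

structure Setup (a ax axx at' u ux uxx ut : ℝ → ℝ → ℝ) (M T X : ℝ) (ξ : ℝ → ℝ) : Prop where
  C : Coef a ax axx at' M (domLat ξ (fun _ => X) T)
  S : Sol a u ux uxx ut M (domLat ξ (fun _ => X) T)
  cξ : ContinuousOn ξ (Icc 0 T)
  lt : ∀ t ∈ Icc (0:ℝ) T, ξ t < X
  hX : ∀ t ∈ Icc (0:ℝ) T, u X t ≠ 0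

section
variable {a ax axx at' u ux uxx ut : ℝ → ℝ → ℝ} {M T X : ℝ} {ξ : ℝ → ℝ}

lemma Setup.neg (G : Setup a ax axx at' u ux uxx ut M T X ξ) :
    Setup a ax axx at' (fun x t => -u x t) (fun x t => -ux x t) (fun x t => -uxx x t)
      (fun x t => -ut x t) M T X ξ :=
  ⟨G.C, G.S.neg, G.cξ, G.lt, fun t ht => neg_ne_zero.2 (G.hX t ht)⟩

lemma Setup.ca (G : Setup a ax axx at' u ux uxx ut M T X ξ) {p : ℝ} (hp : p ∈ Ioo 0 T) :
    ContinuousAt ξ p := G.cξ.continuousAt (Icc_mem_nhds hp.1 hp.2)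

lemma Setup.near0 (G : Setup a ax axx at' u ux uxx ut M T X ξ) {p y : ℝ} (hp : p ∈ Ioo 0 T)
    (hy : ξ p < y) : ∃ δ > 0, ∀ t, |t - p| < δ → t ∈ Ioo 0 T ∧ ξ t < y := by
  have h1 : ∀ᶠ t in 𝓝 p, t ∈ Ioo 0 T := Ioo_mem_nhds hp.1 hp.2
  have h := h1.and ((G.ca hp).eventually (gt_mem_nhds hy))
  obtain ⟨δ, hδ, h⟩ := Metric.eventually_nhds_iff.1 h
  exact ⟨δ, hδ, fun t ht => h (by rwa [Real.dist_eq])⟩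

lemma Setup.cut (G : Setup a ax axx at' u ux uxx ut M T X ξ) {p y : ℝ} (hp : p ∈ Ioo 0 T)
    (hy : y ∈ Icc (ξ p) X) : ContinuousAt (fun t => u y t) p :=
  (G.S.dt y p ⟨⟨hp.1, hp.2.le⟩, hy⟩).continuousAt

lemma Setup.near (G : Setup a ax axx at' u ux uxx ut M T X ξ) {p y : ℝ} (hp : p ∈ Ioo 0 T)
    (hy : y ∈ Ioo (ξ p) X) (h0 : u y p ≠ 0) :
    ∃ δ > 0, ∀ t, |t - p| < δ → t ∈ Ioo 0 T ∧ ξ t < y ∧ 0 < u y p * u y t := by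
  obtain ⟨δ, hδ, h⟩ := G.near0 hp hy.1
  have hc := ((G.cut hp (Ioo_subset_Icc_self hy)).const_mul (u y p)).eventually
    (lt_mem_nhds (mul_self_pos.2 h0))
  obtain ⟨δ', hδ', h'⟩ := Metric.eventually_nhds_iff.1 hc
  exact ⟨min δ δ', lt_min hδ hδ', fun t ht => ⟨(h t (ht.trans_le (min_le_left _ _))).1,
    (h t (ht.trans_le (min_le_left _ _))).2, h' (by rw [Real.dist_eq]; exact ht.trans_le (min_le_right _ _))⟩⟩

lemma Setup.rct (G : Setup a ax axx at' u ux uxx ut M T X ξ) {σ p y : ℝ}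
    (h : ∀ t ∈ Icc σ p, t ∈ Ioo 0 T ∧ ξ t < y) : Rec y X σ p ⊆ domLat ξ (fun _ => X) T :=
  fun q hq => ⟨⟨(h _ hq.1).1.1, (h _ hq.1).1.2.le⟩, ⟨(h _ hq.1).2.le.trans hq.2.1, hq.2.2⟩⟩

lemma Setup.uc (G : Setup a ax axx at' u ux uxx ut M T X ξ) {p l r : ℝ} (hp : p ∈ Ioo 0 T)
    (hl : ξ p ≤ l) (hlr : l < r) (hr : r ≤ X) : ∃ y ∈ Ioo l r, u y p ≠ 0 := by
  obtain ⟨δ, hδ, h⟩ := G.near0 hp (y := (l + r) / 2) (by linarith)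
  have hs := G.rct (σ := p - δ / 2) (p := p) (y := (l + r) / 2)
    (fun t ht => h t (abs_lt.2 ⟨by linarith [ht.1], by linarith [ht.2]⟩))
  obtain ⟨y, hy, h0⟩ := uc_ne (G.C.mono hs) (G.S.mono hs) ⟨by linarith, le_rfl⟩
    (G.hX p (Ioo_subset_Icc_self hp)) le_rfl (show (l + r) / 2 < r by linarith) hr
  exact ⟨y, ⟨by linarith [hy.1], hy.2⟩, h0⟩

lemma Setup.sturm (G : Setup a ax axx at' u ux uxx ut M T X ξ) {σ p y : ℝ} (hσ : σ < p) (hy : y < X)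
    (h : ∀ t ∈ Icc σ p, t ∈ Ioo 0 T ∧ ξ t < y ∧ u y t ≠ 0) :
    {x | x ∈ Ioo y X ∧ u x p = 0}.encard ≤ {x | x ∈ Ioo y X ∧ u x σ = 0}.encard := by
  have hs := G.rct fun t ht => ⟨(h t ht).1, (h t ht).2.1⟩
  exact _root_.sturm (G.C.mono hs) (G.S.mono hs) hσ (fun t ht => (h t ht).2.2)
    (fun t ht => G.hX t (Ioo_subset_Icc_self (h t ht).1)) hy.le

lemma Setup.nearN (G : Setup a ax axx at' u ux uxx ut M T X ξ) {p : ℝ} (hp : p ∈ Ioo 0 T)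
    (hN : u (ξ p) p ≠ 0) : ∃ y ∈ Ioo (ξ p) X, ∃ δ > 0, ∀ t, |t - p| < δ →
      t ∈ Ioo 0 T ∧ ξ t < y ∧ ∀ x ∈ Icc (ξ t) y, u x t ≠ 0 := by
  have hlt := G.lt p (Ioo_subset_Icc_self hp)
  have hc := (G.S.cu (ξ p, p) ⟨⟨hp.1, hp.2.le⟩, le_rfl, hlt.le⟩).eventually_ne hN
  rw [eventually_nhdsWithin_iff, Metric.eventually_nhds_iff] at hc
  obtain ⟨ε, hε, hc⟩ := hc
  obtain ⟨y, hy1, hy2⟩ := exists_between (lt_min hlt (show ξ p < ξ p + ε by linarith))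
  obtain ⟨δ, hδ, h⟩ := G.near0 hp hy1
  obtain ⟨δ', hδ', h'⟩ := Metric.continuousAt_iff.1 (G.ca hp) ε hε
  have hy3 := hy2.trans_le (min_le_left _ _)
  have hy4 := hy2.trans_le (min_le_right _ _)
  refine ⟨y, ⟨hy1, hy3⟩, min δ (min δ' ε), by positivity, fun t ht => ?_⟩
  simp only [lt_min_iff] at ht
  obtain ⟨h1, h2⟩ := h t ht.1
  have h3 := h' (x := t) (by rw [Real.dist_eq]; exact ht.2.1)
  rw [Real.dist_eq, abs_lt] at h3
  refine ⟨h1, h2, fun x hx => hc (y := (x, t)) ?_ ⟨⟨h1.1, h1.2.le⟩, hx.1, hx.2.trans hy3.le⟩⟩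
  rw [Prod.dist_eq, max_lt_iff, Real.dist_eq, Real.dist_eq]
  exact ⟨abs_lt.2 ⟨by linarith [hx.1, h3.1], by linarith [hx.2]⟩, ht.2.2⟩

/-- finiteness at N-moments -/
lemma Setup.finN (G : Setup a ax axx at' u ux uxx ut M T X ξ) {p : ℝ} (hp : p ∈ Ioo 0 T)
    (hN : u (ξ p) p ≠ 0) : Znum u ξ (fun _ => X) p < ⊤ := by
  obtain ⟨y, hy, δ, hδ, h⟩ := G.nearN hp hN
  have h' : ∀ t ∈ Icc (p - δ / 2) p, t ∈ Ioo 0 T ∧ ξ t < y ∧ ∀ x ∈ Icc (ξ t) y, u x t ≠ 0 :=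
    fun t ht => h t (abs_lt.2 ⟨by linarith [ht.1], by linarith [ht.2]⟩)
  have hs := G.rct fun t ht => ⟨(h' t ht).1, (h' t ht).2.1⟩
  have hf := fin_zeros (G.C.mono hs) (G.S.mono hs) (by linarith)
    (fun t ht => (h' t ht).2.2 y ⟨(h' t ht).2.1.le, le_rfl⟩)
    (fun t ht => G.hX t (Ioo_subset_Icc_self (h' t ht).1))
  rw [Znum, encard_lt_top_iff]
  refine hf.subset fun x hx => ⟨⟨?_, ?_⟩, hx.2⟩
  · by_contra hcon
    exact (h' p ⟨by linarith, le_rfl⟩).2.2 x ⟨hx.1.1, not_lt.1 hcon⟩ hx.2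
  · exact lt_of_le_of_ne hx.1.2 fun e => G.hX p (Ioo_subset_Icc_self hp) (e ▸ hx.2)

lemma Setup.right_pos (G : Setup a ax axx at' u ux uxx ut M T X ξ) {p y : ℝ} (hp : p ∈ Ioo 0 T)
    (hy : y ∈ Ioo (ξ p) X) (h : ∀ x ∈ Ioc (ξ p) y, 0 < u x p) (h0 : u (ξ p) p = 0)
    (h3 : ∃ ε > 0, ∀ t ∈ Ioo p (p + ε), 0 ≤ u (ξ t) t) :
    ∃ δ > 0, ∀ t ∈ Ioo p (p + δ), ∀ x ∈ Ioc (ξ t) y, 0 < u x t := by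
  obtain ⟨ε, hε, h3⟩ := h3
  have hyp := h y ⟨hy.1, le_rfl⟩
  obtain ⟨δ, hδ, hn⟩ := G.near hp hy hyp.ne'
  refine ⟨min δ ε, lt_min hδ hε, fun t ht x hx => ?_⟩
  have ht1 : t < p + δ := ht.2.trans_le (by gcongr; exact min_le_left _ _)
  have ht2 : t < p + ε := ht.2.trans_le (by gcongr; exact min_le_right _ _)
  have hn' : ∀ r ∈ Icc p t, r ∈ Ioo 0 T ∧ ξ r < y ∧ 0 < u y r := fun r hr => by
    obtain ⟨e1, e2, e3⟩ := hn r (abs_lt.2 ⟨by linarith [hr.1], by linarith [hr.2]⟩)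
    exact ⟨e1, e2, pos_of_mul_pos_right e3 hyp.le⟩
  have htI : t ∈ Icc p t := ⟨ht.1.le, le_rfl⟩
  have hw := mp_weak G.C G.S (A := ξ) (B := fun _ => y) (σ := p) (p := t)
    (G.cξ.mono fun r hr => Ioo_subset_Icc_self (hn' r hr).1) continuousOn_const
    (fun q hq => ⟨⟨(hn' _ hq.1).1.1, (hn' _ hq.1).1.2.le⟩, hq.2.1, hq.2.2.trans hy.2.le⟩)
    (fun r hr => by
      rcases hr.1.eq_or_lt with e | e
      · rw [← e, h0]
      · exact h3 r ⟨e, by linarith [hr.2]⟩)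
    (fun r hr => (hn' r hr).2.2.le)
    (fun x hx => by
      rcases hx.1.eq_or_lt with e | e
      · rw [← e, h0]
      · exact (h x ⟨e, hx.2⟩).le)
  set l := (ξ t + x) / 2 with hl
  have hlx : l < x := by linarith [hx.1]
  have hly : l < y := hlx.trans_le hx.2
  obtain ⟨δ', hδ', hn2⟩ := G.near0 (hn' t htI).1 (y := l) (by linarith [hx.1])
  set e := min (δ' / 2) (t - p) with he
  have he0 : 0 < e := lt_min (by linarith) (by linarith [ht.1])
  have he1 : e ≤ δ' / 2 := min_le_left _ _
  have he2 : e ≤ t - p := min_le_right _ _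
  have hv : 0 < (y - l) / e := div_pos (by linarith) he0
  have hin : ∀ r ∈ Icc (t - e) t, r ∈ Icc p t ∧ ∀ z, l + (y - l) / e * (t - r) ≤ z → ξ r ≤ z := by
    intro r hr
    refine ⟨⟨by linarith [hr.1], hr.2⟩, fun z hz => ?_⟩
    have := (hn2 r (abs_lt.2 ⟨by linarith [hr.1], by linarith [hr.2]⟩)).2
    have h5 : 0 ≤ (y - l) / e * (t - r) := mul_nonneg hv.le (by linarith [hr.2])
    linarith
  obtain ⟨κ, hκ, θ, hθ, hB⟩ := lemB G.C G.S (l := l) (y0 := y) (v := (y - l) / e) (ε := e) (p := t) hly hv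
    (by field_simp)
    (fun q hq => by
      obtain ⟨h5, h6⟩ := hin _ hq.1
      exact ⟨⟨(hn' _ h5).1.1, (hn' _ h5).1.2.le⟩, h6 _ hq.2.1, hq.2.2.trans hy.2.le⟩)
    (fun r hr x hx => hw r (hin r hr).1 x ⟨(hin r hr).2 x hx.1, hx.2⟩)
    (fun r hr => (hn' r (hin r hr).1).2.2)
  refine lt_of_lt_of_le (mul_pos hκ ?_) (hB x ⟨hlx.le, hx.2⟩)
  have : 0 < θ * (x - l) := mul_pos hθ (by linarith)
  linarith [Real.add_one_le_exp (θ * (x - l))]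

lemma Setup.left_pos (G : Setup a ax axx at' u ux uxx ut M T X ξ) {p y : ℝ} (hp : p ∈ Ioo 0 T)
    (hy : y ∈ Ioo (ξ p) X) (hy0 : u y p ≠ 0) (h0 : u (ξ p) p = 0) (hux : ux (ξ p) p ≤ 0)
    (hL : ∃ L : ℝ, HasDerivWithinAt ξ L (Iio p) p)
    (hpos : ∃ ε > 0, ∀ t ∈ Ioo (p - ε) p, 0 < u (ξ t) t) {δ : ℝ} (hδ : 0 < δ) :
    ∃ t ∈ Ioo (p - δ) p, ∃ w ∈ Icc (ξ t) y, u w t = 0 := by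
  by_contra hcon
  push Not at hcon
  obtain ⟨L, hL⟩ := hL
  obtain ⟨ε, hε, hpos⟩ := hpos
  obtain ⟨δ1, hδ1, hn⟩ := G.near hp hy hy0
  have hsl : ∀ᶠ t in 𝓝[<] p, ξ t ≤ ξ p + (|L| + 1) * (p - t) := by
    rw [hasDerivWithinAt_iff_tendsto_slope' (by simp)] at hL
    have h5 : -(|L| + 1) < L := by linarith [neg_abs_le L]
    filter_upwards [hL.eventually (lt_mem_nhds h5), self_mem_nhdsWithin] with t h6 h7
    have h7 : t < p := h7
    rw [slope_def_field, lt_div_iff_of_neg (by linarith)] at h6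
    linarith
  obtain ⟨t0, ht0, hsl⟩ := (mem_nhdsLT_iff_exists_Ioo_subset).1 hsl
  have ht0 : t0 < p := ht0
  set l := ξ p with hl
  -- small time step
  obtain ⟨e, he0, he⟩ : ∃ e > 0, e < δ ∧ e < ε ∧ e < δ1 ∧ e < p - t0 ∧ e < (y - l) / (|L| + 1) := by
    have h5 : 0 < (y - l) / (|L| + 1) := div_pos (by linarith [hy.1]) (by positivity)
    have h6 : 0 < min δ (min ε (min δ1 (min (p - t0) ((y - l) / (|L| + 1))))) := by
      simp only [lt_min_iff]; exact ⟨hδ, hε, hδ1, by linarith, h5⟩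
    obtain ⟨e, he, he'⟩ := exists_between h6
    exact ⟨e, he, by simpa only [lt_min_iff] using he'⟩
  obtain ⟨e1, e2, e3, e4, e5⟩ := he
  have hv : |L| + 1 ≤ (y - l) / e := by
    rw [lt_div_iff₀ (by positivity)] at e5
    rw [le_div_iff₀ he0]; linarith
  have hLp : 0 < |L| + 1 := by positivity
  have hn' : ∀ t ∈ Icc (p - e) p, t ∈ Ioo 0 T ∧ ξ t < y := fun t ht =>
    ⟨(hn t (abs_lt.2 ⟨by linarith [ht.1], by linarith [ht.2]⟩)).1,
      (hn t (abs_lt.2 ⟨by linarith [ht.1], by linarith [ht.2]⟩)).2.1⟩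
  have hlin : ∀ t ∈ Ico (p - e) p, ξ t ≤ l + (|L| + 1) * (p - t) := fun t ht =>
    hsl ⟨by linarith [ht.1], ht.2⟩
  have hlt : ∀ t ∈ Icc (p - e) p, ∀ z, l + (y - l) / e * (p - t) ≤ z → ξ t ≤ z := by
    intro t ht z hz
    rcases ht.2.eq_or_lt with h | h
    · rw [h] at hz ⊢; linarith
    · have h6 := hlin t ⟨ht.1, h⟩
      have h7 : (|L| + 1) * (p - t) ≤ (y - l) / e * (p - t) := by gcongr
      linarith
  have hu : ∀ t ∈ Ico (p - e) p, ∀ x ∈ Icc (ξ t) y, 0 < u x t := by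
    intro t ht
    have ht' := hn' t (Ico_subset_Icc_self ht)
    refine pos_of_ne (isPreconnected_Icc (a := ξ t) (b := y)) (f := fun x => u x t) (fun x hx => ?_)
      (hcon t ⟨by linarith [ht.1], ht.2⟩) ⟨le_rfl, ht'.2.le⟩ (hpos t ⟨by linarith [ht.1], ht.2⟩)
    exact (G.S.dx x t ⟨⟨ht'.1.1, ht'.1.2.le⟩, hx.1, hx.2.trans hy.2.le⟩).continuousAt.continuousWithinAt
  have hup : ∀ x ∈ Icc l y, 0 ≤ u x p := by
    intro x hx
    rcases hx.1.eq_or_lt with h | h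
    · rw [← h, h0]
    · have hc := (G.cut hp (y := x) ⟨hx.1, hx.2.trans hy.2.le⟩).tendsto.mono_left
        (nhdsWithin_le_nhds (s := Iio p))
      refine ge_of_tendsto hc ?_
      have h8 : ∀ᶠ t in 𝓝[<] p, ξ t < x := nhdsWithin_le_nhds ((G.ca hp).eventually (gt_mem_nhds h))
      filter_upwards [h8, Ioo_mem_nhdsLT (show p - e < p by linarith)] with t h9 h10
      exact (hu t ⟨h10.1.le, h10.2⟩ x ⟨h9.le, hx.2⟩).le
  have hypos : 0 < u y p := lt_of_le_of_ne (hup y ⟨hy.1.le, le_rfl⟩) hy0.symm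
  obtain ⟨κ, hκ, θ, hθ, hB⟩ := lemB G.C G.S (l := l) (y0 := y) (v := (y - l) / e) (ε := e) (p := p) hy.1
    (by linarith) (by field_simp)
    (fun q hq => ⟨⟨(hn' _ hq.1).1.1, (hn' _ hq.1).1.2.le⟩, hlt _ hq.1 _ hq.2.1, hq.2.2.trans hy.2.le⟩)
    (fun t ht x hx => by
      rcases ht.2.eq_or_lt with h | h
      · rw [h] at hx ⊢; exact hup x ⟨by linarith [hx.1], hx.2⟩
      · exact (hu t ⟨ht.1, h⟩ x ⟨hlt t ht x hx.1, hx.2⟩).le)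
    (fun t ht => by
      rcases ht.2.eq_or_lt with h | h
      · rw [h]; exact hypos
      · exact hu t ⟨ht.1, h⟩ y ⟨(hn' t ht).2.le, le_rfl⟩)
  have hd1 := G.S.dx l p ⟨⟨hp.1, hp.2.le⟩, le_rfl, (hy.1.trans hy.2).le⟩
  have hd2 : HasDerivAt (fun x => κ * (Real.exp (θ * (x - l)) - 1)) (κ * θ) l := by
    have := ((((hasDerivAt_id l).sub_const l).const_mul θ).exp.sub_const 1).const_mul κ
    simpa using this
  have hd : Tendsto _ (𝓝[>] l) _ := (hasDerivAt_iff_tendsto_slope.1 (hd1.sub hd2)).mono_left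
    (nhdsWithin_mono l (fun x (hx : l < x) => (ne_of_gt hx : x ≠ l)))
  have : 0 ≤ ux l p - κ * θ := by
    refine ge_of_tendsto hd ?_
    filter_upwards [Ioo_mem_nhdsGT hy.1] with x hx
    rw [slope_def_field]
    refine div_nonneg ?_ (by linarith [hx.1])
    have := hB x ⟨hx.1.le, hx.2.le⟩
    simp [h0]; linarith
  nlinarith [mul_pos hκ hθ]
end

section
variable {a ax axx at' u ux uxx ut : ℝ → ℝ → ℝ} {M T X : ℝ} {ξ : ℝ → ℝ}

def Nset (u : ℝ → ℝ → ℝ) (X y t : ℝ) : Set ℝ := {x | x ∈ Ioo y X ∧ u x t = 0}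

lemma Setup.zN (G : Setup a ax axx at' u ux uxx ut M T X ξ) {y t : ℝ} (ht : t ∈ Ioo 0 T)
    (h : ∀ x ∈ Icc (ξ t) y, u x t ≠ 0) : Znum u ξ (fun _ => X) t ≤ (Nset u X y t).encard := by
  refine encard_le_encard fun x hx => ⟨⟨?_, ?_⟩, hx.2⟩
  · by_contra hcon; exact h x ⟨hx.1.1, not_lt.1 hcon⟩ hx.2
  · exact lt_of_le_of_ne hx.1.2 fun e => G.hX t (Ioo_subset_Icc_self ht) (e ▸ hx.2)

lemma Setup.zN1 (G : Setup a ax axx at' u ux uxx ut M T X ξ) {y t : ℝ} (ht : t ∈ Ioo 0 T)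
    (h : ∀ x ∈ Ioc (ξ t) y, u x t ≠ 0) : Znum u ξ (fun _ => X) t ≤ (Nset u X y t).encard + 1 := by
  refine le_trans (encard_le_encard (t := insert (ξ t) (Nset u X y t)) fun x hx => ?_)
    (encard_insert_le _ _)
  rcases hx.1.1.eq_or_lt with e | e
  · exact Or.inl e.symm
  refine Or.inr ⟨⟨?_, ?_⟩, hx.2⟩
  · by_contra hcon; exact h x ⟨e, not_lt.1 hcon⟩ hx.2
  · exact lt_of_le_of_ne hx.1.2 fun e => G.hX t (Ioo_subset_Icc_self ht) (e ▸ hx.2)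

lemma Nset_le {y t : ℝ} (h : ξ t ≤ y) : (Nset u X y t).encard ≤ Znum u ξ (fun _ => X) t :=
  encard_le_encard fun x hx => ⟨⟨h.trans hx.1.1.le, hx.1.2.le⟩, hx.2⟩

lemma Nset_le1 {y t w : ℝ} (hw : w ∈ Icc (ξ t) y) (h0 : u w t = 0) (hy : y < X) :
    (Nset u X y t).encard + 1 ≤ Znum u ξ (fun _ => X) t := by
  have h1 : w ∉ Nset u X y t := fun h => absurd h.1.1 (not_lt.2 hw.2)
  rw [← encard_insert_of_notMem h1]
  refine encard_le_encard fun x hx => ?_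
  rcases hx with e | hx
  · rw [e]; exact ⟨⟨hw.1, hw.2.trans hy.le⟩, h0⟩
  · exact ⟨⟨hw.1.trans (hw.2.trans hx.1.1.le), hx.1.2.le⟩, hx.2⟩

lemma Setup.RL (G : Setup a ax axx at' u ux uxx ut M T X ξ) {p : ℝ} (hp : p ∈ Ioo 0 T)
    (hZ : Znum u ξ (fun _ => X) p ≠ ⊤) (h3 : u (ξ p) p = 0 → H3one u ξ p) :
    ∃ ε > 0, ∀ t ∈ Ioo p (p + ε), Znum u ξ (fun _ => X) t ≤ Znum u ξ (fun _ => X) p ∧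
      (u (ξ p) p = 0 → u (ξ t) t ≠ 0 → Znum u ξ (fun _ => X) t < Znum u ξ (fun _ => X) p) := by
  have hpI := Ioo_subset_Icc_self hp
  by_cases h0 : u (ξ p) p = 0
  swap
  · obtain ⟨y, hy, δ, hδ, h⟩ := G.nearN hp h0
    refine ⟨δ, hδ, fun t ht => ⟨?_, fun h' => absurd h' h0⟩⟩
    have h' : ∀ r ∈ Icc p t, r ∈ Ioo 0 T ∧ ξ r < y ∧ ∀ x ∈ Icc (ξ r) y, u x r ≠ 0 :=
      fun r hr => h r (abs_lt.2 ⟨by linarith [hr.1], by linarith [hr.2, ht.2]⟩)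
    have ht' := h' t ⟨ht.1.le, le_rfl⟩
    exact (G.zN ht'.1 ht'.2.2).trans ((G.sturm ht.1 hy.2 fun r hr =>
      ⟨(h' r hr).1, (h' r hr).2.1, (h' r hr).2.2 y ⟨(h' r hr).2.1.le, le_rfl⟩⟩).trans (Nset_le hy.1.le))
  obtain ⟨ε, hε, d, hd, h3⟩ := h3 h0
  have hfin : (zeroSet u ξ (fun _ => X) p).Finite := encard_ne_top_iff.1 hZ
  have hlt := G.lt p hpI
  obtain ⟨y, hy, hyne, hyd⟩ : ∃ y ∈ Ioo (ξ p) X, (∀ x ∈ Ioc (ξ p) y, u x p ≠ 0) ∧ y - ξ p < d := by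
    have h1 : (zeroSet u ξ (fun _ => X) p \ {ξ p})ᶜ ∈ 𝓝[>] (ξ p) :=
      nhdsWithin_le_nhds ((hfin.subset diff_subset).isClosed.isOpen_compl.mem_nhds (by simp))
    obtain ⟨r, hr, h2⟩ := mem_nhdsGT_iff_exists_Ioo_subset.1 h1
    have hr : ξ p < r := hr
    obtain ⟨y, hy1, hy2⟩ := exists_between (lt_min hr (lt_min hlt (show ξ p < ξ p + d by linarith)))
    simp only [lt_min_iff] at hy2
    refine ⟨y, ⟨hy1, hy2.2.1⟩, fun x hx h0 => ?_, by linarith [hy2.2.2]⟩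
    exact h2 ⟨hx.1, hx.2.trans_lt hy2.1⟩
      ⟨⟨⟨hx.1.le, hx.2.trans hy2.2.1.le⟩, h0⟩, ne_of_gt hx.1⟩
  have hyI : y ∈ Ioc (ξ p) y := ⟨hy.1, le_rfl⟩
  have hcx : ContinuousOn (fun x => u x p) (Ioc (ξ p) y) := fun x hx =>
    (G.S.dx x p ⟨⟨hp.1, hp.2.le⟩, hx.1.le, hx.2.trans hy.2.le⟩).continuousAt.continuousWithinAt
  obtain ⟨δ, hδ, hr⟩ : ∃ δ > 0, ∀ t ∈ Ioo p (p + δ), ∀ x ∈ Ioc (ξ t) y, u x t ≠ 0 := by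
    rcases (hyne y hyI).lt_or_gt with hs | hs
    · have h5 : ∀ x ∈ Ioc (ξ p) y, 0 < -u x p := pos_of_ne (isPreconnected_Ioc (a := ξ p) (b := y))
        hcx.neg (fun x hx => neg_ne_zero.2 (hyne x hx)) hyI (by simpa using hs)
      obtain ⟨δ, hδ, h⟩ := G.neg.right_pos hp hy h5 (by simp [h0])
        ⟨ε, hε, fun t ht => by nlinarith [h3 t ht y hy.1 hyd]⟩
      exact ⟨δ, hδ, fun t ht x hx h0 => absurd (h t ht x hx) (by simp [h0])⟩
    · have h5 : ∀ x ∈ Ioc (ξ p) y, 0 < u x p := pos_of_ne (isPreconnected_Ioc (a := ξ p) (b := y))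
        hcx hyne hyI hs
      obtain ⟨δ, hδ, h⟩ := G.right_pos hp hy h5 h0
        ⟨ε, hε, fun t ht => by nlinarith [h3 t ht y hy.1 hyd]⟩
      exact ⟨δ, hδ, fun t ht x hx => (h t ht x hx).ne'⟩
  obtain ⟨δ', hδ', hn⟩ := G.near hp hy (hyne y hyI)
  refine ⟨min δ δ', lt_min hδ hδ', fun t ht => ?_⟩
  have ht1 : t < p + δ := ht.2.trans_le (by gcongr; exact min_le_left _ _)
  have ht2 : t < p + δ' := ht.2.trans_le (by gcongr; exact min_le_right _ _)
  have hn' : ∀ r ∈ Icc p t, r ∈ Ioo 0 T ∧ ξ r < y ∧ u y r ≠ 0 := fun r hr => by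
    obtain ⟨e1, e2, e3⟩ := hn r (abs_lt.2 ⟨by linarith [hr.1], by linarith [hr.2]⟩)
    exact ⟨e1, e2, right_ne_zero_of_mul e3.ne'⟩
  have hS : (Nset u X y t).encard ≤ (Nset u X y p).encard := G.sturm ht.1 hy.2 hn'
  have hp1 : (Nset u X y p).encard + 1 ≤ Znum u ξ (fun _ => X) p := Nset_le1 ⟨le_rfl, hy.1.le⟩ h0 hy.2
  have htT := (hn' t ⟨ht.1.le, le_rfl⟩).1
  have hne := hr t ⟨ht.1, ht1⟩
  refine ⟨(G.zN1 htT hne).trans ((add_le_add hS le_rfl).trans hp1), fun _ h => ?_⟩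
  have h6 : Znum u ξ (fun _ => X) t ≤ (Nset u X y p).encard := by
    refine (G.zN htT (y := y) fun x hx => ?_).trans hS
    rcases hx.1.eq_or_lt with e | e
    · rwa [← e]
    · exact hne x ⟨e, hx.2⟩
  have h7 : (Nset u X y p).encard ≠ ⊤ := fun h => hZ (top_le_iff.1 (h ▸ Nset_le hy.1.le))
  exact ((ENat.lt_add_one_iff h7).2 h6).trans_le hp1

lemma Setup.cw (G : Setup a ax axx at' u ux uxx ut M T X ξ) :
    ContinuousOn (fun t => u (ξ t) t) (Ioo 0 T) :=
  G.S.cu.comp ((G.cξ.mono Ioo_subset_Icc_self).prodMk continuousOn_id) fun t ht =>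
    ⟨⟨ht.1, ht.2.le⟩, le_rfl, (G.lt t (Ioo_subset_Icc_self ht)).le⟩

lemma Setup.left_zero (G : Setup a ax axx at' u ux uxx ut M T X ξ) {p y : ℝ} (hp : p ∈ Ioo 0 T)
    (hy : y ∈ Ioo (ξ p) X) (hy0 : u y p ≠ 0) (h0 : u (ξ p) p = 0)
    (h2 : leftN (fun t => u (ξ t) t) p → (∃ L : ℝ, HasDerivWithinAt ξ L (Iio p) p) ∧
      ((∃ ε > 0, ∀ t ∈ Ioo (p - ε) p, 0 < u (ξ t) t) → ux (ξ p) p ≤ 0) ∧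
      ((∃ ε > 0, ∀ t ∈ Ioo (p - ε) p, u (ξ t) t < 0) → 0 ≤ ux (ξ p) p)) {δ : ℝ} (hδ : 0 < δ) :
    ∃ t ∈ Ioo (p - δ) p, ∃ w ∈ Icc (ξ t) y, u w t = 0 := by
  by_cases hN : leftN (fun t => u (ξ t) t) p
  · obtain ⟨hL, h2p, h2n⟩ := h2 hN
    obtain ⟨ε, hε, hN⟩ := hN
    set e := min ε p with he
    have he0 : 0 < e := lt_min hε hp.1
    have hsub : Ioo (p - e) p ⊆ Ioo 0 T := fun t ht =>
      ⟨by linarith [ht.1, min_le_right ε p], ht.2.trans hp.2⟩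
    have hN : ∀ t ∈ Ioo (p - e) p, u (ξ t) t ≠ 0 := fun t ht =>
      hN t ⟨by linarith [ht.1, min_le_left ε p], ht.2⟩
    have hm : p - e / 2 ∈ Ioo (p - e) p := ⟨by linarith, by linarith⟩
    rcases (hN _ hm).lt_or_gt with hs | hs
    · have h5 : ∀ t ∈ Ioo (p - e) p, 0 < -u (ξ t) t :=
        pos_of_ne isPreconnected_Ioo (G.cw.mono hsub).neg (fun t ht => neg_ne_zero.2 (hN t ht)) hm
          (by simpa using hs)
      have h6 := h2n ⟨e, he0, fun t ht => by linarith [h5 t ht]⟩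
      obtain ⟨t, ht, w, hw, h7⟩ := G.neg.left_pos hp hy (neg_ne_zero.2 hy0) (by simp [h0])
        (by simpa using h6) hL ⟨e, he0, h5⟩ hδ
      exact ⟨t, ht, w, hw, neg_eq_zero.1 h7⟩
    · have h5 : ∀ t ∈ Ioo (p - e) p, 0 < u (ξ t) t :=
        pos_of_ne isPreconnected_Ioo (G.cw.mono hsub) hN hm hs
      exact G.left_pos hp hy hy0 h0 (h2p ⟨e, he0, h5⟩) hL ⟨e, he0, h5⟩ hδ
  · obtain ⟨δ1, hδ1, hn⟩ := G.near0 hp hy.1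
    simp only [leftN] at hN
    push Not at hN
    obtain ⟨t, ht, h⟩ := hN (min δ δ1) (lt_min hδ hδ1)
    have e1 := min_le_left δ δ1
    have e2 := min_le_right δ δ1
    exact ⟨t, ⟨by linarith [ht.1], ht.2⟩, ξ t, ⟨le_rfl,
      (hn t (abs_lt.2 ⟨by linarith [ht.1], by linarith [ht.2]⟩)).2.le⟩, h⟩

lemma Setup.LL (G : Setup a ax axx at' u ux uxx ut M T X ξ) {p : ℝ} (hp : p ∈ Ioo 0 T)
    (h2 : u (ξ p) p = 0 → leftN (fun t => u (ξ t) t) p → (∃ L : ℝ, HasDerivWithinAt ξ L (Iio p) p) ∧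
      ((∃ ε > 0, ∀ t ∈ Ioo (p - ε) p, 0 < u (ξ t) t) → ux (ξ p) p ≤ 0) ∧
      ((∃ ε > 0, ∀ t ∈ Ioo (p - ε) p, u (ξ t) t < 0) → 0 ≤ ux (ξ p) p))
    {n : ℕ} (hn : (n : ℕ∞) ≤ Znum u ξ (fun _ => X) p) {δ : ℝ} (hδ : 0 < δ) :
    ∃ t ∈ Ioo (p - δ) p, (n : ℕ∞) ≤ Znum u ξ (fun _ => X) t := by
  have hpI := Ioo_subset_Icc_self hp
  by_cases h0 : u (ξ p) p = 0
  swap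
  · obtain ⟨y, hy, δ1, hδ1, h⟩ := G.nearN hp h0
    obtain ⟨e, he0, he⟩ := exists_between (lt_min hδ hδ1)
    simp only [lt_min_iff] at he
    have h' : ∀ r ∈ Icc (p - e) p, r ∈ Ioo 0 T ∧ ξ r < y ∧ ∀ x ∈ Icc (ξ r) y, u x r ≠ 0 :=
      fun r hr => h r (abs_lt.2 ⟨by linarith [hr.1], by linarith [hr.2]⟩)
    refine ⟨p - e, ⟨by linarith, by linarith⟩, hn.trans ?_⟩
    have ht' := h' p ⟨by linarith, le_rfl⟩
    exact (G.zN hp ht'.2.2).trans ((G.sturm (by linarith) hy.2 fun r hr =>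
      ⟨(h' r hr).1, (h' r hr).2.1, (h' r hr).2.2 y ⟨(h' r hr).2.1.le, le_rfl⟩⟩).trans
      (Nset_le (h' (p - e) ⟨le_rfl, by linarith⟩).2.1.le))
  rcases n with _ | m
  · exact ⟨p - δ / 2, ⟨by linarith, by linarith⟩, by simp⟩
  obtain ⟨F, hF, hc⟩ := finset_of_le hn
  have hF' : ∀ x ∈ F.erase (ξ p), x ∈ Ioo (ξ p) X ∧ u x p = 0 := fun x hx => by
    obtain ⟨h1, h2⟩ := Finset.mem_erase.1 hx
    obtain ⟨h3, h4⟩ := hF h2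
    exact ⟨⟨lt_of_le_of_ne h3.1 h1.symm, lt_of_le_of_ne h3.2 fun e => G.hX p hpI (e ▸ h4)⟩, h4⟩
  set K := insert X (F.erase (ξ p)) with hK
  have hKne : K.Nonempty := ⟨X, by simp [hK]⟩
  have hm1 : ξ p < K.min' hKne := by
    rw [Finset.lt_min'_iff]
    intro x hx
    rcases Finset.mem_insert.1 hx with e | e
    · rw [e]; exact G.lt p hpI
    · exact (hF' x e).1.1
  have hm2 : K.min' hKne ≤ X := Finset.min'_le _ _ (by simp [hK])
  obtain ⟨y, hy, hy0⟩ := G.uc hp le_rfl hm1 hm2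
  have hyI : y ∈ Ioo (ξ p) X := ⟨hy.1, hy.2.trans_le hm2⟩
  have hNp : (m : ℕ∞) ≤ (Nset u X y p).encard := by
    have h5 : (↑(F.erase (ξ p)) : Set ℝ) ⊆ Nset u X y p := fun x hx =>
      ⟨⟨hy.2.trans_le (Finset.min'_le _ _ (Finset.mem_insert_of_mem hx)), (hF' x hx).1.2⟩, (hF' x hx).2⟩
    refine le_trans ?_ (encard_le_encard h5)
    rw [encard_coe_eq_coe_finsetCard]
    have := Finset.pred_card_le_card_erase (s := F) (a := ξ p)
    exact_mod_cast (by omega : m ≤ (F.erase (ξ p)).card)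
  obtain ⟨δ1, hδ1, hnr⟩ := G.near hp hyI hy0
  obtain ⟨t, ht, w, hw, hw0⟩ := G.left_zero hp hyI hy0 h0 (h2 h0) (lt_min hδ hδ1)
  have e1 := min_le_left δ δ1
  have e2 := min_le_right δ δ1
  refine ⟨t, ⟨by linarith [ht.1], ht.2⟩, le_trans ?_ (Nset_le1 hw hw0 hyI.2)⟩
  have hS : (Nset u X y p).encard ≤ (Nset u X y t).encard := G.sturm ht.2 hyI.2 fun r hr => by
    obtain ⟨e1, e2, e3⟩ := hnr r (abs_lt.2 ⟨by linarith [hr.1, ht.1], by linarith [hr.2]⟩)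
    exact ⟨e1, e2, right_ne_zero_of_mul e3.ne'⟩
  push_cast
  exact add_le_add (hNp.trans hS) le_rfl

lemma Setup.mono (G : Setup a ax axx at' u ux uxx ut M T X ξ)
    (h2 : ∀ p ∈ Ioo 0 T, u (ξ p) p = 0 → leftN (fun t => u (ξ t) t) p →
      (∃ L : ℝ, HasDerivWithinAt ξ L (Iio p) p) ∧
      ((∃ ε > 0, ∀ t ∈ Ioo (p - ε) p, 0 < u (ξ t) t) → ux (ξ p) p ≤ 0) ∧
      ((∃ ε > 0, ∀ t ∈ Ioo (p - ε) p, u (ξ t) t < 0) → 0 ≤ ux (ξ p) p))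
    (h3 : ∀ p ∈ Ioo 0 T, u (ξ p) p = 0 → H3one u ξ p)
    {σ p : ℝ} (hσ : 0 < σ) (hσp : σ ≤ p) (hp : p < T) :
    Znum u ξ (fun _ => X) p ≤ Znum u ξ (fun _ => X) σ := by
  by_contra hcon
  rw [not_le] at hcon
  have hf : Znum u ξ (fun _ => X) σ ≠ ⊤ := hcon.ne_top
  obtain ⟨n, hn⟩ := ENat.ne_top_iff_exists.1 hf
  set S := {t | t ∈ Icc σ p ∧ ∀ r ∈ Icc σ t, Znum u ξ (fun _ => X) r ≤ Znum u ξ (fun _ => X) σ} with hS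
  have hσS : σ ∈ S := ⟨⟨le_rfl, hσp⟩, fun r hr => by rw [le_antisymm hr.2 hr.1]⟩
  have hb : BddAbove S := ⟨p, fun t ht => ht.1.2⟩
  set τ := sSup S with hτ
  have h1 : σ ≤ τ := le_csSup hb hσS
  have h4 : τ ≤ p := csSup_le ⟨σ, hσS⟩ fun t ht => ht.1.2
  have hτT : τ ∈ Ioo 0 T := ⟨by linarith, by linarith⟩
  have hbel : ∀ r ∈ Ico σ τ, Znum u ξ (fun _ => X) r ≤ Znum u ξ (fun _ => X) σ := fun r hr => by
    obtain ⟨t, ht, hrt⟩ := exists_lt_of_lt_csSup ⟨σ, hσS⟩ hr.2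
    exact ht.2 r ⟨hr.1, hrt.le⟩
  have hat : Znum u ξ (fun _ => X) τ ≤ Znum u ξ (fun _ => X) σ := by
    by_contra hc
    rw [not_le] at hc
    rcases h1.eq_or_lt with e | e
    · rw [← e] at hc; exact lt_irrefl _ hc
    have h5 : ((n + 1 : ℕ) : ℕ∞) ≤ Znum u ξ (fun _ => X) τ := by
      rw [← hn] at hc; push_cast; exact Order.add_one_le_of_lt hc
    obtain ⟨t, ht, h6⟩ := G.LL hτT (h2 τ hτT) h5 (show 0 < τ - σ by linarith)
    have h7 := h6.trans (hbel t ⟨by linarith [ht.1], ht.2⟩)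
    rw [← hn] at h7
    have : n + 1 ≤ n := by exact_mod_cast h7
    omega
  have hτp : τ < p := lt_of_le_of_ne h4 fun e => absurd (e ▸ hat) (not_le.2 hcon)
  obtain ⟨ε, hε, hR⟩ := G.RL hτT (fun e => hf (top_le_iff.1 (e ▸ hat))) (h3 τ hτT)
  obtain ⟨t, ht1, ht2⟩ := exists_between (lt_min hτp (show τ < τ + ε by linarith))
  simp only [lt_min_iff] at ht2
  have htS : t ∈ S := ⟨⟨by linarith, ht2.1.le⟩, fun r hr => by
    rcases lt_trichotomy r τ with h | h | h
    · exact hbel r ⟨hr.1, h⟩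
    · rw [h]; exact hat
    · exact (hR r ⟨h, by linarith [hr.2]⟩).1.trans hat⟩
  linarith [le_csSup hb htS]
end

/-- Lemma 2.7: across an A-type interval `A = (r,s) ∪ [s,r₁] ∪ (r₁,s₁)` of `w₁` one
has `Z(t₁) ≥ Z(s) ≥ Z(t₂) > Z(t₃)` for `t₁ ∈ (r,s)`, `t₂ ∈ (s,r₁]`, `t₃ ∈ (r₁,s₁)`. -/
theorem A_type_interval_decrease
    (T X : ℝ) (xi1 : ℝ → ℝ) (a b c u : ℝ → ℝ → ℝ)
    (hT : 0 < T)
    (hxc : ContinuousOn xi1 (Icc 0 T)) (hxlt : ∀ t ∈ Icc (0:ℝ) T, xi1 t < X)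
    (hsol : IsClassicalSolution a b c xi1 (fun _ => X) T u)
    (hreg : Reg12 a b c xi1 (fun _ => X) T)
    (hX : ∀ t ∈ Icc (0:ℝ) T, u X t ≠ 0)
    (hnz : ∀ t ∈ Icc (0:ℝ) T, ∃ x ∈ Icc (xi1 t) X, u x t ≠ 0)
    (hH1 : H1cond (bdryTrace u xi1) xi1 T)
    (hH2 : ∀ s ∈ Ioo (0:ℝ) T, IsNZstar (bdryTrace u xi1) s → H2at u xi1 (-1) s)
    (hH3 : ∀ s ∈ Ioo (0:ℝ) T, bdryTrace u xi1 s = 0 → H3one u xi1 s)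
    (r s r₁ s₁ : ℝ)
    (hr : 0 ≤ r) (hrs : r < s) (hsr₁ : s ≤ r₁) (hr₁s₁ : r₁ < s₁) (hs₁ : s₁ ≤ T)
    (hNl : ∀ t ∈ Ioo r s, u (xi1 t) t ≠ 0)
    (hNr : ∀ t ∈ Ioo r₁ s₁, u (xi1 t) t ≠ 0)
    (hZs : u (xi1 s) s = 0) (hZr₁ : u (xi1 r₁) r₁ = 0)
    (hcase : s = r₁ ∨
      (s < r₁ ∧ ∀ t ∈ Icc s r₁, u (xi1 t) t = 0) ∨
      (s < r₁ ∧ (∃ t ∈ Ioo s r₁, u (xi1 t) t = 0) ∧ (∃ t ∈ Ioo s r₁, u (xi1 t) t ≠ 0) ∧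
        ∀ t ∈ Ioc s r₁, Znum u xi1 (fun _ => X) t ≤ Znum u xi1 (fun _ => X) s)) :
    (∀ t₁ ∈ Ioo r s, Znum u xi1 (fun _ => X) s ≤ Znum u xi1 (fun _ => X) t₁) ∧
    (∀ t₂ ∈ Ioc s r₁, Znum u xi1 (fun _ => X) t₂ ≤ Znum u xi1 (fun _ => X) s) ∧
    (∀ t₂ ∈ Ioc s r₁, ∀ t₃ ∈ Ioo r₁ s₁,
      Znum u xi1 (fun _ => X) t₃ < Znum u xi1 (fun _ => X) t₂) ∧
    (∀ t₃ ∈ Ioo r₁ s₁, Znum u xi1 (fun _ => X) t₃ < Znum u xi1 (fun _ => X) s) := by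
  have hset : ∃ M, Setup a (pdx a) (pdxx a) (pdt a) u (pdx u) (pdxx u) (pdt u) M T X xi1 := by
    obtain ⟨M, hM⟩ := hreg
    have hab : M ≤ |M| + 1 := by linarith [le_abs_self M]
    refine ⟨|M| + 1, ⟨⟨by positivity, ?_, ?_, ?_, ?_, ?_, ?_, ?_, ?_⟩, ⟨?_, hsol.cont_x, hsol.cont_xx,
      hsol.cont_t, ?_, ?_, ?_, ?_⟩, hxc, hxlt, hX⟩⟩
    · exact fun x t m => (hM _ m).2.1.hasDerivAt
    · exact fun x t m => (hM _ m).2.2.1.hasDerivAt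
    · exact fun x t m => (hM _ m).2.2.2.1.hasDerivAt
    · intro x t m
      obtain ⟨h1, -, -, -, -, -, -, h8, -⟩ := hM _ m
      exact inv_le_of_inv_le₀ h1 ((le_abs_self _).trans (h8.trans hab))
    · intro x t m
      obtain ⟨-, -, -, -, -, -, h7, -⟩ := hM _ m
      exact (le_abs_self _).trans (h7.trans hab)
    · intro x t m
      obtain ⟨-, -, -, -, -, -, -, -, -, h10, -⟩ := hM _ m
      exact h10.trans hab
    · intro x t m
      obtain ⟨-, -, -, -, -, -, -, -, -, -, h11, -⟩ := hM _ m
      exact h11.trans hab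
    · intro x t m
      obtain ⟨-, -, -, -, -, -, -, -, h9, -⟩ := hM _ m
      exact h9.trans hab
    · exact hsol.cont.mono fun q hq => ⟨Ioc_subset_Icc_self hq.1, hq.2⟩
    · exact fun x t m => (hsol.diff_x _ m).hasDerivAt
    · exact fun x t m => (hsol.diff_xx _ m).hasDerivAt
    · exact fun x t m => (hsol.diff_t _ m).hasDerivAt
    · intro x t m
      obtain ⟨-, -, -, -, -, -, -, -, -, -, -, hb, -, -, hc⟩ := hM _ m
      have he : pdt u x t - a x t * pdxx u x t = b x t * pdx u x t + c x t * u x t := by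
        have := hsol.eqn _ m
        simp only at this
        rw [this]; ring
      rw [he]
      refine (abs_add_le _ _).trans ?_
      rw [abs_mul, abs_mul]
      have h1 := mul_le_mul_of_nonneg_right (hb.trans hab) (abs_nonneg (pdx u x t))
      have h2 := mul_le_mul_of_nonneg_right (hc.trans hab) (abs_nonneg (u x t))
      simp only at h1 h2
      linarith
  obtain ⟨M, G⟩ := hset
  have mono : ∀ {σ p : ℝ}, 0 < σ → σ ≤ p → p < T →
      Znum u xi1 (fun _ => X) p ≤ Znum u xi1 (fun _ => X) σ := by
    refine fun h1 h2 h3 => G.mono (fun p hp h0 hN => ?_) hH3 h1 h2 h3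
    obtain ⟨hL, hp1, hp2⟩ := hH2 p hp ⟨h0, hN⟩
    exact ⟨hL, fun h => by linarith [hp1 h], fun h => by linarith [hp2 h]⟩
  have hr0 : 0 < s := by linarith
  have key : ∀ t₃ ∈ Ioo r₁ s₁, Znum u xi1 (fun _ => X) t₃ < Znum u xi1 (fun _ => X) r₁ := by
    intro t ht
    have hrT : r₁ ∈ Ioo 0 T := ⟨by linarith, by linarith⟩
    by_cases hZ : Znum u xi1 (fun _ => X) r₁ = ⊤
    · rw [hZ]
      exact G.finN ⟨by linarith [ht.1], by linarith [ht.2]⟩ (hNr t ht)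
    obtain ⟨ε, hε, hR⟩ := G.RL hrT hZ (hH3 r₁ hrT)
    obtain ⟨t', h1, h2⟩ := exists_between (lt_min ht.1 (show r₁ < r₁ + ε by linarith))
    simp only [lt_min_iff] at h2
    exact (mono (by linarith) h2.1.le (by linarith [ht.2])).trans_lt
      ((hR t' ⟨h1, h2.2⟩).2 hZr₁ (hNr t' ⟨h1, by linarith [ht.2]⟩))
  refine ⟨fun t ht => mono (by linarith [ht.1]) ht.2.le (by linarith),
    fun t ht => mono hr0 ht.1.le (by linarith [ht.2]),
    fun t ht t₃ h => (key t₃ h).trans_le (mono (by linarith [ht.1]) ht.2 (by linarith)),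
    fun t₃ h => (key t₃ h).trans_le (mono hr0 hsr₁ (by linarith))⟩
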